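/- arXiv:1505.03012 — 4 statements merged into one kernel-verified Lean document; each statement's English description precedes it below -/
import Mathlib

section
/- Let (u₁, u₂) be a C² solution on all of ℝ² of the G₂ Toda system with constant coefficients: Δu₁ + 2e^{u₁} − e^{u₂} = 0 and Δu₂ − 3e^{u₁} + 2e^{u₂} = 0 in ℝ², and assume the finite energy conditions ∫_{ℝ²} e^{u₁} < ∞ and ∫_{ℝ²} e^{u₂} < ∞. Then (1/(2π)) ∫_{ℝ²} e^{u₁} = 12 and (1/(2π)) ∫_{ℝ²} e^{u₂} = 20. -/
noncomputable section
open Real MeasureTheory Metric Filter Topology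

/-- The plane `ℝ²` with the Euclidean metric. -/
abbrev E2 := EuclideanSpace ℝ (Fin 2)

/-- The Euclidean Laplacian on `ℝ²`: `Δu = ∂²u/∂x₁² + ∂²u/∂x₂²`. -/
noncomputable def lap (u : E2 → ℝ) (x : E2) : ℝ :=
  ∑ i : Fin 2, fderiv ℝ (fun y => fderiv ℝ u y (EuclideanSpace.single i 1)) x
    (EuclideanSpace.single i 1)

open scoped ContDiff

/-- The real-linear map `v ↦ a v + b v̄`. -/
def wirtCLM (a b : ℂ) : ℂ →L[ℝ] ℂ :=
  a • (ContinuousLinearMap.id ℝ ℂ) + b • (Complex.conjCLE : ℂ →L[ℝ] ℂ)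

@[simp] lemma wirtCLM_apply (a b v : ℂ) : wirtCLM a b v = a * v + b * (starRingEnd ℂ) v := by
  simp [wirtCLM]

/-- The Wirtinger derivative `∂f/∂z`. -/
def dz (f : ℂ → ℂ) (z : ℂ) : ℂ := (fderiv ℝ f z 1 - Complex.I * fderiv ℝ f z Complex.I) / 2

/-- The Wirtinger derivative `∂f/∂z̄`. -/
def db (f : ℂ → ℂ) (z : ℂ) : ℂ := (fderiv ℝ f z 1 + Complex.I * fderiv ℝ f z Complex.I) / 2

/-- `f` is real differentiable at `z` with Wirtinger derivatives `a` and `b`. -/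
def HasW (f : ℂ → ℂ) (a b z : ℂ) : Prop := HasFDerivAt f (wirtCLM a b) z

lemma clm_eq_wirtCLM (L : ℂ →L[ℝ] ℂ) :
    L = wirtCLM ((L 1 - Complex.I * L Complex.I) / 2) ((L 1 + Complex.I * L Complex.I) / 2) := by
  ext v
  have hv : v = v.re • (1 : ℂ) + v.im • Complex.I := by
    simp [Complex.re_add_im]
  have h1 : L v = v.re * L 1 + v.im * L Complex.I := by
    conv_lhs => rw [hv]
    rw [map_add, map_smul, map_smul]; simp
  rw [h1, wirtCLM_apply]
  have h2 : v = v.re + v.im * Complex.I := (Complex.re_add_im v).symm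
  have h3 : (starRingEnd ℂ) v = v.re - v.im * Complex.I := by
    apply Complex.ext <;> simp
  rw [h3]
  conv_rhs => rw [h2]
  simp only [Complex.add_re, Complex.ofReal_re, Complex.mul_re, Complex.I_re, mul_zero,
    Complex.ofReal_im, Complex.I_im, mul_one, sub_self, add_zero, Complex.add_im, Complex.mul_im,
    zero_add]
  linear_combination ((v.im : ℂ) * L Complex.I) * Complex.I_mul_I

lemma DifferentiableAt.hasW {f : ℂ → ℂ} {z : ℂ} (h : DifferentiableAt ℝ f z) :
    HasW f (dz f z) (db f z) z := by
  unfold HasW dz db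
  rw [← clm_eq_wirtCLM]
  exact h.hasFDerivAt

namespace HasW
variable {f g : ℂ → ℂ} {a b a' b' z : ℂ}

lemma dz_eq (h : HasW f a b z) : dz f z = a := by
  unfold dz
  rw [HasFDerivAt.fderiv h]
  simp only [wirtCLM_apply, map_one, Complex.conj_I]
  linear_combination (-(a - b) / 2) * Complex.I_mul_I

lemma db_eq (h : HasW f a b z) : db f z = b := by
  unfold db
  rw [HasFDerivAt.fderiv h]
  simp only [wirtCLM_apply, map_one, Complex.conj_I]
  linear_combination ((a - b) / 2) * Complex.I_mul_I

lemma congr' (h : HasW f a b z) (ha : a = a') (hb : b = b') : HasW f a' b' z := by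
  subst ha hb; exact h

lemma add (h : HasW f a b z) (h' : HasW g a' b' z) :
    HasW (fun w => f w + g w) (a + a') (b + b') z := by
  refine (HasFDerivAt.add h h').congr_fderiv ?_
  ext v; simp; ring

lemma sub (h : HasW f a b z) (h' : HasW g a' b' z) :
    HasW (fun w => f w - g w) (a - a') (b - b') z := by
  refine (HasFDerivAt.sub h h').congr_fderiv ?_
  ext v; simp; ring

lemma neg (h : HasW f a b z) : HasW (fun w => -f w) (-a) (-b) z := by
  refine (HasFDerivAt.neg h).congr_fderiv ?_
  ext v; simp; ring

lemma mul (h : HasW f a b z) (h' : HasW g a' b' z) :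
    HasW (fun w => f w * g w) (a * g z + f z * a') (b * g z + f z * b') z := by
  refine (HasFDerivAt.mul h h').congr_fderiv ?_
  ext v; simp; ring

lemma const (c : ℂ) : HasW (fun _ => c) 0 0 z := by
  refine (hasFDerivAt_const c z).congr_fderiv ?_
  ext v; simp

lemma const_mul (c : ℂ) (h : HasW f a b z) : HasW (fun w => c * f w) (c * a) (c * b) z :=
  ((HasW.const c).mul h).congr' (by ring) (by ring)

lemma id : HasW (fun w => w) 1 0 z := by
  refine (hasFDerivAt_id z).congr_fderiv ?_
  ext v; simp

lemma conj (h : HasW f a b z) :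
    HasW (fun w => (starRingEnd ℂ) (f w)) ((starRingEnd ℂ) b) ((starRingEnd ℂ) a) z := by
  refine ((Complex.conjCLE : ℂ →L[ℝ] ℂ).hasFDerivAt.comp z h).congr_fderiv ?_
  ext v; simp; ring

lemma comp_hol {φ : ℂ → ℂ} {d : ℂ} (hφ : HasDerivAt φ d (f z)) (h : HasW f a b z) :
    HasW (fun w => φ (f w)) (d * a) (d * b) z := by
  refine ((hφ.hasFDerivAt.restrictScalars ℝ).comp z h).congr_fderiv ?_
  ext v; simp; ring

lemma cexp (h : HasW f a b z) :
    HasW (fun w => Complex.exp (f w)) (Complex.exp (f z) * a) (Complex.exp (f z) * b) z :=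
  comp_hol (Complex.hasDerivAt_exp _) h

lemma pow (h : HasW f a b z) (n : ℕ) :
    HasW (fun w => f w ^ n) (n * f z ^ (n - 1) * a) (n * f z ^ (n - 1) * b) z :=
  comp_hol (hasDerivAt_pow n (f z)) h

lemma comp_affine {c : ℂ} {R : ℝ} (h : HasW f a b (c + R * z)) :
    HasW (fun w => f (c + R * w)) (R * a) (R * b) z := by
  have h1 : HasFDerivAt (𝕜 := ℝ) (fun w : ℂ => c + R * w) (wirtCLM R 0) z :=
    ((HasW.const c).add (HasW.id.const_mul (R : ℂ))).congr' (by simp) (by simp)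
  refine (HasFDerivAt.comp (f := fun w : ℂ => c + R * w) z h h1).congr_fderiv ?_
  ext v; simp; ring

lemma hasDerivAt_comp {γ : ℝ → ℂ} {γ' : ℂ} {t : ℝ} (h : HasW f a b (γ t))
    (hγ : HasDerivAt γ γ' t) :
    HasDerivAt (fun s => f (γ s)) (a * γ' + b * (starRingEnd ℂ) γ') t := by
  refine (HasFDerivAt.comp_hasDerivAt t h hγ).congr_deriv ?_
  simp

end HasW

lemma ContDiff.dz {f : ℂ → ℂ} {n m : WithTop ℕ∞} (h : ContDiff ℝ n f) (hmn : m + 1 ≤ n) :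
    ContDiff ℝ m (dz f) := by
  have h1 := h.fderiv_right hmn
  unfold _root_.dz
  exact ((h1.clm_apply contDiff_const).sub
    (contDiff_const.mul (h1.clm_apply contDiff_const))).div_const 2

lemma ContDiff.db {f : ℂ → ℂ} {n m : WithTop ℕ∞} (h : ContDiff ℝ n f) (hmn : m + 1 ≤ n) :
    ContDiff ℝ m (db f) := by
  have h1 := h.fderiv_right hmn
  unfold _root_.db
  exact ((h1.clm_apply contDiff_const).add
    (contDiff_const.mul (h1.clm_apply contDiff_const))).div_const 2

lemma ContDiff.hasW {f : ℂ → ℂ} {n : WithTop ℕ∞} (h : ContDiff ℝ n f) (hn : n ≠ 0) (z : ℂ) :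
    HasW f (_root_.dz f z) (_root_.db f z) z :=
  (h.differentiable hn z).hasW

lemma dz_db_comm {f : ℂ → ℂ} (h : ContDiff ℝ 2 f) (z : ℂ) : dz (db f) z = db (dz f) z := by
  have hd : DifferentiableAt ℝ (fderiv ℝ f) z :=
    (h.fderiv_right (m := 1) (by norm_num)).differentiable (by norm_num) z
  have hs : IsSymmSndFDerivAt ℝ f z := h.contDiffAt.isSymmSndFDerivAt (by simp)
  have key : ∀ (c v : ℂ), HasFDerivAt (𝕜 := ℝ)
      (fun w => (fderiv ℝ f w 1 + c * fderiv ℝ f w Complex.I) / 2)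
      ((2⁻¹ : ℂ) • ((fderiv ℝ (fderiv ℝ f) z).flip 1
        + c • (fderiv ℝ (fderiv ℝ f) z).flip Complex.I)) z := by
    intro c v
    have e1 := hd.hasFDerivAt.clm_apply (hasFDerivAt_const (1 : ℂ) z)
    have e2 := hd.hasFDerivAt.clm_apply (hasFDerivAt_const Complex.I z)
    have := ((e1.add (e2.const_mul c)).const_mul (2⁻¹ : ℂ))
    refine (this.congr_fderiv ?_).congr_of_eventuallyEq ?_
    · ext v; simp
    · filter_upwards with w
      simp; ring
  have h1 := (key Complex.I 0).fderiv
  have h2 := (key (-Complex.I) 0).fderiv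
  have e1 : db f = fun w => (fderiv ℝ f w 1 + Complex.I * fderiv ℝ f w Complex.I) / 2 := rfl
  have e2 : dz f = fun w => (fderiv ℝ f w 1 + -Complex.I * fderiv ℝ f w Complex.I) / 2 := by
    ext w; unfold dz; ring
  rw [dz, e1, h1, db, e2, h2]
  have := hs.eq 1 Complex.I
  simp [this]
  ring

/-- The integral of `f` over the circle of centre `c` and radius `r`, with respect to the angle. -/
def circ (f : ℂ → ℂ) (c : ℂ) (r : ℝ) : ℂ := ∫ θ in (-π)..π, f (circleMap c r θ)

lemma hasDerivAt_intervalIntegral_of_continuous {F F' : ℝ → ℝ → ℂ} {a b r : ℝ}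
    (hF : Continuous F.uncurry) (hF' : Continuous F'.uncurry)
    (h : ∀ x t, HasDerivAt (fun x => F x t) (F' x t) x) :
    HasDerivAt (fun x => ∫ t in a..b, F x t) (∫ t in a..b, F' r t) r := by
  obtain ⟨C, hC⟩ := ((isCompact_Icc (a := r - 1) (b := r + 1)).prod
    (isCompact_uIcc (a := a) (b := b))).exists_bound_of_continuousOn hF'.continuousOn
  refine (intervalIntegral.hasDerivAt_integral_of_dominated_loc_of_deriv_le (bound := fun _ => C)
    (Icc_mem_nhds (by linarith : r - 1 < r) (by linarith : r < r + 1)) ?_ ?_ ?_ ?_ ?_ ?_).2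
  · exact Eventually.of_forall fun x =>
      (hF.comp (Continuous.prodMk_right x)).aestronglyMeasurable
  · exact (hF.comp (Continuous.prodMk_right r)).intervalIntegrable _ _
  · exact (hF'.comp (Continuous.prodMk_right r)).aestronglyMeasurable
  · refine Eventually.of_forall fun t ht x hx => hC (x, t) ⟨hx, Set.uIoc_subset_uIcc ht⟩
  · exact intervalIntegrable_const
  · exact Eventually.of_forall fun t _ x _ => h x t

lemma circleMap_eq (c : ℂ) (r θ : ℝ) : circleMap c r θ = c + r * Complex.exp (θ * Complex.I) := rfl

lemma continuous_circleMap_uncurry (c : ℂ) :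
    Continuous (fun p : ℝ × ℝ => circleMap c p.1 p.2) := by
  unfold circleMap; fun_prop

lemma hasDerivAt_circleMap_radius (c : ℂ) (r θ : ℝ) :
    HasDerivAt (fun r => circleMap c r θ) (Complex.exp (θ * Complex.I)) r := by
  have := (((hasDerivAt_id r).ofReal_comp).mul_const (Complex.exp (θ * Complex.I))).const_add c
  simpa [circleMap] using this

lemma conj_exp_I (θ : ℝ) :
    (starRingEnd ℂ) (Complex.exp (θ * Complex.I)) = Complex.exp (-(θ * Complex.I)) := by
  rw [← Complex.exp_conj]; simp

lemma continuous_circ {f : ℂ → ℂ} (hf : Continuous f) (c : ℂ) : Continuous (circ f c) :=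
  intervalIntegral.continuous_parametric_intervalIntegral_of_continuous'
    (f := fun r θ => f (circleMap c r θ)) (hf.comp (continuous_circleMap_uncurry c)) _ _

lemma circ_zero (f : ℂ → ℂ) (c : ℂ) : circ f c 0 = 2 * π * f c := by
  simp only [circ, circleMap_zero_radius, Function.const_apply, intervalIntegral.integral_const,
    Complex.real_smul]
  push_cast; ring

lemma circ_congr {f g : ℂ → ℂ} {c : ℂ} {r : ℝ} (h : ∀ z ∈ sphere c |r|, f z = g z) :
    circ f c r = circ g c r :=
  intervalIntegral.integral_congr fun θ _ => h _ (circleMap_mem_sphere' c r θ)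

lemma circ_const_mul (a : ℂ) (f : ℂ → ℂ) (c : ℂ) (r : ℝ) :
    circ (fun z => a * f z) c r = a * circ f c r :=
  intervalIntegral.integral_const_mul _ _

lemma circleMap_integrable {f : ℂ → ℂ} (hf : Continuous f) (c : ℂ) (r a b : ℝ) :
    IntervalIntegrable (fun θ => f (circleMap c r θ)) volume a b :=
  (hf.comp (continuous_circleMap c r)).intervalIntegrable _ _

section
variable {h : ℂ → ℂ} (hh : ContDiff ℝ 1 h) (c : ℂ)
include hh

lemma circ_aux {r : ℝ} :
    (∫ θ in (-π)..π, Complex.exp (θ * Complex.I) * dz h (circleMap c r θ)) * r =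
    (∫ θ in (-π)..π, Complex.exp (-(θ * Complex.I)) * db h (circleMap c r θ)) * r := by
  have hz : Continuous (dz h) := (hh.dz (m := 0) (by norm_num)).continuous
  have hb : Continuous (db h) := (hh.db (m := 0) (by norm_num)).continuous
  have hd : ∀ θ ∈ Set.uIcc (-π) π, HasDerivAt (fun θ => h (circleMap c r θ))
      (Complex.I * (Complex.exp (θ * Complex.I) * dz h (circleMap c r θ) * r
        - Complex.exp (-(θ * Complex.I)) * db h (circleMap c r θ) * r)) θ := by
    intro θ _
    refine ((hh.hasW one_ne_zero _).hasDerivAt_comp (hasDerivAt_circleMap c r θ)).congr_deriv ?_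
    simp only [circleMap_eq, map_mul, map_add, conj_exp_I, Complex.conj_I, Complex.conj_ofReal,
      map_zero]
    ring
  have hi := intervalIntegral.integral_eq_sub_of_hasDerivAt hd
    (Continuous.intervalIntegrable (by
      have := continuous_circleMap c r
      fun_prop) _ _)
  have hper : circleMap c r π = circleMap c r (-π) := by
    have := periodic_circleMap c r (-π)
    rw [← this]; ring_nf
  rw [hper, sub_self, intervalIntegral.integral_const_mul, intervalIntegral.integral_sub,
    intervalIntegral.integral_mul_const, intervalIntegral.integral_mul_const] at hi
  · exact sub_eq_zero.mp ((mul_eq_zero.mp hi).resolve_left Complex.I_ne_zero)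
  all_goals
    refine Continuous.intervalIntegrable ?_ _ _
    have := continuous_circleMap c r
    fun_prop

lemma hasDerivAt_circ_aux (r : ℝ) :
    HasDerivAt (circ h c)
      ((∫ θ in (-π)..π, Complex.exp (θ * Complex.I) * dz h (circleMap c r θ)) +
      ∫ θ in (-π)..π, Complex.exp (-(θ * Complex.I)) * db h (circleMap c r θ)) r := by
  have hz : Continuous (dz h) := (hh.dz (m := 0) (by norm_num)).continuous
  have hb : Continuous (db h) := (hh.db (m := 0) (by norm_num)).continuous
  have hc := continuous_circleMap_uncurry c
  rw [← intervalIntegral.integral_add]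
  · refine hasDerivAt_intervalIntegral_of_continuous (F := fun r θ => h (circleMap c r θ))
      (F' := fun r θ => Complex.exp (θ * Complex.I) * dz h (circleMap c r θ) +
        Complex.exp (-(θ * Complex.I)) * db h (circleMap c r θ)) (hh.continuous.comp hc) ?_ ?_
    · simp only [Function.uncurry_def]; fun_prop
    · intro x t
      refine ((hh.hasW one_ne_zero _).hasDerivAt_comp
        (hasDerivAt_circleMap_radius c x t)).congr_deriv ?_
      simp only [conj_exp_I]
      ring
  all_goals
    refine Continuous.intervalIntegrable ?_ _ _
    have := continuous_circleMap c r
    fun_prop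

lemma hasDerivAt_circ_db {r : ℝ} (hr : r ≠ 0) :
    HasDerivAt (circ h c)
      (2 * ∫ θ in (-π)..π, Complex.exp (-(θ * Complex.I)) * db h (circleMap c r θ)) r := by
  have := mul_right_cancel₀ (by exact_mod_cast hr) (circ_aux hh c (r := r))
  convert hasDerivAt_circ_aux hh c r using 1
  rw [this]; ring

lemma hasDerivAt_circ_dz {r : ℝ} (hr : r ≠ 0) :
    HasDerivAt (circ h c)
      (2 * ∫ θ in (-π)..π, Complex.exp (θ * Complex.I) * dz h (circleMap c r θ)) r := by
  have := mul_right_cancel₀ (by exact_mod_cast hr) (circ_aux hh c (r := r))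
  convert hasDerivAt_circ_aux hh c r using 1
  rw [← this]; ring

end

section polar

lemma polarCoord_symm_add (c : ℂ) (p : ℝ × ℝ) :
    c + Complex.polarCoord.symm p = circleMap c p.1 p.2 := by
  rw [Complex.polarCoord_symm_apply, circleMap_eq, Complex.exp_mul_I]
  push_cast; ring_nf

lemma integrable_polar {F : ℂ → ℂ} (hm : Measurable F) (hF : Integrable F) (c : ℂ) :
    Integrable (fun p : ℝ × ℝ => p.1 * F (circleMap c p.1 p.2))
      ((volume.restrict (Set.Ioi 0)).prod (volume.restrict (Set.Ioo (-π) π))) := by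
  have hmeas : Measurable (fun p : ℝ × ℝ => (p.1 : ℂ) * F (circleMap c p.1 p.2)) := by
    have := (continuous_circleMap_uncurry c).measurable
    fun_prop
  refine ⟨hmeas.aestronglyMeasurable, ?_⟩
  have h1 := (hF.comp_add_left c).2
  rw [HasFiniteIntegral, ← Complex.lintegral_comp_polarCoord_symm] at h1
  rw [HasFiniteIntegral, Measure.prod_restrict, ← Measure.volume_eq_prod]
  refine lt_of_eq_of_lt (setLIntegral_congr_fun polarCoord.open_target.measurableSet ?_) h1
  intro p hp
  have hp1 : 0 < p.1 := hp.1
  simp only [smul_eq_mul, polarCoord_symm_add, enorm_mul]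
  congr 1
  rw [← ofReal_norm]
  simp [abs_of_pos hp1]

lemma circ_eq_setIntegral (F : ℂ → ℂ) (c : ℂ) (r : ℝ) :
    circ F c r = ∫ θ in Set.Ioo (-π) π, F (circleMap c r θ) := by
  rw [circ, intervalIntegral.integral_of_le (by linarith [pi_pos]), integral_Ioc_eq_integral_Ioo]

lemma integrableOn_mul_circ {F : ℂ → ℂ} (hm : Measurable F) (hF : Integrable F) (c : ℂ) :
    IntegrableOn (fun r : ℝ => r * circ F c r) (Set.Ioi 0) := by
  have := (integrable_polar hm hF c).integral_prod_left
  simp only [integral_const_mul, ← circ_eq_setIntegral] at this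
  exact this

lemma integral_mul_circ {F : ℂ → ℂ} (hm : Measurable F) (hF : Integrable F) (c : ℂ) :
    ∫ r in Set.Ioi (0 : ℝ), r * circ F c r = ∫ z, F z := by
  have h1 := integral_prod _ (integrable_polar hm hF c)
  simp only [integral_const_mul, ← circ_eq_setIntegral] at h1
  rw [← h1, ← integral_add_left_eq_self F c, ← Complex.integral_comp_polarCoord_symm,
    Measure.prod_restrict, ← Measure.volume_eq_prod]
  refine setIntegral_congr_fun polarCoord.open_target.measurableSet fun p _ => ?_
  simp only [polarCoord_symm_add, Complex.real_smul]

lemma setIntegral_ball_eq {F : ℂ → ℂ} (hF : Continuous F) (c : ℂ) {ρ : ℝ} (hρ : 0 ≤ ρ) :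
    ∫ z in ball c ρ, F z = ∫ r in (0 : ℝ)..ρ, r * circ F c r := by
  have hi : Integrable ((ball c ρ).indicator F) :=
    ((hF.continuousOn.integrableOn_compact (isCompact_closedBall c ρ)).mono_set
      ball_subset_closedBall).integrable_indicator isOpen_ball.measurableSet
  rw [← integral_indicator isOpen_ball.measurableSet,
    ← integral_mul_circ (hF.measurable.indicator isOpen_ball.measurableSet) hi c,
    intervalIntegral.integral_of_le hρ, integral_Ioc_eq_integral_Ioo]
  have : Set.Ioo 0 ρ ⊆ Set.Ioi 0 := Set.Ioo_subset_Ioi_self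
  refine (setIntegral_eq_of_subset_of_forall_sdiff_eq_zero measurableSet_Ioi this ?_).trans ?_
  rotate_left
  · refine setIntegral_congr_fun measurableSet_Ioo fun r hr => ?_
    congr 1
    refine circ_congr fun z hz => Set.indicator_of_mem ?_ _
    rw [mem_sphere, abs_of_pos hr.1] at hz
    rw [mem_ball, hz]; exact hr.2
  · intro r hr
    have hr0 : 0 < r := hr.1
    have hr1 : ρ ≤ r := by
      by_contra h; exact hr.2 ⟨hr0, not_le.mp h⟩
    rw [circ_congr (g := fun _ => 0)]
    · simp [circ]
    · intro z hz
      refine Set.indicator_of_notMem ?_ _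
      rw [mem_sphere, abs_of_pos hr0] at hz
      rw [mem_ball, hz]; exact not_lt.mpr hr1

end polar

lemma lintegral_ball_inv_norm (c : ℂ) {ρ : ℝ} (hρ : 0 ≤ ρ) :
    ∫⁻ y in ball c ρ, ENNReal.ofReal ‖y - c‖⁻¹ ≤ ENNReal.ofReal (2 * π * ρ) := by
  rw [← lintegral_indicator isOpen_ball.measurableSet,
    ← lintegral_add_right_eq_self _ c, ← Complex.lintegral_comp_polarCoord_symm]
  calc _ ≤ ∫⁻ p in polarCoord.target, (Set.Ioo (0 : ℝ) ρ ×ˢ Set.Ioo (-π) π).indicator 1 p := by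
        refine setLIntegral_mono' polarCoord.open_target.measurableSet fun p hp => ?_
        have hp1 : 0 < p.1 := hp.1
        have hn : ‖Complex.polarCoord.symm p‖ = p.1 := by
          rw [Complex.norm_polarCoord_symm, abs_of_pos hp1]
        by_cases h : p.1 < ρ
        · rw [Set.indicator_of_mem (by simp only [mem_ball, dist_eq_norm, add_sub_cancel_right, hn, h]),
            Set.indicator_of_mem (show p ∈ Set.Ioo (0 : ℝ) ρ ×ˢ Set.Ioo (-π) π from ⟨⟨hp1, h⟩, hp.2⟩),
            add_sub_cancel_right, hn, smul_eq_mul, ← ENNReal.ofReal_mul hp1.le,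
            mul_inv_cancel₀ hp1.ne']
          simp
        · rw [Set.indicator_of_notMem (by
            simp only [mem_ball, dist_eq_norm, add_sub_cancel_right, hn, h, not_false_eq_true])]
          simp
    _ ≤ ∫⁻ p : ℝ × ℝ, (Set.Ioo (0 : ℝ) ρ ×ˢ Set.Ioo (-π) π).indicator 1 p :=
        setLIntegral_le_lintegral _ _
    _ = ENNReal.ofReal (2 * π * ρ) := by
        rw [lintegral_indicator_one (measurableSet_Ioo.prod measurableSet_Ioo),
          Measure.volume_eq_prod, Measure.prod_prod, Real.volume_Ioo, Real.volume_Ioo,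
          ← ENNReal.ofReal_mul (by linarith)]
        congr 1; ring

lemma integrableOn_ball_inv_norm (c : ℂ) (ρ : ℝ) :
    IntegrableOn (fun y => ‖y - c‖⁻¹) (ball c ρ) := by
  rcases lt_or_ge ρ 0 with h | h
  · simp [ball_eq_empty.mpr h.le]
  · refine ⟨by fun_prop, ?_⟩
    rw [hasFiniteIntegral_iff_ofReal (Eventually.of_forall fun y => by positivity)]
    exact (lintegral_ball_inv_norm c h).trans_lt ENNReal.ofReal_lt_top

lemma integral_ball_inv_norm_le (c : ℂ) {ρ : ℝ} (hρ : 0 ≤ ρ) :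
    ∫ y in ball c ρ, ‖y - c‖⁻¹ ≤ 2 * π * ρ := by
  rw [integral_eq_lintegral_of_nonneg_ae (Eventually.of_forall fun y => by positivity)
    (by fun_prop)]
  exact ENNReal.toReal_le_of_le_ofReal (by positivity) (lintegral_ball_inv_norm c hρ)

lemma integrable_div_sub {G : ℂ → ℂ} {M : ℝ} (hG : Integrable G) (hb : ∀ y, ‖G y‖ ≤ M) (c : ℂ) :
    Integrable (fun y => G y / (y - c)) := by
  have hm : AEStronglyMeasurable (fun y => G y / (y - c)) :=
    hG.aestronglyMeasurable.mul (by fun_prop : Measurable fun y => (y - c)⁻¹).aestronglyMeasurable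
  rw [← integrableOn_univ, ← Set.union_compl_self (ball c 1)]
  refine IntegrableOn.union ?_ ?_
  · refine Integrable.mono' ((integrableOn_ball_inv_norm c 1).const_mul M) hm.restrict ?_
    refine Eventually.of_forall fun y => ?_
    rw [norm_div, div_eq_mul_inv]
    exact mul_le_mul_of_nonneg_right (hb y) (by positivity)
  · refine Integrable.mono' hG.norm.integrableOn hm.restrict ?_
    rw [ae_restrict_iff' isOpen_ball.measurableSet.compl]
    refine Eventually.of_forall fun y hy => ?_
    have : 1 ≤ ‖y - c‖ := by simpa [dist_eq_norm] using hy
    rw [norm_div]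
    exact div_le_self (norm_nonneg _) this

lemma mul_circ_div {G : ℂ → ℂ} (c : ℂ) {r : ℝ} (hr : r ≠ 0) :
    r * circ (fun y => G y / (y - c)) c r =
      ∫ θ in (-π)..π, Complex.exp (-(θ * Complex.I)) * G (circleMap c r θ) := by
  rw [circ, ← intervalIntegral.integral_const_mul]
  refine intervalIntegral.integral_congr fun θ _ => ?_
  have h1 : circleMap c r θ - c = r * Complex.exp (θ * Complex.I) := by
    rw [circleMap_eq]; ring
  have h2 : (r : ℂ) ≠ 0 := by exact_mod_cast hr
  simp only [h1, Complex.exp_neg]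
  field_simp

/-- Cauchy–Pompeiu formula on the whole plane. -/
lemma cauchy_pompeiu_of_tendsto {h : ℂ → ℂ} (hh : ContDiff ℝ 1 h) (c : ℂ) {L : ℂ}
    (hi : Integrable (fun y => db h y / (y - c)))
    (hL : Tendsto (circ h c) atTop (𝓝 L)) :
    2 * ∫ y, db h y / (y - c) = L - 2 * π * h c := by
  have hb : Continuous (db h) := (hh.db (m := 0) (by norm_num)).continuous
  have hm : Measurable (fun y => db h y / (y - c)) := by
    have := hb.measurable
    fun_prop
  have hd : ∀ r ∈ Set.Ioi (0 : ℝ), HasDerivAt (circ h c)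
      (2 * (r * circ (fun y => db h y / (y - c)) c r)) r := by
    intro r hr
    rw [mul_circ_div c (ne_of_gt hr)]
    exact hasDerivAt_circ_db hh c (ne_of_gt hr)
  have := integral_Ioi_of_hasDerivAt_of_tendsto
    (continuous_circ hh.continuous c).continuousWithinAt hd
    ((integrableOn_mul_circ hm hi c).const_mul 2) hL
  rw [integral_const_mul, integral_mul_circ hm hi, circ_zero] at this
  exact this

lemma HasCompactSupport.db {h : ℂ → ℂ} (hs : HasCompactSupport h) : HasCompactSupport (db h) := by
  refine (hs.fderiv (𝕜 := ℝ)).mono fun x hx => ?_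
  contrapose! hx
  simp only [Function.mem_support, ne_eq, not_not] at hx
  simp [_root_.db, hx]

lemma HasCompactSupport.dz {h : ℂ → ℂ} (hs : HasCompactSupport h) : HasCompactSupport (dz h) := by
  refine (hs.fderiv (𝕜 := ℝ)).mono fun x hx => ?_
  contrapose! hx
  simp only [Function.mem_support, ne_eq, not_not] at hx
  simp [_root_.dz, hx]

lemma circ_eventually_zero {h : ℂ → ℂ} (hs : HasCompactSupport h) (c : ℂ) :
    ∀ᶠ r in atTop, circ h c r = 0 := by
  obtain ⟨R, hR⟩ := hs.isCompact.isBounded.subset_closedBall c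
  filter_upwards [eventually_gt_atTop (max R 0)] with r hr
  rw [circ_congr (g := fun _ => 0)]
  · simp [circ]
  · intro z hz
    by_contra hne
    have := hR (subset_tsupport _ hne)
    rw [mem_closedBall] at this
    rw [mem_sphere, abs_of_pos (lt_of_le_of_lt (le_max_right _ _) hr)] at hz
    have := le_max_left R 0
    linarith

lemma cauchy_pompeiu {h : ℂ → ℂ} (hh : ContDiff ℝ 1 h) (hs : HasCompactSupport h) (c : ℂ) :
    ∫ y, db h y / (y - c) = - π * h c := by
  have hb : Continuous (db h) := (hh.db (m := 0) (by norm_num)).continuous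
  obtain ⟨M, hM⟩ := hb.bounded_above_of_compact_support hs.db
  have := cauchy_pompeiu_of_tendsto hh c (L := 0)
    (integrable_div_sub (hb.integrable_of_hasCompactSupport hs.db) hM c)
    (tendsto_const_nhds.congr' ((circ_eventually_zero hs c).mono fun r hr => hr.symm))
  linear_combination this / 2

/-- `∫ ∂h = 0` for compactly supported `h`. -/
lemma integral_dz_eq_zero {h : ℂ → ℂ} (hh : ContDiff ℝ 1 h) (hs : HasCompactSupport h) :
    ∫ y, dz h y = 0 := by
  have hd := hh.differentiable one_ne_zero
  have key : ∀ v : ℂ, ∫ y, fderiv ℝ h y v = 0 := by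
    intro v
    have hi : Integrable (fun y => fderiv ℝ h y v) :=
      ((hh.continuous_fderiv one_ne_zero).clm_apply continuous_const).integrable_of_hasCompactSupport
        (hs.fderiv_apply (𝕜 := ℝ) v)
    have := integral_smul_fderiv_eq_neg_fderiv_smul_of_integrable (𝕜 := ℝ) (μ := (volume : Measure ℂ))
      (f := fun _ : ℂ => (1 : ℝ)) (g := h) (v := v) (by simp) (by simpa using hi)
      (by simpa using hh.continuous.integrable_of_hasCompactSupport hs) (by fun_prop) (fun x _ => hd x)
    simpa using this
  have hi : ∀ v : ℂ, Integrable (fun y => fderiv ℝ h y v) := fun v =>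
      ((hh.continuous_fderiv one_ne_zero).clm_apply continuous_const).integrable_of_hasCompactSupport
        (hs.fderiv_apply (𝕜 := ℝ) v)
  unfold dz
  rw [integral_div, integral_sub (hi _) ((hi _).const_mul _), integral_const_mul, key, key]
  simp

/-- A smooth radial cut-off function, equal to `1` on `ball 0 (1/2)` and supported in the unit
ball. -/
def cutoff (z : ℂ) : ℂ := ((⟨1 / 2, 1, by norm_num, by norm_num⟩ : ContDiffBump (0 : ℂ)) z : ℝ)

lemma contDiff_cutoff : ContDiff ℝ ∞ cutoff :=
  Complex.ofRealCLM.contDiff.comp (ContDiffBump.contDiff _)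

lemma cutoff_eq_one {z : ℂ} (hz : ‖z‖ ≤ 1 / 2) : cutoff z = 1 := by
  unfold cutoff
  rw [ContDiffBump.one_of_mem_closedBall _ (by simpa using hz)]; simp

lemma cutoff_eq_zero {z : ℂ} (hz : 1 ≤ ‖z‖) : cutoff z = 0 := by
  unfold cutoff
  rw [ContDiffBump.zero_of_le_dist _ (by simpa using hz)]; simp

lemma tsupport_cutoff : tsupport cutoff ⊆ closedBall 0 1 := by
  refine closure_minimal (fun z hz => ?_) isClosed_closedBall
  by_contra h
  simp only [mem_closedBall, dist_zero_right, not_le] at h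
  exact hz (cutoff_eq_zero h.le)

lemma hasCompactSupport_cutoff : HasCompactSupport cutoff :=
  HasCompactSupport.of_support_subset_isCompact (isCompact_closedBall 0 1)
    ((subset_tsupport _).trans tsupport_cutoff)

/-- The singular kernel of the localized Cauchy–Pompeiu formula. -/
def kerS (w : ℂ) : ℂ := cutoff w / w

/-- The smooth kernel of the localized Cauchy–Pompeiu formula. -/
def kerR (w : ℂ) : ℂ := db cutoff w / w

lemma db_cutoff_eq_zero {z : ℂ} (hz : ‖z‖ < 1 / 2) : db cutoff z = 0 := by
  have : cutoff =ᶠ[𝓝 z] fun _ => 1 := by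
    filter_upwards [isOpen_ball.mem_nhds (show z ∈ ball (0 : ℂ) (1 / 2) by simpa using hz)] with w hw
    exact cutoff_eq_one (by simpa using (mem_ball.mp hw).le)
  unfold db
  rw [this.fderiv_eq]; simp

lemma contDiff_kerR : ContDiff ℝ ∞ kerR := by
  rw [contDiff_iff_contDiffAt]
  intro z
  by_cases hz : ‖z‖ < 1 / 2
  · have : kerR =ᶠ[𝓝 z] fun _ => 0 := by
      filter_upwards [isOpen_ball.mem_nhds (show z ∈ ball (0 : ℂ) (1 / 2) by simpa using hz)]
        with w hw
      rw [kerR, db_cutoff_eq_zero (by simpa using hw), zero_div]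
    exact contDiffAt_const.congr_of_eventuallyEq this
  · have h0 : z ≠ 0 := by rintro rfl; norm_num at hz
    exact (contDiff_cutoff.db (m := ∞) (by simp)).contDiffAt.mul (contDiffAt_id.inv h0)

lemma kerR_support : Function.support kerR ⊆ closedBall 0 1 := by
  intro z hz
  have : db cutoff z ≠ 0 := fun h => hz (by simp [kerR, h])
  by_contra hc
  have h2 : z ∉ tsupport cutoff := fun h => hc (tsupport_cutoff h)
  apply this
  unfold db
  rw [fderiv_of_notMem_tsupport (𝕜 := ℝ) h2]; simp

lemma hasCompactSupport_kerR : HasCompactSupport kerR :=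
  HasCompactSupport.of_support_subset_isCompact (isCompact_closedBall 0 1) kerR_support

lemma dz_kerR_support : Function.support (dz kerR) ⊆ closedBall 0 1 := by
  intro z hz
  by_contra hc
  have h2 : z ∉ tsupport kerR := fun h => hc (closure_minimal kerR_support isClosed_closedBall h)
  apply hz
  unfold dz
  rw [fderiv_of_notMem_tsupport (𝕜 := ℝ) h2]; simp

lemma kerS_support : Function.support kerS ⊆ closedBall 0 1 := by
  intro z hz
  exact tsupport_cutoff (subset_tsupport _ fun h => hz (by simp [kerS, h]))

lemma integrable_kerS : Integrable kerS := by
  obtain ⟨M, hM⟩ := contDiff_cutoff.continuous.bounded_above_of_compact_support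
    hasCompactSupport_cutoff
  have := integrable_div_sub
    (contDiff_cutoff.continuous.integrable_of_hasCompactSupport hasCompactSupport_cutoff) hM 0
  simp only [sub_zero] at this
  exact this

lemma measurable_kerS : Measurable kerS := by
  have := contDiff_cutoff.continuous.measurable
  unfold kerS
  fun_prop

lemma integrable_kerS_mul {G : ℂ → ℂ} (hG : Continuous G) (x : ℂ) :
    Integrable (fun w => kerS w * G (x + w)) := by
  obtain ⟨M, hM⟩ := (isCompact_closedBall x 1).exists_bound_of_continuousOn hG.continuousOn
  refine Integrable.mono' (integrable_kerS.norm.mul_const M)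
    ((measurable_kerS.mul (hG.comp (by fun_prop : Continuous fun w => x + w)).measurable
      ).aestronglyMeasurable) (Eventually.of_forall fun w => ?_)
  rw [norm_mul]
  by_cases hw : kerS w = 0
  · simp [hw]
  · have h1 := kerS_support hw
    exact mul_le_mul_of_nonneg_left (hM _ (by simpa using h1)) (norm_nonneg _)

lemma integrable_smooth_mul {κ G : ℂ → ℂ} (hκ : Continuous κ) (hs : HasCompactSupport κ)
    (hG : Continuous G) (x : ℂ) : Integrable (fun w => κ w * G (x + w)) :=
  (hκ.mul (by fun_prop)).integrable_of_hasCompactSupport hs.mul_right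

lemma HasW.translate {f : ℂ → ℂ} {a b x w : ℂ} (h : HasW f a b (x + w)) :
    HasW (fun w => f (x + w)) a b w := by
  have := HasW.comp_affine (f := f) (c := x) (R := 1) (z := w) (by simpa using h)
  simpa using this

lemma cauchy_pompeiu_cutoff {h : ℂ → ℂ} (hh : ContDiff ℝ 1 h) (x : ℂ) :
    (∫ w, kerS w * db h (x + w)) + ∫ w, kerR w * h (x + w) = -π * h x := by
  have hb : Continuous (db h) := (hh.db (m := 0) (by norm_num)).continuous
  have h1 : ContDiff ℝ 1 (fun w => cutoff w * h (x + w)) :=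
    (contDiff_cutoff.of_le (by exact_mod_cast le_top)).mul (by fun_prop)
  have h2 := cauchy_pompeiu h1 (hasCompactSupport_cutoff.mul_right) 0
  have h3 : ∀ w, db (fun w => cutoff w * h (x + w)) w / (w - 0) =
      kerS w * db h (x + w) + kerR w * h (x + w) := by
    intro w
    rw [((contDiff_cutoff.hasW (by simp) w).mul (hh.hasW one_ne_zero (x + w)).translate).db_eq,
      kerS, kerR, sub_zero]
    ring
  simp only [h3] at h2
  rw [integral_add (integrable_kerS_mul hb x)
    (integrable_smooth_mul contDiff_kerR.continuous hasCompactSupport_kerR hh.continuous x)] at h2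
  rw [h2, cutoff_eq_one (by simp), add_zero, one_mul]

lemma dz_formula {h : ℂ → ℂ} (hh : ContDiff ℝ 2 h) (x : ℂ) :
    (∫ w, kerS w * dz (db h) (x + w)) - ∫ w, dz kerR w * h (x + w) = -π * dz h x := by
  have hz : ContDiff ℝ 1 (dz h) := hh.dz (by norm_num)
  have h1 := cauchy_pompeiu_cutoff hz x
  simp only [← dz_db_comm hh] at h1
  rw [← h1, sub_eq_add_neg]
  congr 1
  have hk1 : ContDiff ℝ 1 kerR := contDiff_kerR.of_le (by exact_mod_cast le_top)
  have hh1 : ContDiff ℝ 1 h := hh.of_le (by norm_num)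
  have h2 := integral_dz_eq_zero (h := fun w => kerR w * h (x + w)) (hk1.mul (by fun_prop))
    hasCompactSupport_kerR.mul_right
  have h3 : ∀ w, dz (fun w => kerR w * h (x + w)) w =
      dz kerR w * h (x + w) + kerR w * dz h (x + w) := fun w =>
    ((hk1.hasW one_ne_zero w).mul (hh1.hasW one_ne_zero (x + w)).translate).dz_eq
  simp only [h3] at h2
  rw [integral_add
    (integrable_smooth_mul (hk1.dz (m := 0) (by norm_num)).continuous hasCompactSupport_kerR.dz
      hh.continuous x)
    (integrable_smooth_mul contDiff_kerR.continuous hasCompactSupport_kerR hz.continuous x)] at h2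
  linear_combination -h2

lemma norm_integral_ker_le {κ G : ℂ → ℂ} (hκ : Integrable κ)
    (hs : Function.support κ ⊆ closedBall 0 1) {x : ℂ} {A : ℝ}
    (hA : ∀ y ∈ closedBall x 1, ‖G y‖ ≤ A) :
    ‖∫ w, κ w * G (x + w)‖ ≤ (∫ w, ‖κ w‖) * A := by
  rw [← integral_mul_const]
  refine norm_integral_le_of_norm_le (hκ.norm.mul_const A) (Eventually.of_forall fun w => ?_)
  rw [norm_mul]
  by_cases hw : κ w = 0
  · simp [hw]
  · exact mul_le_mul_of_nonneg_left (hA _ (by simpa using hs hw)) (norm_nonneg _)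

lemma exists_dz_bound : ∃ C : ℝ, 0 ≤ C ∧ ∀ (h : ℂ → ℂ), ContDiff ℝ 2 h → ∀ (x : ℂ) (R A B : ℝ),
    0 < R → (∀ y ∈ closedBall x R, ‖h y‖ ≤ A) → (∀ y ∈ closedBall x R, ‖dz (db h) y‖ ≤ B) →
    R * ‖dz h x‖ ≤ C * (A + R ^ 2 * B) := by
  set I1 := ∫ w, ‖kerS w‖
  set I2 := ∫ w, ‖dz kerR w‖
  have hI1 : 0 ≤ I1 := integral_nonneg fun _ => norm_nonneg _
  have hI2 : 0 ≤ I2 := integral_nonneg fun _ => norm_nonneg _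
  refine ⟨(I1 + I2) / π, by positivity, fun h hh x R A B hR hA hB => ?_⟩
  set g : ℂ → ℂ := fun w => h (x + R * w) with hg
  have hg2 : ContDiff ℝ 2 g := by
    have : ContDiff ℝ 2 (fun w : ℂ => x + R * w) := by fun_prop
    exact hh.comp this
  have gz : ∀ w, dz g w = R * dz h (x + R * w) := fun w =>
    (HasW.comp_affine (hh.hasW two_ne_zero _)).dz_eq
  have gb : db g = fun w => R * db h (x + R * w) := funext fun w =>
    (HasW.comp_affine (hh.hasW two_ne_zero _)).db_eq
  have gzb : ∀ w, dz (db g) w = R ^ 2 * dz (db h) (x + R * w) := fun w => by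
    rw [gb, (HasW.const_mul (R : ℂ) (HasW.comp_affine
      ((hh.db (m := 1) (by norm_num)).hasW one_ne_zero _))).dz_eq]
    ring
  have hmem : ∀ y ∈ closedBall (0 : ℂ) 1, x + R * y ∈ closedBall x R := by
    intro y hy
    simp only [mem_closedBall, dist_zero_right, dist_self_add_left, norm_mul, Complex.norm_real,
      norm_eq_abs, abs_of_pos hR] at hy ⊢
    exact mul_le_of_le_one_right hR.le hy
  have f := dz_formula hg2 0
  have hk1 : ContDiff ℝ 1 kerR := contDiff_kerR.of_le (by exact_mod_cast le_top)
  have b1 := norm_integral_ker_le (G := dz (db g)) integrable_kerS kerS_support (x := 0)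
    (A := R ^ 2 * B) (by
      intro y hy
      rw [gzb, norm_mul, norm_pow, Complex.norm_real, norm_eq_abs, abs_of_pos hR]
      exact mul_le_mul_of_nonneg_left (hB _ (hmem y hy)) (by positivity))
  have b2 := norm_integral_ker_le (G := g) (κ := dz kerR)
    ((hk1.dz (m := 0) (by norm_num)).continuous.integrable_of_hasCompactSupport
      hasCompactSupport_kerR.dz) dz_kerR_support (x := 0) (A := A) (fun y hy => hA _ (hmem y hy))
  have hA0 : 0 ≤ A := (norm_nonneg _).trans (hA x (mem_closedBall_self hR.le))
  have hB0 : 0 ≤ B := (norm_nonneg _).trans (hB x (mem_closedBall_self hR.le))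
  have b3 : π * (R * ‖dz h x‖) ≤ I1 * (R ^ 2 * B) + I2 * A := by
    have : π * (R * ‖dz h x‖) = ‖-(π : ℂ) * dz g 0‖ := by
      rw [gz]; simp [abs_of_pos hR, abs_of_pos pi_pos]
    rw [this, ← f]
    exact (norm_sub_le _ _).trans (add_le_add b1 b2)
  rw [div_mul_eq_mul_div, le_div_iff₀ pi_pos]
  have : 0 ≤ I1 * A := by positivity
  have : 0 ≤ I2 * (R ^ 2 * B) := by positivity
  nlinarith

lemma eventually_cocompact_iff {P : ℂ → Prop} :
    (∀ᶠ z in cocompact ℂ, P z) ↔ ∃ r : ℝ, 0 < r ∧ ∀ z, r ≤ ‖z‖ → P z := by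
  rw [← Metric.cobounded_eq_cocompact, ← comap_norm_atTop, (atTop_basis.comap norm).eventually_iff]
  simp only [true_and, Set.mem_preimage, Set.mem_Ici]
  constructor
  · rintro ⟨r, hr⟩
    exact ⟨max r 1, by positivity, fun z hz => hr ((le_max_left _ _).trans hz)⟩
  · rintro ⟨r, _, hr⟩
    exact ⟨r, fun {z} hz => hr z hz⟩

lemma tendsto_mul_dz {h : ℂ → ℂ} (hh : ContDiff ℝ 2 h) (h0 : Tendsto h (cocompact ℂ) (𝓝 0))
    (h2 : Tendsto (fun z => z ^ 2 * dz (db h) z) (cocompact ℂ) (𝓝 0)) :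
    Tendsto (fun z => z * dz h z) (cocompact ℂ) (𝓝 0) := by
  obtain ⟨C, hC0, hC⟩ := exists_dz_bound
  rw [Metric.tendsto_nhds] at h0 h2 ⊢
  intro ε hε
  set δ := ε / (4 * (C + 1)) with hδ
  have hδ0 : 0 < δ := by positivity
  have ev := (h0 δ hδ0).and (h2 δ hδ0)
  rw [eventually_cocompact_iff] at ev ⊢
  obtain ⟨r, hr0, hr⟩ := ev
  refine ⟨2 * r, by positivity, fun z hz => ?_⟩
  set R := ‖z‖ / 2 with hR
  have hR0 : 0 < R := by linarith
  have hy : ∀ y ∈ closedBall z R, R ≤ ‖y‖ := by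
    intro y hy
    rw [mem_closedBall, dist_eq_norm, norm_sub_rev] at hy
    have := norm_sub_norm_le z y
    linarith
  have := hC h hh z R δ (δ / R ^ 2) hR0 (fun y h1 => by
      simpa using (hr y (by linarith [hy y h1])).1.le) (fun y h1 => by
      have h3 := (hr y (by linarith [hy y h1])).2.le
      rw [dist_zero_right, norm_mul, norm_pow] at h3
      rw [le_div_iff₀ (by positivity), mul_comm]
      refine le_trans ?_ h3
      have := hy y h1
      gcongr)
  rw [mul_div_cancel₀ _ (by positivity)] at this
  rw [dist_zero_right, norm_mul]
  have h4 : δ * (4 * (C + 1)) = ε := by rw [hδ]; field_simp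
  have h5 : ‖z‖ = 2 * R := by rw [hR]; ring
  rw [h5]
  nlinarith

lemma contDiff_integral_kerS {G : ℂ → ℂ} {n : ℕ∞} (hG : ContDiff ℝ n G) :
    ContDiff ℝ n (fun x => ∫ w, kerS w * G (x + w)) := by
  rw [contDiff_iff_contDiffAt]
  intro x₀
  set χ : ContDiffBump x₀ := ⟨2, 3, by norm_num, by norm_num⟩
  set G' : ℂ → ℂ := fun y => ((χ y : ℝ) : ℂ) * G y with hG'
  have hχ : ContDiff ℝ n (fun y => ((χ y : ℝ) : ℂ)) := Complex.ofRealCLM.contDiff.comp χ.contDiff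
  have hs : HasCompactSupport G' :=
    (χ.hasCompactSupport.comp_left (g := fun t : ℝ => (t : ℂ)) (by simp)).mul_right
  have hc := hs.contDiff_convolution_right (ContinuousLinearMap.mul ℝ ℂ)
    (integrable_kerS.comp_neg).locallyIntegrable (hχ.mul hG)
  refine hc.contDiffAt.congr_of_eventuallyEq ?_
  filter_upwards [ball_mem_nhds x₀ one_pos] with x hx
  rw [convolution_def, ← integral_neg_eq_self]
  refine integral_congr_ae (Eventually.of_forall fun w => ?_)
  simp only [ContinuousLinearMap.mul_apply', sub_eq_add_neg, hG']
  by_cases hw : kerS (-w) = 0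
  · simp [hw]
  · rw [χ.one_of_mem_closedBall]
    · simp
    · have := kerS_support hw
      simp only [mem_closedBall, mem_ball, dist_eq_norm, sub_zero, norm_neg] at this hx ⊢
      calc ‖x + -w - x₀‖ = ‖(x - x₀) - w‖ := by congr 1; ring
        _ ≤ ‖x - x₀‖ + ‖w‖ := norm_sub_le _ _
        _ ≤ 2 := by linarith

lemma contDiff_integral_kerR {h : ℂ → ℂ} (hh : Continuous h) {n : ℕ∞} :
    ContDiff ℝ n (fun x => ∫ w, kerR w * h (x + w)) := by
  have hs : HasCompactSupport (fun w => kerR (-w)) :=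
    hasCompactSupport_kerR.comp_homeomorph (Homeomorph.neg ℂ)
  have hk : ContDiff ℝ n (fun w => kerR (-w)) :=
    (contDiff_kerR.of_le (by exact_mod_cast le_top)).comp contDiff_neg
  have hc := hs.contDiff_convolution_left (ContinuousLinearMap.mul ℝ ℂ) (μ := volume) hk
    hh.locallyIntegrable
  convert hc using 1
  ext x
  rw [convolution_def, ← integral_neg_eq_self]
  simp [sub_eq_add_neg]

/-- Interior regularity for the Cauchy–Riemann operator. -/
lemma contDiff_of_db {h : ℂ → ℂ} {n : ℕ∞} (hh : ContDiff ℝ 1 h) (hb : ContDiff ℝ n (db h)) :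
    ContDiff ℝ n h := by
  have : h = fun x => (-(π : ℂ))⁻¹ *
      ((∫ w, kerS w * db h (x + w)) + ∫ w, kerR w * h (x + w)) := by
    ext x
    have : (π : ℂ) ≠ 0 := by exact_mod_cast pi_ne_zero
    rw [cauchy_pompeiu_cutoff hh]
    field_simp
  rw [this]
  exact contDiff_const.mul ((contDiff_integral_kerS hb).add (contDiff_integral_kerR hh.continuous))

lemma hasDerivAt_re {f : ℝ → ℂ} {f' : ℂ} {r : ℝ} (h : HasDerivAt f f' r) :
    HasDerivAt (fun s => (f s).re) f'.re r :=
  (Complex.reCLM.hasFDerivAt.comp_hasDerivAt r h)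

lemma circ_re {f : ℂ → ℂ} (hf : Continuous f) (c : ℂ) (r : ℝ) :
    (circ f c r).re = ∫ θ in (-π)..π, (f (circleMap c r θ)).re :=
  (Complex.reCLM.intervalIntegral_comp_comm (circleMap_integrable hf c r _ _)).symm

lemma le_circ_re {f : ℂ → ℂ} (hf : Continuous f) {c : ℂ} {r k : ℝ}
    (h : ∀ y ∈ sphere c |r|, k ≤ (f y).re) : 2 * π * k ≤ (circ f c r).re := by
  rw [circ_re hf]
  have : ∫ _ in (-π)..π, k = 2 * π * k := by
    rw [intervalIntegral.integral_const, smul_eq_mul]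
    ring
  rw [← this]
  refine intervalIntegral.integral_mono_on (by linarith [pi_pos]) (by simp) ?_
    fun θ _ => h _ (circleMap_mem_sphere' c r θ)
  exact (Complex.continuous_re.comp (hf.comp (continuous_circleMap c r))).intervalIntegrable _ _

section
variable {v : ℂ → ℂ} (hv : ContDiff ℝ 2 v) (c : ℂ)
include hv

lemma contDiff_radial : ContDiff ℝ 1 (fun y => 2 * (y - c) * dz v y) := by
  have := hv.dz (m := 1) (by norm_num)
  fun_prop

lemma hasDerivAt_circ_radial {r : ℝ} (hr : r ≠ 0) :
    HasDerivAt (circ v c) (circ (fun y => 2 * (y - c) * dz v y) c r / r) r := by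
  have hr' : (r : ℂ) ≠ 0 := by exact_mod_cast hr
  convert hasDerivAt_circ_dz (hv.of_le (by norm_num)) c hr using 1
  rw [div_eq_iff hr', circ, ← intervalIntegral.integral_const_mul,
    ← intervalIntegral.integral_mul_const]
  refine intervalIntegral.integral_congr fun θ _ => ?_
  simp only [circleMap_eq]
  ring

lemma hasDerivAt_circ_laplacian {r : ℝ} (hr : r ≠ 0) :
    HasDerivAt (circ (fun y => 2 * (y - c) * dz v y) c)
      (r * circ (fun y => 4 * dz (db v) y) c r) r := by
  convert hasDerivAt_circ_db (contDiff_radial hv c) c hr using 1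
  rw [circ, ← intervalIntegral.integral_const_mul, ← intervalIntegral.integral_const_mul]
  refine intervalIntegral.integral_congr fun θ _ => ?_
  have hd := (hv.dz (m := 1) (by norm_num)).hasW one_ne_zero (circleMap c r θ)
  have : db (fun y => 2 * (y - c) * dz v y) (circleMap c r θ) =
      2 * (circleMap c r θ - c) * db (dz v) (circleMap c r θ) := by
    rw [(((HasW.id.sub (HasW.const c)).const_mul 2).mul hd).db_eq]
    ring
  simp only [this, dz_db_comm hv]
  simp only [circleMap_eq, Complex.exp_neg]
  have := Complex.exp_ne_zero (θ * Complex.I)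
  field_simp
  ring

lemma sub_mean_value {ρ k : ℝ} (hρ : 0 < ρ)
    (hk : ∀ y ∈ ball c ρ, -k ≤ (4 * dz (db v) y).re) :
    π * ρ ^ 2 * (v c).re ≤ (∫ y in ball c ρ, v y).re + π * k * ρ ^ 4 / 8 := by
  set w : ℂ → ℂ := fun y => 2 * (y - c) * dz v y with hw
  have hwc : Continuous w := (contDiff_radial hv c).continuous
  have hLc : Continuous (fun y => 4 * dz (db v) y) :=
    continuous_const.mul ((hv.db (m := 1) (by norm_num)).dz (m := 0) (by norm_num)).continuous
  have hint : interior (Set.Icc 0 ρ) = Set.Ioo 0 ρ := interior_Icc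
  have m1 : MonotoneOn (fun r => (circ w c r).re + π * k * r ^ 2) (Set.Icc 0 ρ) := by
    refine monotoneOn_of_hasDerivWithinAt_nonneg (convex_Icc 0 ρ) (f' := fun r =>
      (r * circ (fun y => 4 * dz (db v) y) c r).re + π * k * (2 * r)) ?_ ?_ ?_
    · have := continuous_circ hwc c
      exact Continuous.continuousOn (by fun_prop)
    · rw [hint]
      intro r hr
      have h1 := hasDerivAt_re (hasDerivAt_circ_laplacian hv c hr.1.ne')
      refine (h1.add (((hasDerivAt_pow 2 r).const_mul (π * k)).congr_deriv ?_)).hasDerivWithinAt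
      norm_num
    · rw [hint]
      intro r hr
      have := le_circ_re hLc (c := c) (r := r) (k := -k) (fun y hy => hk y (by
        rw [mem_sphere, abs_of_pos hr.1] at hy
        rw [mem_ball, hy]; exact hr.2))
      have h2 : (r * circ (fun y => 4 * dz (db v) y) c r).re =
          r * (circ (fun y => 4 * dz (db v) y) c r).re := by simp
      rw [h2]
      nlinarith [mul_le_mul_of_nonneg_left this hr.1.le]
  have b1 : ∀ r ∈ Set.Icc 0 ρ, -(π * k * r ^ 2) ≤ (circ w c r).re := by
    intro r hr
    have := m1 ⟨le_rfl, hρ.le⟩ hr hr.1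
    simp only [circ_zero, hw, sub_self, mul_zero, zero_mul, Complex.zero_re] at this
    simp only [hw]
    linarith
  have m2 : MonotoneOn (fun r => (circ v c r).re + π * k / 2 * r ^ 2) (Set.Icc 0 ρ) := by
    refine monotoneOn_of_hasDerivWithinAt_nonneg (convex_Icc 0 ρ) (f' := fun r =>
      (circ w c r / r).re + π * k / 2 * (2 * r)) ?_ ?_ ?_
    · have := continuous_circ hv.continuous c
      exact Continuous.continuousOn (by fun_prop)
    · rw [hint]
      intro r hr
      have h1 := hasDerivAt_re (hasDerivAt_circ_radial hv c hr.1.ne')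
      refine (h1.add (((hasDerivAt_pow 2 r).const_mul (π * k / 2)).congr_deriv ?_)).hasDerivWithinAt
      norm_num
    · rw [hint]
      intro r hr
      have := b1 r ⟨hr.1.le, hr.2.le⟩
      rw [Complex.div_ofReal_re]
      have h3 : -(π * k * r) ≤ (circ w c r).re / r := by
        rw [le_div_iff₀ hr.1]; linarith
      linarith
  have b2 : ∀ r ∈ Set.Icc 0 ρ, 2 * π * (v c).re * r - π * k / 2 * r ^ 3 ≤ (r * circ v c r).re := by
    intro r hr
    have := m2 ⟨le_rfl, hρ.le⟩ hr hr.1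
    simp only [circ_zero] at this
    have e : (2 * π * v c).re = 2 * π * (v c).re := by
      rw [← Complex.ofReal_ofNat, ← Complex.ofReal_mul, Complex.re_ofReal_mul]
    rw [e] at this
    rw [Complex.re_ofReal_mul]
    nlinarith [mul_le_mul_of_nonneg_left this hr.1]
  rw [setIntegral_ball_eq hv.continuous c hρ.le]
  have hci : Continuous (fun r : ℝ => r * circ v c r) := by
    have := continuous_circ hv.continuous c
    fun_prop
  have e := Complex.reCLM.intervalIntegral_comp_comm (hci.intervalIntegrable (μ := volume) 0 ρ)
  simp only [Complex.reCLM_apply] at e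
  rw [← e]
  have e2 : ∫ r in (0 : ℝ)..ρ, (2 * π * (v c).re * r - π * k / 2 * r ^ 3) =
      π * ρ ^ 2 * (v c).re - π * k * ρ ^ 4 / 8 := by
    rw [intervalIntegral.integral_sub, intervalIntegral.integral_const_mul,
      intervalIntegral.integral_const_mul, integral_id, integral_pow]
    · ring
    all_goals exact Continuous.intervalIntegrable (by fun_prop) _ _
  have := intervalIntegral.integral_mono_on hρ.le
    (Continuous.intervalIntegrable (by fun_prop) _ _)
    ((Complex.continuous_re.comp hci).intervalIntegrable (μ := volume) 0 ρ) b2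
  rw [e2] at this
  simp only [Function.comp_def] at this
  linarith

end

/-- Schoen's trick: a sub-mean value inequality with quadratic error implies a pointwise bound under
small mass. -/
lemma epsilon_regularity {V : ℂ → ℝ} (hV : Continuous V) (hpos : ∀ z, 0 < V z)
    (hm : ∀ (c : ℂ) (ρ K : ℝ), 0 < ρ → (∀ y ∈ ball c ρ, V y ≤ K) →
      π * ρ ^ 2 * V c ≤ (∫ y in ball c ρ, V y) + π * K ^ 2 * ρ ^ 4 / 4)
    {x : ℂ} {R ε : ℝ} (hR : 0 < R) (hε : ε < π / 16) (hint : ∫ y in ball x R, V y ≤ ε) :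
    R ^ 2 * V x ≤ 8 * ε / π := by
  obtain ⟨y0, hy0, hmax⟩ := (isCompact_closedBall x R).exists_isMaxOn
    ⟨x, mem_closedBall_self hR.le⟩
    (f := fun y => (R - dist y x) ^ 2 * V y) (by fun_prop)
  have hx := hmax (mem_closedBall_self hR.le)
  simp only [Set.mem_ofPred_eq, dist_self, sub_zero] at hx
  set r := (R - dist y0 x) / 2 with hr
  set V0 := V y0
  have hV0 : 0 < V0 := hpos y0
  have hr0 : 0 < r := by
    have h1 : dist y0 x ≤ R := hy0
    rcases eq_or_lt_of_le h1 with h | h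
    · rw [h, sub_self] at hx
      have := mul_pos (pow_pos hR 2) (hpos x)
      norm_num at hx
      linarith
    · rw [hr]; linarith
  have hRd : R - dist y0 x = 2 * r := by rw [hr]; ring
  rw [hRd] at hx
  have hK : ∀ y ∈ ball y0 r, V y ≤ 4 * V0 := by
    intro y hy
    rw [mem_ball] at hy
    have h1 : r ≤ R - dist y x := by
      have := dist_triangle y y0 x
      linarith
    have h2 := hmax (show y ∈ closedBall x R by rw [mem_closedBall]; linarith)
    simp only [Set.mem_ofPred_eq] at h2
    rw [hRd] at h2
    have h3 : r ^ 2 * V y ≤ r ^ 2 * (4 * V0) := by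
      have : r ^ 2 * V y ≤ (R - dist y x) ^ 2 * V y := by
        have := (hpos y).le
        gcongr
      calc _ ≤ _ := this
        _ ≤ _ := h2
        _ = _ := by ring
    exact le_of_mul_le_mul_left h3 (by positivity)
  have hme : ∀ ρ, 0 < ρ → ρ ≤ r → π * ρ ^ 2 * V0 ≤ ε + 4 * π * V0 ^ 2 * ρ ^ 4 := by
    intro ρ h0 h1
    have h2 := hm y0 ρ (4 * V0) h0 (fun y hy => hK y (ball_subset_ball h1 hy))
    have h3 : ∫ y in ball y0 ρ, V y ≤ ∫ y in ball x R, V y := by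
      refine setIntegral_mono_set ?_ (Eventually.of_forall fun y => (hpos y).le) ?_
      · exact (hV.continuousOn.integrableOn_compact (isCompact_closedBall x R)).mono_set
          ball_subset_closedBall
      · refine LE.le.eventuallyLE (ball_subset_ball' ?_)
        linarith
    nlinarith
  have hpi := pi_pos
  have hsmall : V0 * r ^ 2 < 1 / 8 := by
    by_contra hc
    push Not at hc
    have h1 : √(1 / (8 * V0)) ^ 2 = 1 / (8 * V0) := Real.sq_sqrt (by positivity)
    have h2 := hme (√(1 / (8 * V0))) (by positivity) (by
      rw [Real.sqrt_le_left hr0.le, div_le_iff₀ (by positivity)]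
      linarith)
    have h3 : √(1 / (8 * V0)) ^ 4 = (1 / (8 * V0)) ^ 2 := by
      calc √(1 / (8 * V0)) ^ 4 = (√(1 / (8 * V0)) ^ 2) ^ 2 := by ring
        _ = _ := by rw [h1]
    rw [h1, h3] at h2
    have h4 : π * (1 / (8 * V0)) * V0 = π / 8 := by field_simp
    have h5 : 4 * π * V0 ^ 2 * (1 / (8 * V0)) ^ 2 = π / 16 := by field_simp; norm_num
    rw [h4, h5] at h2
    linarith
  have h1 := hme r hr0 le_rfl
  rw [le_div_iff₀ hpi]
  have h2 : 4 * π * V0 ^ 2 * r ^ 4 ≤ 4 * π * (1 / 8) * (V0 * r ^ 2) := by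
    have : 4 * π * V0 ^ 2 * r ^ 4 = 4 * π * (V0 * r ^ 2) * (V0 * r ^ 2) := by ring
    rw [this]
    gcongr
  nlinarith

lemma tendsto_setIntegral_compl_ball {V : ℂ → ℝ} (hi : Integrable V) :
    Tendsto (fun n : ℕ => ∫ y in (ball (0 : ℂ) n)ᶜ, V y) atTop (𝓝 0) := by
  have := tendsto_setIntegral_of_antitone (μ := volume) (f := V) (s := fun n : ℕ => (ball (0 : ℂ) n)ᶜ)
    (fun n => isOpen_ball.measurableSet.compl)
    (fun m n h => Set.compl_subset_compl.mpr (ball_subset_ball (by exact_mod_cast h)))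
    ⟨0, hi.integrableOn⟩
  have h0 : ⋂ n : ℕ, (ball (0 : ℂ) n)ᶜ = ∅ := by
    rw [← Set.compl_iUnion, Metric.iUnion_ball_nat, Set.compl_univ]
  simpa [h0] using this

lemma tendsto_sq_mul_of_integrable {V : ℂ → ℝ} (hV : Continuous V) (hpos : ∀ z, 0 < V z)
    (hm : ∀ (c : ℂ) (ρ K : ℝ), 0 < ρ → (∀ y ∈ ball c ρ, V y ≤ K) →
      π * ρ ^ 2 * V c ≤ (∫ y in ball c ρ, V y) + π * K ^ 2 * ρ ^ 4 / 4)
    (hi : Integrable V) : Tendsto (fun z => ‖z‖ ^ 2 * V z) (cocompact ℂ) (𝓝 0) := by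
  rw [Metric.tendsto_nhds]
  intro δ hδ
  have hpi := pi_pos
  obtain ⟨n, hn⟩ := ((tendsto_setIntegral_compl_ball hi).eventually_lt_const
    (show 0 < min (π / 16) (δ * π / 64) by positivity)).exists
  rw [eventually_cocompact_iff]
  refine ⟨2 * n + 1, by positivity, fun z hz => ?_⟩
  set ε := ∫ y in (ball (0 : ℂ) n)ᶜ, V y with hε
  have hz0 : 0 < ‖z‖ := lt_of_lt_of_le (by positivity) hz
  have := epsilon_regularity hV hpos hm (x := z) (R := ‖z‖ / 2) (ε := ε) (by positivity)
    (hn.trans_le (min_le_left _ _)) (by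
      refine setIntegral_mono_set hi.integrableOn (Eventually.of_forall fun y => (hpos y).le)
        (LE.le.eventuallyLE fun y hy => ?_)
      rw [mem_ball, dist_eq_norm, norm_sub_rev] at hy
      have := norm_sub_norm_le z y
      simp only [Set.mem_compl_iff, mem_ball, dist_zero_right, not_lt]
      linarith)
  rw [dist_zero_right, norm_mul, norm_pow, norm_norm, norm_eq_abs, abs_of_pos (hpos z)]
  rw [le_div_iff₀ hpi] at this
  have h2 := hn.trans_le (min_le_right _ _)
  have : ‖z‖ ^ 2 * V z * π < δ * π := by nlinarith
  exact lt_of_mul_lt_mul_right this hpi.le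

lemma db_ofReal {u : ℂ → ℝ} {z : ℂ} (h : DifferentiableAt ℝ (fun w => (u w : ℂ)) z) :
    db (fun w => (u w : ℂ)) z = (starRingEnd ℂ) (dz (fun w => (u w : ℂ)) z) := by
  have := h.hasW.conj.db_eq
  simpa using this

/-- Finite-energy subsolutions of the Liouville equation decay faster than `|z|⁻²`. -/
lemma tendsto_sq_mul_exp {u : ℂ → ℝ} (hu : ContDiff ℝ 2 (fun z => (u z : ℂ)))
    (hL : ∀ z, -2 * exp (u z) ≤ (4 * dz (db (fun w => (u w : ℂ))) z).re)
    (hi : Integrable (fun z => exp (u z))) :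
    Tendsto (fun z => ‖z‖ ^ 2 * exp (u z)) (cocompact ℂ) (𝓝 0) := by
  have huc : Continuous u := Complex.continuous_re.comp hu.continuous
  set U : ℂ → ℂ := fun z => (u z : ℂ)
  refine tendsto_sq_mul_of_integrable (by fun_prop) (fun z => exp_pos _) ?_ hi
  intro c ρ K hρ hK
  have hE : ContDiff ℝ 2 (fun z => Complex.exp (U z)) := hu.cexp
  have e1 : db (fun z => Complex.exp (U z)) = fun z => Complex.exp (U z) * db U z :=
    funext fun z => (hu.hasW two_ne_zero z).cexp.db_eq
  have e2 : ∀ z, dz (db (fun z => Complex.exp (U z))) z =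
      Complex.exp (U z) * (dz U z * db U z + dz (db U) z) := by
    intro z
    rw [e1, ((hu.hasW two_ne_zero z).cexp.mul
      ((hu.db (m := 1) (by norm_num)).hasW one_ne_zero z)).dz_eq]
    ring
  have hEr : ∀ z, Complex.exp (U z) = (exp (u z) : ℝ) := fun z => (Complex.ofReal_exp _).symm
  have := sub_mean_value hE c (ρ := ρ) (k := 2 * K ^ 2) hρ (by
    intro y hy
    rw [e2, hEr, mul_left_comm, Complex.re_ofReal_mul,
      db_ofReal (hu.differentiable two_ne_zero y), Complex.mul_conj, mul_add, Complex.add_re]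
    have h1 := hL y
    have h2 := hK y hy
    have h3 := exp_pos (u y)
    have h4 : 0 ≤ (4 * ((Complex.normSq (dz U y) : ℝ) : ℂ)).re := by
      rw [← Complex.ofReal_ofNat, ← Complex.ofReal_mul, Complex.ofReal_re]
      have := Complex.normSq_nonneg (dz U y)
      positivity
    nlinarith)
  simp only [hEr, Complex.ofReal_re] at this
  have e : ∫ y in ball c ρ, ((exp (u y) : ℝ) : ℂ) = ((∫ y in ball c ρ, exp (u y) : ℝ) : ℂ) :=
    integral_ofReal
  rw [e, Complex.ofReal_re] at this
  linarith

lemma hasDerivAt_circ_db_div {h : ℂ → ℂ} (hh : ContDiff ℝ 1 h) (c : ℂ) {r : ℝ} (hr : 0 < r) :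
    HasDerivAt (circ h c) (2 * (r * circ (fun y => db h y / (y - c)) c r)) r := by
  rw [mul_circ_div c hr.ne']
  exact hasDerivAt_circ_db hh c hr.ne'

lemma exists_tendsto_circ {h : ℂ → ℂ} (hh : ContDiff ℝ 1 h) (c : ℂ)
    (hi : Integrable (fun y => db h y / (y - c))) :
    ∃ L, Tendsto (circ h c) atTop (𝓝 L) := by
  have hm : Measurable (fun y => db h y / (y - c)) := by
    have := (hh.db (m := 0) (by norm_num)).continuous.measurable
    fun_prop
  exact ⟨_, tendsto_limUnder_of_hasDerivAt_of_integrableOn_Ioi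
    (fun r hr => hasDerivAt_circ_db_div hh c hr)
    ((integrableOn_mul_circ hm hi c).const_mul 2)⟩

lemma norm_circ_le {f : ℂ → ℂ} {g : ℂ → ℂ} {c : ℂ} {r : ℝ} (hg : Continuous g)
    (h : ∀ y ∈ sphere c |r|, ‖f y‖ ≤ (g y).re) : ‖circ f c r‖ ≤ (circ g c r).re := by
  rw [circ_re hg]
  refine intervalIntegral.norm_integral_le_of_norm_le (by linarith [pi_pos])
    (Eventually.of_forall fun θ _ => h _ (circleMap_mem_sphere' c r θ)) ?_
  exact (Complex.continuous_re.comp (hg.comp (continuous_circleMap c r))).intervalIntegrable _ _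

lemma hasDerivAt_circ_conj_mul {U : ℂ → ℝ}
    (hU : ContDiff ℝ 2 (fun z => (U z : ℂ))) (c : ℂ) {r : ℝ} (hr : 0 < r) :
    HasDerivAt (circ (fun y => (starRingEnd ℂ) (y - c) * (U y : ℂ)) c)
      (2 * r * circ (dz (fun w => (U w : ℂ))) c r) r := by
  have hh : ContDiff ℝ 1 (fun y => (starRingEnd ℂ) (y - c) * (U y : ℂ)) := by
    have h1 : ContDiff ℝ 1 (fun y : ℂ => (starRingEnd ℂ) (y - c)) :=
      Complex.conjCLE.contDiff.comp (contDiff_id.sub contDiff_const)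
    exact h1.mul (hU.of_le (by norm_num))
  convert hasDerivAt_circ_dz hh c hr.ne' using 1
  rw [circ, mul_assoc, ← intervalIntegral.integral_const_mul]
  congr 1
  refine intervalIntegral.integral_congr fun θ _ => ?_
  have e := (((HasW.id (z := circleMap c r θ)).sub (HasW.const c)).conj.mul
    (hU.hasW two_ne_zero _)).dz_eq
  simp only [e]
  have h1 : (starRingEnd ℂ) (circleMap c r θ - c) = r * Complex.exp (-(θ * Complex.I)) := by
    rw [circleMap_eq, add_sub_cancel_left, map_mul, Complex.conj_ofReal, conj_exp_I]
  rw [h1, Complex.exp_neg]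
  have := Complex.exp_ne_zero (θ * Complex.I)
  simp
  field_simp

section superharmonic
variable {U E : ℂ → ℝ} (hU : ContDiff ℝ 2 (fun z => (U z : ℂ)))
  (hL : ∀ z, 4 * dz (db (fun w => (U w : ℂ))) z = -(E z : ℂ)) (hE : Integrable E)
  (hpos : ∀ z, 0 ≤ E z)
include hU hL hE hpos

lemma neg_integral_le_circ_radial (c : ℂ) {r : ℝ} (hr : 0 ≤ r) :
    -(∫ y, E y) ≤ (circ (fun y => 2 * (y - c) * dz (fun w => (U w : ℂ)) y) c r).re := by
  have hEc : Continuous (fun z => -(E z : ℂ)) := by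
    rw [← funext hL]
    exact continuous_const.mul ((hU.db (m := 1) (by norm_num)).dz (m := 0) (by norm_num)).continuous
  have h1 := intervalIntegral.integral_eq_sub_of_hasDerivAt_of_le hr
    (continuous_circ (contDiff_radial hU c).continuous c).continuousOn
    (fun s hs => hasDerivAt_circ_laplacian hU c hs.1.ne') (by
      simp only [hL]
      have := continuous_circ hEc c
      exact Continuous.intervalIntegrable (by fun_prop) _ _)
  simp only [hL, circ_zero, sub_self, mul_zero, zero_mul, sub_zero] at h1
  rw [← h1, ← setIntegral_ball_eq hEc c hr, integral_neg]
  have e : ∫ y in ball c r, (E y : ℂ) = ((∫ y in ball c r, E y : ℝ) : ℂ) := integral_ofReal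
  rw [e, Complex.neg_re, Complex.ofReal_re]
  exact neg_le_neg (setIntegral_le_integral hE (Eventually.of_forall hpos))

lemma circ_ge_log (c : ℂ) {r : ℝ} (hr : 1 ≤ r) :
    (circ (fun w => (U w : ℂ)) c 1).re - (∫ y, E y) * log r ≤
      (circ (fun w => (U w : ℂ)) c r).re := by
  have m : MonotoneOn (fun r => (circ (fun w => (U w : ℂ)) c r).re + (∫ y, E y) * log r)
      (Set.Ici 1) := by
    refine monotoneOn_of_hasDerivWithinAt_nonneg (convex_Ici 1) (f' := fun r =>
      (circ (fun y => 2 * (y - c) * dz (fun w => (U w : ℂ)) y) c r / r).re +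
        (∫ y, E y) * r⁻¹) ?_ ?_ ?_
    · have := continuous_circ hU.continuous c
      refine (Complex.continuous_re.comp this).continuousOn.add (continuousOn_const.mul
        (continuousOn_log.mono fun x hx => ?_))
      exact (lt_of_lt_of_le one_pos hx).ne'
    · rw [interior_Ici]
      intro s hs
      have hs0 : s ≠ 0 := (one_pos.trans hs).ne'
      exact ((hasDerivAt_re (hasDerivAt_circ_radial hU c hs0)).add
        ((hasDerivAt_log hs0).const_mul _)).hasDerivWithinAt
    · rw [interior_Ici]
      intro s hs
      have hs0 : 0 < s := one_pos.trans hs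
      have := neg_integral_le_circ_radial hU hL hE hpos c hs0.le
      rw [Complex.div_ofReal_re, ← div_eq_mul_inv, ← add_div]
      exact div_nonneg (by linarith) hs0.le
  have := m Set.self_mem_Ici hr hr
  simp only [log_one, mul_zero, add_zero] at this
  linarith

lemma norm_circ_conj_mul_le {B : ℝ} (hB0 : 0 ≤ B) (hB : ∀ z, U z ≤ B) (c : ℂ) {r : ℝ}
    (hr : 1 ≤ r) :
    ‖circ (fun y => (starRingEnd ℂ) (y - c) * (U y : ℂ)) c r‖ ≤
      r * (4 * π * B - (circ (fun w => (U w : ℂ)) c 1).re + (∫ y, E y) * log r) := by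
  have hr0 : 0 < r := one_pos.trans_le hr
  have hUc := hU.continuous
  have h1 : ‖circ (fun y => (starRingEnd ℂ) (y - c) * (U y : ℂ)) c r‖ ≤
      (circ (fun y => (r : ℂ) * (2 * B - (U y : ℂ))) c r).re := by
    refine norm_circ_le (by fun_prop) fun y hy => ?_
    rw [mem_sphere, dist_eq_norm, abs_of_pos hr0] at hy
    rw [norm_mul, RCLike.norm_conj, hy, Complex.norm_real, norm_eq_abs, Complex.re_ofReal_mul]
    have : (2 * (B : ℂ) - U y).re = 2 * B - U y := by
      rw [← Complex.ofReal_ofNat, ← Complex.ofReal_mul, ← Complex.ofReal_sub, Complex.ofReal_re]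
    rw [this]
    refine mul_le_mul_of_nonneg_left (abs_le.mpr ⟨by linarith, ?_⟩) hr0.le
    linarith [hB y]
  refine h1.trans ?_
  have h2 : circ (fun y => (r : ℂ) * (2 * B - (U y : ℂ))) c r =
      r * (((4 * π * B : ℝ) : ℂ) - circ (fun w => (U w : ℂ)) c r) := by
    rw [circ_const_mul]
    congr 1
    unfold circ
    rw [intervalIntegral.integral_sub (by simp) (circleMap_integrable hUc c r _ _),
      intervalIntegral.integral_const, Complex.real_smul]
    push_cast
    ring
  rw [h2, Complex.re_ofReal_mul, Complex.sub_re, Complex.ofReal_re]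
  have := circ_ge_log hU hL hE hpos c hr
  gcongr
  linarith

lemma tendsto_circ_dz {B : ℝ} (hB0 : 0 ≤ B) (hB : ∀ z, U z ≤ B) {c L : ℂ}
    (h : Tendsto (circ (dz (fun w => (U w : ℂ))) c) atTop (𝓝 L)) : L = 0 := by
  by_contra hL0
  set H := circ (fun y => (starRingEnd ℂ) (y - c) * (U y : ℂ)) c
  set k := Complex.normSq L with hk
  have hk0 : 0 < k := Complex.normSq_pos.mpr hL0
  have h1 : Tendsto (fun r => ((starRingEnd ℂ) L * circ (dz (fun w => (U w : ℂ))) c r).re) atTop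
      (𝓝 k) := by
    have := (Complex.continuous_re.tendsto _).comp (h.const_mul ((starRingEnd ℂ) L))
    rwa [mul_comm, Complex.mul_conj, Complex.ofReal_re] at this
  obtain ⟨R, hR⟩ := eventually_atTop.mp (h1.eventually_const_le (half_lt_self hk0))
  set R' := max R 1
  have hR1 : 1 ≤ R' := le_max_right _ _
  have m : MonotoneOn (fun r => ((starRingEnd ℂ) L * H r).re - k / 2 * r ^ 2) (Set.Ici R') := by
    have hd : ∀ r, R' ≤ r → HasDerivAt
        (fun r => ((starRingEnd ℂ) L * H r).re - k / 2 * r ^ 2)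
        (((starRingEnd ℂ) L * (2 * r * circ (dz (fun w => (U w : ℂ))) c r)).re -
          k / 2 * (2 * r)) r := by
      intro r hr
      have hr0 : 0 < r := by linarith
      refine (hasDerivAt_re ((hasDerivAt_circ_conj_mul hU c hr0).const_mul _)).sub
        (((hasDerivAt_pow 2 r).const_mul (k / 2)).congr_deriv ?_)
      norm_num
    refine monotoneOn_of_hasDerivWithinAt_nonneg (convex_Ici R')
      (fun r hr => (hd r hr).continuousAt.continuousWithinAt)
      (fun r hr => (hd r (interior_subset hr)).hasDerivWithinAt) fun r hr => ?_
    have hr' : R' ≤ r := interior_subset (s := Set.Ici R') hr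
    have e : (starRingEnd ℂ) L * (2 * r * circ (dz (fun w => (U w : ℂ))) c r) =
        ((2 * r : ℝ) : ℂ) * ((starRingEnd ℂ) L * circ (dz (fun w => (U w : ℂ))) c r) := by
      push_cast; ring
    rw [e, Complex.re_ofReal_mul]
    have := hR r ((le_max_left _ _).trans hr')
    nlinarith
  set C0 := ((starRingEnd ℂ) L * H R').re - k / 2 * R' ^ 2
  set C1 := 4 * π * B - (circ (fun w => (U w : ℂ)) c 1).re
  set K := ∫ y, E y
  have h2 : ∀ᶠ r : ℝ in atTop, k / 2 ≤ -C0 * (r ^ 2)⁻¹ + ‖L‖ * (C1 * r⁻¹ + K * (log r / r)) := by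
    filter_upwards [eventually_ge_atTop R'] with r hr
    have hr0 : 0 < r := by linarith
    have h3 : C0 ≤ ((starRingEnd ℂ) L * H r).re - k / 2 * r ^ 2 := m Set.self_mem_Ici hr hr
    have h4 : ((starRingEnd ℂ) L * H r).re ≤ ‖L‖ * (r * (C1 + K * log r)) := by
      refine (Complex.re_le_norm _).trans ?_
      rw [norm_mul, RCLike.norm_conj]
      gcongr
      exact norm_circ_conj_mul_le hU hL hE hpos hB0 hB c (hR1.trans hr)
    have e : -C0 * (r ^ 2)⁻¹ + ‖L‖ * (C1 * r⁻¹ + K * (log r / r)) =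
        (-C0 + ‖L‖ * (r * (C1 + K * log r))) / r ^ 2 := by
      field_simp
    rw [e, le_div_iff₀ (by positivity)]
    linarith
  have h5 : Tendsto (fun r : ℝ => -C0 * (r ^ 2)⁻¹ + ‖L‖ * (C1 * r⁻¹ + K * (log r / r))) atTop
      (𝓝 (-C0 * 0 + ‖L‖ * (C1 * 0 + K * 0))) := by
    have a1 : Tendsto (fun r : ℝ => (r ^ 2)⁻¹) atTop (𝓝 0) :=
      tendsto_inv_atTop_zero.comp (tendsto_pow_atTop two_ne_zero)
    have a2 : Tendsto (fun r : ℝ => log r / r) atTop (𝓝 0) := by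
      simpa using Real.isLittleO_log_id_atTop.tendsto_div_nhds_zero
    exact (a1.const_mul _).add ((((tendsto_inv_atTop_zero).const_mul _).add
      (a2.const_mul _)).const_mul _)
  have := ge_of_tendsto h5 h2
  norm_num at this
  linarith

/-- Representation of the gradient of a superharmonic function bounded above, with integrable
Laplacian, as a Cauchy potential. -/
theorem cauchy_potential {B M : ℝ} (hB0 : 0 ≤ B) (hB : ∀ z, U z ≤ B) (hM : ∀ z, E z ≤ M) (c : ℂ) :
    4 * π * dz (fun w => (U w : ℂ)) c = ∫ y, (E y : ℂ) / (y - c) := by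
  set p := dz (fun w => (U w : ℂ))
  have hp : ContDiff ℝ 1 p := hU.dz (by norm_num)
  have e : db p = fun y => (-1 / 4) * (E y : ℂ) := by
    funext y
    rw [← dz_db_comm hU]
    linear_combination hL y / 4
  have e' : (fun y => db p y / (y - c)) = fun y => (-1 / 4) * ((E y : ℂ) / (y - c)) := by
    rw [e]; funext y; ring
  have hi : Integrable (fun y => (E y : ℂ) / (y - c)) := by
    refine integrable_div_sub (M := M) (hE.ofReal : Integrable (fun y => (E y : ℂ))) (fun y => ?_) c
    rw [Complex.norm_real, norm_eq_abs, abs_of_nonneg (hpos y)]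
    exact hM y
  have hi' : Integrable (fun y => db p y / (y - c)) := by
    rw [e']
    exact hi.const_mul _
  obtain ⟨L, hLt⟩ := exists_tendsto_circ hp c hi'
  have := cauchy_pompeiu_of_tendsto hp c hi' hLt
  rw [tendsto_circ_dz hU hL hE hpos hB0 hB hLt, e', integral_const_mul] at this
  linear_combination 2 * this
end superharmonic

section potential
variable {E : ℂ → ℝ} (hc : Continuous E) (hi : Integrable E) (hpos : ∀ z, 0 ≤ E z)
  (hd : Tendsto (fun z => ‖z‖ ^ 2 * E z) (cocompact ℂ) (𝓝 0))
include hi hpos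

omit hi in
include hd in
lemma tendsto_near_integral :
    Tendsto (fun z => ∫ y in ball z (‖z‖ / 2), (E y : ℂ) * y / (y - z)) (cocompact ℂ) (𝓝 0) := by
  rw [Metric.tendsto_nhds]
  intro δ hδ
  have hpi := pi_pos
  set ε := δ / (7 * π) with hε
  have hε0 : 0 < ε := by positivity
  have h1 := hd.eventually_lt_const hε0
  rw [eventually_cocompact_iff] at h1 ⊢
  obtain ⟨R, hR, h1⟩ := h1
  refine ⟨2 * R, by positivity, fun z hz => ?_⟩
  have hz0 : 0 < ‖z‖ := by linarith
  have h2 : ∀ y ∈ ball z (‖z‖ / 2), ‖(E y : ℂ) * y / (y - z)‖ ≤ 6 * ε / ‖z‖ * ‖y - z‖⁻¹ := by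
    intro y hy
    rw [mem_ball, dist_eq_norm] at hy
    have h3 := norm_sub_norm_le z y
    rw [norm_sub_rev] at h3
    have h4 := norm_sub_norm_le y z
    have h5 := (h1 y (by linarith)).le
    have h6 : ‖z‖ ^ 2 / 4 * E y ≤ ε := by
      refine le_trans (mul_le_mul_of_nonneg_right ?_ (hpos y)) h5
      nlinarith
    rw [norm_div, norm_mul, Complex.norm_real, norm_eq_abs, abs_of_nonneg (hpos y),
      div_eq_mul_inv]
    refine mul_le_mul_of_nonneg_right ?_ (by positivity)
    rw [le_div_iff₀ hz0]
    have h7 : E y * ‖y‖ ≤ E y * (3 / 2 * ‖z‖) :=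
      mul_le_mul_of_nonneg_left (by linarith) (hpos y)
    nlinarith
  have h3 := norm_integral_le_of_norm_le
    ((integrableOn_ball_inv_norm z (‖z‖ / 2)).const_mul (6 * ε / ‖z‖))
    ((ae_restrict_iff' isOpen_ball.measurableSet).mpr (Eventually.of_forall h2))
  rw [integral_const_mul] at h3
  have h4 := integral_ball_inv_norm_le z (ρ := ‖z‖ / 2) (by positivity)
  rw [dist_zero_right]
  calc _ ≤ _ := h3
    _ ≤ 6 * ε / ‖z‖ * (2 * π * (‖z‖ / 2)) := by gcongr
    _ = 6 / 7 * δ := by rw [hε]; field_simp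
    _ < δ := by linarith

include hc in
lemma tendsto_far_integral :
    Tendsto (fun z => ∫ y in (ball z (‖z‖ / 2))ᶜ, (E y : ℂ) * y / (y - z)) (cocompact ℂ)
      (𝓝 0) := by
  have e : ∀ z, ∫ y in (ball z (‖z‖ / 2))ᶜ, (E y : ℂ) * y / (y - z) =
      ∫ y, ((ball z (‖z‖ / 2))ᶜ).indicator (fun y => (E y : ℂ) * y / (y - z)) y := fun z =>
    (integral_indicator isOpen_ball.measurableSet.compl).symm
  simp only [e]
  have key : ∀ z y, ‖((ball z (‖z‖ / 2))ᶜ).indicator (fun y => (E y : ℂ) * y / (y - z)) y‖ ≤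
      E y * ‖y‖ * ‖y - z‖⁻¹ := by
    intro z y
    refine (norm_indicator_le_norm_self _ _).trans (le_of_eq ?_)
    rw [norm_div, norm_mul, Complex.norm_real, norm_eq_abs, abs_of_nonneg (hpos y),
      div_eq_mul_inv]
  rw [← integral_zero ℂ ℂ (μ := volume)]
  have : (cocompact ℂ).IsCountablyGenerated := by
    rw [← Metric.cobounded_eq_cocompact, ← comap_norm_atTop]
    infer_instance
  refine tendsto_integral_filter_of_dominated_convergence (fun y => 3 * E y)
    (Eventually.of_forall fun z => ?_) ?_ (hi.const_mul 3) (Eventually.of_forall fun y => ?_)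
  · refine AEStronglyMeasurable.indicator (Measurable.aestronglyMeasurable ?_)
      isOpen_ball.measurableSet.compl
    have := hc.measurable
    fun_prop
  · rw [eventually_cocompact_iff]
    refine ⟨1, one_pos, fun z hz => Eventually.of_forall fun y => ?_⟩
    by_cases hy : y ∈ ball z (‖z‖ / 2)
    · rw [Set.indicator_of_notMem (Set.notMem_compl_iff.mpr hy), norm_zero]
      linarith [hpos y]
    · refine (key z y).trans ?_
      rw [mem_ball, not_lt, dist_eq_norm] at hy
      have h1 := norm_sub_norm_le y z
      have h2 : 0 < ‖y - z‖ := by linarith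
      rw [← div_eq_mul_inv, div_le_iff₀ h2]
      have := mul_le_mul_of_nonneg_left (show ‖y‖ ≤ 3 * ‖y - z‖ by linarith) (hpos y)
      linarith
  · refine squeeze_zero_norm (fun z => key z y) ?_
    have h1 : Tendsto (fun z => y - z) (cocompact ℂ) (cocompact ℂ) :=
      (Homeomorph.subLeft y).isClosedEmbedding.tendsto_cocompact
    have h2 := (tendsto_inv_atTop_zero.comp ((tendsto_norm_cocompact_atTop (E := ℂ)).comp h1))
    simpa using h2.const_mul (E y * ‖y‖)

include hc hd in
lemma tendsto_mul_potential {M : ℝ} (hM : ∀ z, E z ≤ M) :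
    Tendsto (fun z => z * ∫ y, (E y : ℂ) / (y - z)) (cocompact ℂ) (𝓝 (-(∫ y, (E y : ℂ)))) := by
  have hi' : Integrable (fun y => (E y : ℂ)) := hi.ofReal
  have h1 : ∀ z, Integrable (fun y => (E y : ℂ) / (y - z)) := by
    refine integrable_div_sub (M := M) hi' (fun y => ?_)
    rw [Complex.norm_real, norm_eq_abs, abs_of_nonneg (hpos y)]
    exact hM y
  have h2 : ∀ z, (fun y => (E y : ℂ) * y / (y - z)) =ᵐ[volume]
      fun y => (E y : ℂ) + z * ((E y : ℂ) / (y - z)) := by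
    intro z
    filter_upwards [compl_mem_ae_iff.mpr (measure_singleton z)] with y hy
    have : y - z ≠ 0 := sub_ne_zero.mpr hy
    field_simp
    ring
  have h3 : ∀ z, Integrable (fun y => (E y : ℂ) * y / (y - z)) := fun z =>
    (hi'.add ((h1 z).const_mul z)).congr (h2 z).symm
  have h4 : ∀ z, z * ∫ y, (E y : ℂ) / (y - z) =
      ((∫ y in ball z (‖z‖ / 2), (E y : ℂ) * y / (y - z)) +
        ∫ y in (ball z (‖z‖ / 2))ᶜ, (E y : ℂ) * y / (y - z)) - ∫ y, (E y : ℂ) := by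
    intro z
    rw [integral_add_compl isOpen_ball.measurableSet (h3 z), integral_congr_ae (h2 z),
      integral_add hi' ((h1 z).const_mul z), integral_const_mul]
    ring
  simp only [h4]
  simpa using ((tendsto_near_integral hpos hd).add (tendsto_far_integral hc hi hpos)).sub_const _
end potential

lemma ContDiff.dz_infty {f : ℂ → ℂ} (h : ContDiff ℝ ∞ f) : ContDiff ℝ ∞ (_root_.dz f) :=
  h.dz (by simp)

lemma ContDiff.db_infty {f : ℂ → ℂ} (h : ContDiff ℝ ∞ f) : ContDiff ℝ ∞ (_root_.db f) :=
  h.db (by simp)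

lemma ContDiff.hasW_infty {f : ℂ → ℂ} (h : ContDiff ℝ ∞ f) (z : ℂ) :
    HasW f (_root_.dz f z) (_root_.db f z) z :=
  h.hasW (by simp) z

lemma ContDiff.iterate_dz {f : ℂ → ℂ} (h : ContDiff ℝ ∞ f) (k : ℕ) : ContDiff ℝ ∞ (_root_.dz^[k] f) := by
  induction k generalizing f with
  | zero => exact h
  | succ k ih => exact ih h.dz_infty

lemma db_dz {f : ℂ → ℂ} (h : ContDiff ℝ ∞ f) : db (dz f) = dz (db f) :=
  funext fun z => (dz_db_comm (contDiff_infty.mp h 2) z).symm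

lemma db_iterate_dz {f : ℂ → ℂ} (h : ContDiff ℝ ∞ f) (k : ℕ) :
    db (dz^[k] f) = dz^[k] (db f) := by
  induction k generalizing f with
  | zero => rfl
  | succ k ih =>
    rw [Function.iterate_succ_apply, Function.iterate_succ_apply, ih h.dz_infty, db_dz h]

/-- The limits at infinity of `z ^ (m + j) * ∂ʲf`, for `j ≤ n`, exist and belong to `I`. -/
def Asym (I : Ideal ℂ) (n m : ℕ) (f : ℂ → ℂ) : Prop :=
  ∀ j ≤ n, ∃ L ∈ I, Tendsto (fun z => z ^ (m + j) * dz^[j] f z) (cocompact ℂ) (𝓝 L)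

namespace Asym
variable {I : Ideal ℂ} {n m k : ℕ} {f g : ℂ → ℂ}

lemma mono {n' : ℕ} (h : Asym I n m f) (hn : n' ≤ n) : Asym I n' m f :=
  fun j hj => h j (hj.trans hn)

lemma succ_iff : Asym I (n + 1) m f ↔ Asym I 0 m f ∧ Asym I n (m + 1) (dz f) := by
  refine ⟨fun h => ⟨h.mono (Nat.zero_le _), fun j hj => ?_⟩, fun h j hj => ?_⟩
  · obtain ⟨L, hL, hT⟩ := h (j + 1) (by omega)
    refine ⟨L, hL, ?_⟩
    rwa [add_right_comm, add_assoc]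
  · rcases j with _ | j
    · exact h.1 0 le_rfl
    · obtain ⟨L, hL, hT⟩ := h.2 j (by omega)
      refine ⟨L, hL, ?_⟩
      rwa [add_right_comm, add_assoc] at hT

lemma add (hf : ContDiff ℝ ∞ f) (hg : ContDiff ℝ ∞ g) (h : Asym I n m f) (h' : Asym I n m g) :
    Asym I n m (fun z => f z + g z) := by
  induction n generalizing m f g with
  | zero =>
    intro j hj
    obtain rfl : j = 0 := by omega
    obtain ⟨L, hL, hT⟩ := h 0 le_rfl
    obtain ⟨L', hL', hT'⟩ := h' 0 le_rfl
    refine ⟨L + L', I.add_mem hL hL', ?_⟩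
    simpa [mul_add] using hT.add hT'
  | succ n ih =>
    refine succ_iff.mpr ⟨?_, ?_⟩
    · intro j hj
      obtain rfl : j = 0 := by omega
      obtain ⟨L, hL, hT⟩ := h 0 (by omega)
      obtain ⟨L', hL', hT'⟩ := h' 0 (by omega)
      refine ⟨L + L', I.add_mem hL hL', ?_⟩
      simpa [mul_add] using hT.add hT'
    · have e : dz (fun z => f z + g z) = fun z => dz f z + dz g z :=
        funext fun z => ((hf.hasW_infty z).add (hg.hasW_infty z)).dz_eq
      rw [e]
      exact ih hf.dz_infty hg.dz_infty (succ_iff.mp h).2 (succ_iff.mp h').2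

lemma mul_zero_order (h : Asym I 0 m f) (h' : Asym ⊤ 0 k g) :
    Asym I 0 (m + k) (fun z => f z * g z) := by
  intro j hj
  obtain rfl : j = 0 := by omega
  obtain ⟨L, hL, hT⟩ := h 0 le_rfl
  obtain ⟨L', -, hT'⟩ := h' 0 le_rfl
  refine ⟨L * L', I.mul_mem_right _ hL, (hT.mul hT').congr fun z => ?_⟩
  simp only [Function.iterate_zero, id_eq, add_zero, pow_add]
  ring

lemma mul (hf : ContDiff ℝ ∞ f) (hg : ContDiff ℝ ∞ g) (h : Asym I n m f) (h' : Asym ⊤ n k g) :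
    Asym I n (m + k) (fun z => f z * g z) := by
  induction n generalizing m k f g with
  | zero => exact mul_zero_order h h'
  | succ n ih =>
    refine succ_iff.mpr ⟨mul_zero_order (h.mono (Nat.zero_le _)) (h'.mono (Nat.zero_le _)), ?_⟩
    have e : dz (fun z => f z * g z) = fun z => dz f z * g z + f z * dz g z := funext fun z => by
      rw [((hf.hasW_infty z).mul (hg.hasW_infty z)).dz_eq]
    rw [e]
    refine add (hf.dz_infty.mul hg) (hf.mul hg.dz_infty) ?_ ?_
    · rw [add_right_comm]
      exact ih hf.dz_infty hg (succ_iff.mp h).2 (h'.mono n.le_succ)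
    · rw [add_assoc]
      exact ih hf hg.dz_infty (h.mono n.le_succ) (succ_iff.mp h').2

lemma const_mul (hf : ContDiff ℝ ∞ f) (c : ℂ) (h : Asym I n m f) :
    Asym I n m (fun z => c * f z) := by
  induction n generalizing m f with
  | zero =>
    intro j hj
    obtain rfl : j = 0 := by omega
    obtain ⟨L, hL, hT⟩ := h 0 le_rfl
    refine ⟨c * L, I.mul_mem_left _ hL, (hT.const_mul c).congr fun z => ?_⟩
    simp only [Function.iterate_zero, id_eq]
    ring
  | succ n ih =>
    refine succ_iff.mpr ⟨?_, ?_⟩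
    · intro j hj
      obtain rfl : j = 0 := by omega
      obtain ⟨L, hL, hT⟩ := h 0 (by omega)
      refine ⟨c * L, I.mul_mem_left _ hL, (hT.const_mul c).congr fun z => ?_⟩
      simp only [Function.iterate_zero, id_eq]
      ring
    · have e : dz (fun z => c * f z) = fun z => c * dz f z :=
        funext fun z => ((hf.hasW_infty z).const_mul c).dz_eq
      rw [e]
      exact ih hf.dz_infty (succ_iff.mp h).2

/-- Bootstrapping decay through a logarithmic derivative. -/
lemma of_dz_eq_mul (hf : ContDiff ℝ ∞ f) (hg : ContDiff ℝ ∞ g) (e : dz f = fun z => f z * g z)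
    (h0 : Asym I 0 m f) (h : Asym ⊤ n 1 g) : Asym I (n + 1) m f := by
  have key : ∀ j ≤ n, Asym I (j + 1) m f := by
    intro j hj
    induction j with
    | zero =>
      refine succ_iff.mpr ⟨h0, ?_⟩
      rw [e]
      exact mul_zero_order h0 (h.mono hj)
    | succ j ih =>
      refine succ_iff.mpr ⟨h0, ?_⟩
      rw [e]
      exact mul hf hg (ih (by omega)) (h.mono hj)
  exact key n le_rfl

end Asym

lemma tendsto_pow_mul_dz {f : ℂ → ℂ} (hf : ContDiff ℝ ∞ f) {k : ℕ} {c : ℂ}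
    (h0 : Tendsto (fun z => z ^ k * f z) (cocompact ℂ) (𝓝 c))
    (h1 : Tendsto (fun z => z ^ (k + 1) * db f z) (cocompact ℂ) (𝓝 0))
    (h2 : Tendsto (fun z => z ^ (k + 2) * dz (db f) z) (cocompact ℂ) (𝓝 0)) :
    Tendsto (fun z => z ^ (k + 1) * dz f z) (cocompact ℂ) (𝓝 (-k * c)) := by
  have hid : ContDiff ℝ ∞ (fun z : ℂ => z ^ k) := contDiff_id.pow k
  have hh : ContDiff ℝ ∞ (fun z => z ^ k * f z - c) := (hid.mul hf).sub contDiff_const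
  have ew : ∀ z, HasW (fun z => z ^ k * f z - c) (k * z ^ (k - 1) * f z + z ^ k * dz f z)
      (z ^ k * db f z) z := fun z =>
    (((HasW.id.pow k).mul (hf.hasW_infty z)).sub (HasW.const c)).congr' (by ring) (by ring)
  have e1 : db (fun z => z ^ k * f z - c) = fun z => z ^ k * db f z := funext fun z => (ew z).db_eq
  have e2 : ∀ z, dz (fun z => z ^ k * db f z) z =
      k * z ^ (k - 1) * db f z + z ^ k * dz (db f) z := fun z => by
    rw [((HasW.id.pow k).mul (hf.db_infty.hasW_infty z)).dz_eq]
    ring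
  have ek : ∀ z : ℂ, (k : ℂ) * (z * z ^ (k - 1)) = k * z ^ k := fun z => by
    rcases k with _ | k
    · simp
    · rw [Nat.add_sub_cancel, pow_succ']
  have := tendsto_mul_dz (contDiff_infty.mp hh 2) (by simpa using h0.sub_const c) (by
    rw [e1]
    simp only [e2]
    have := (h1.const_mul (k : ℂ)).add h2
    rw [mul_zero, add_zero] at this
    refine this.congr fun z => ?_
    linear_combination (-z * db f z) * ek z)
  have h3 := this.sub (h0.const_mul (k : ℂ))
  rw [zero_sub, ← neg_mul] at h3
  refine h3.congr fun z => ?_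
  rw [(ew z).dz_eq]
  linear_combination (f z) * ek z

lemma tendsto_iterate_dz {f : ℂ → ℂ} (hf : ContDiff ℝ ∞ f) {n : ℕ} {c : ℂ}
    (h0 : Tendsto (fun z => z * f z) (cocompact ℂ) (𝓝 c)) (h : Asym ⊥ n 2 (db f)) :
    ∀ k ≤ n, Tendsto (fun z => z ^ (k + 1) * dz^[k] f z) (cocompact ℂ)
      (𝓝 ((-1) ^ k * k.factorial * c)) := by
  intro k hk
  induction k with
  | zero => simpa using h0
  | succ k ih =>
    have hz : ∀ j ≤ n, Tendsto (fun z => z ^ (j + 2) * dz^[j] (db f) z) (cocompact ℂ) (𝓝 0) := by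
      intro j hj
      obtain ⟨L, hL, hT⟩ := h j hj
      rw [Ideal.mem_bot] at hL
      rwa [hL, add_comm] at hT
    have := tendsto_pow_mul_dz (hf.iterate_dz k) (ih (by omega))
      (by rw [db_iterate_dz hf]; exact hz k (by omega))
      (by
        rw [db_iterate_dz hf, ← Function.iterate_succ_apply' dz]
        exact hz (k + 1) hk)
    rw [← Function.iterate_succ_apply' dz] at this
    convert this using 2
    rw [Nat.factorial_succ]
    push_cast
    ring

lemma asym_of_db {f : ℂ → ℂ} (hf : ContDiff ℝ ∞ f) {n : ℕ} {c : ℂ}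
    (h0 : Tendsto (fun z => z * f z) (cocompact ℂ) (𝓝 c)) (h : Asym ⊥ n 2 (db f)) :
    Asym ⊤ n 1 f := fun j hj =>
  ⟨_, trivial, by simpa [add_comm] using tendsto_iterate_dz hf h0 h j hj⟩

/-- Liouville's theorem in terms of `∂/∂z̄`. -/
lemma eq_zero_of_db_eq_zero {f : ℂ → ℂ} (hf : ContDiff ℝ ∞ f) (h : ∀ z, db f z = 0) {n : ℕ} {c : ℂ}
    (hc : Tendsto (fun z => z ^ (n + 1) * f z) (cocompact ℂ) (𝓝 c)) : ∀ z, f z = 0 := by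
  have hd : Differentiable ℂ f := fun z => by
    have := hf.hasW_infty z
    rw [h z] at this
    refine (hasFDerivAt_of_restrictScalars ℝ (f' := dz f z • ContinuousLinearMap.id ℂ ℂ)
      this ?_).differentiableAt
    ext v
    simp
  have h0 : Tendsto f (cocompact ℂ) (𝓝 0) := by
    have h1 : Tendsto (fun z : ℂ => (z ^ (n + 1))⁻¹) (cocompact ℂ) (𝓝 0) := by
      have : Tendsto (fun z : ℂ => z⁻¹) (cocompact ℂ) (𝓝 0) := by
        rw [← Metric.cobounded_eq_cocompact]
        exact tendsto_inv₀_cobounded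
      simpa [inv_pow] using this.pow (n + 1)
    have h2 := h1.mul hc
    rw [zero_mul] at h2
    refine h2.congr' ?_
    rw [EventuallyEq, eventually_cocompact_iff]
    refine ⟨1, one_pos, fun z hz => ?_⟩
    have : z ≠ 0 := norm_pos_iff.mp (one_pos.trans_le hz)
    field_simp
  exact fun z => hd.apply_eq_of_tendsto_cocompact z h0

lemma limit_eq_zero_of_db_eq_zero {f : ℂ → ℂ} (hf : ContDiff ℝ ∞ f) (h : ∀ z, db f z = 0) {n : ℕ}
    {c : ℂ} (hc : Tendsto (fun z => z ^ (n + 1) * f z) (cocompact ℂ) (𝓝 c)) : c = 0 := by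
  have := eq_zero_of_db_eq_zero hf h hc
  simp only [this, mul_zero] at hc
  exact (tendsto_nhds_unique tendsto_const_nhds hc).symm

/-- The `G₂` Toda system for the gradients `p = -∂U₁`, `q = -∂U₂` of the potentials and the
densities `a = e^{u₁} / 4`, `b = e^{u₂} / 4`. -/
structure IsToda (p q a b : ℂ → ℂ) : Prop where
  contDiff_p : ContDiff ℝ ∞ p
  contDiff_q : ContDiff ℝ ∞ q
  contDiff_a : ContDiff ℝ ∞ a
  contDiff_b : ContDiff ℝ ∞ b
  db_p : db p = a
  db_q : db q = b
  dz_a : dz a = fun z => a z * (q z - 2 * p z)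
  dz_b : dz b = fun z => b z * (3 * p z - 2 * q z)

/-- The differential polynomial of the degree six invariant of `G₂`. -/
def sextic (p : ℂ → ℂ) (z : ℂ) : ℂ :=
  dz^[5] p z + 19 / 2 * dz^[2] p z ^ 2 + 16 * (dz p z * dz^[3] p z) +
    5 * (p z * dz^[4] p z) + 18 * dz p z ^ 3 + 51 * (p z * dz p z * dz^[2] p z) +
    11 * (p z ^ 2 * dz^[3] p z) + 69 / 2 * (p z ^ 2 * dz p z ^ 2) + 13 * (p z ^ 3 * dz^[2] p z) +
    9 * (p z ^ 4 * dz p z) + 1 / 2 * p z ^ 6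

namespace IsToda
variable {p q a b : ℂ → ℂ} {s t : ℂ} (T : IsToda p q a b)
include T

lemma hasW_p (z : ℂ) : HasW p (dz p z) (a z) z :=
  (T.contDiff_p.hasW_infty z).congr' rfl (congrFun T.db_p z)

lemma hasW_q (z : ℂ) : HasW q (dz q z) (b z) z :=
  (T.contDiff_q.hasW_infty z).congr' rfl (congrFun T.db_q z)

lemma hasW_a (z : ℂ) : HasW a (a z * (q z - 2 * p z)) (db a z) z :=
  (T.contDiff_a.hasW_infty z).congr' (congrFun T.dz_a z) rfl

lemma hasW_dz_p (z : ℂ) : HasW (dz p) (dz (dz p) z) (a z * (q z - 2 * p z)) z :=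
  (T.contDiff_p.dz_infty.hasW_infty z).congr' rfl (by rw [db_dz T.contDiff_p, T.db_p, T.dz_a])

lemma hasW_dz_q (z : ℂ) : HasW (dz q) (dz (dz q) z) (b z * (3 * p z - 2 * q z)) z :=
  (T.contDiff_q.dz_infty.hasW_infty z).congr' rfl (by rw [db_dz T.contDiff_q, T.db_q, T.dz_b])

lemma hasW_iterate {k : ℕ} {l l' m : ℂ → ℂ}
    (h : ∀ z, HasW (dz^[k] p) (dz^[k + 1] p z) (a z * l z) z)
    (hl : ∀ z, HasW l (l' z) (m z) z) (z : ℂ) :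
    HasW (dz^[k + 1] p) (dz^[k + 2] p z) (a z * ((q z - 2 * p z) * l z + l' z)) z := by
  refine ((T.contDiff_p.iterate_dz (k + 1)).hasW_infty z).congr'
    (Function.iterate_succ_apply' dz _ _ ▸ rfl) ?_
  have hs : ContDiff ℝ ∞ (dz^[k] p) := T.contDiff_p.iterate_dz k
  rw [Function.iterate_succ_apply', db_dz hs, funext fun z => (h z).db_eq,
    ((T.hasW_a z).mul (hl z)).dz_eq]
  ring

/-- The quadratic conservation law. -/
lemma hasW_quadratic (z : ℂ) : ∃ d, HasW
    (fun z => 3 * p z ^ 2 - 3 * (p z * q z) + q z ^ 2 + 3 * dz p z + dz q z) d 0 z :=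
  ⟨_, ((((((T.hasW_p z).pow 2).const_mul 3).sub (((T.hasW_p z).mul (T.hasW_q z)).const_mul 3)).add
    ((T.hasW_q z).pow 2)).add ((T.hasW_dz_p z).const_mul 3)).add (T.hasW_dz_q z) |>.congr' rfl
    (by push_cast; ring)⟩

/-- The sextic conservation law, on the zero set of the quadratic one. -/
lemma hasW_sextic (hq : ∀ z, 3 * p z ^ 2 - 3 * (p z * q z) + q z ^ 2 + 3 * dz p z + dz q z = 0)
    (z : ℂ) :
    ∃ d, HasW (sextic p) d 0 z := by
  have w0 := T.hasW_p
  have w1 : ∀ z, HasW (dz p) (dz^[2] p z) (a z * (q z - 2 * p z)) z := T.hasW_dz_p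
  have wq : ∀ z, HasW q (-(3 * p z ^ 2 - 3 * (p z * q z) + q z ^ 2 + 3 * dz p z)) (b z) z :=
    fun z => (T.hasW_q z).congr' (by linear_combination hq z) rfl
  have w2 : ∀ z, HasW (dz^[2] p) (dz^[3] p z)
      (a z * (p z ^ 2 - p z * q z - 5 * dz p z)) z := fun z =>
    (T.hasW_iterate (k := 1) w1 (fun z => (wq z).sub ((w0 z).const_mul 2)) z).congr' rfl (by ring)
  have w3 : ∀ z, HasW (dz^[3] p) (dz^[4] p z)
      (a z * (15 * (p z * dz p z) - 6 * (dz p z * q z) + p z ^ 3 - 5 * dz^[2] p z)) z := fun z =>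
    (T.hasW_iterate (k := 2) w2 (fun z => (((w0 z).pow 2).sub ((w0 z).mul (wq z))).sub
      ((w1 z).const_mul 5)) z).congr' rfl (by push_cast; ring)
  have w4 : ∀ z, HasW (dz^[4] p) (dz^[5] p z)
      (a z * (33 * dz p z ^ 2 + 25 * (p z * dz^[2] p z) - 11 * (dz^[2] p z * q z) -
        9 * (p z ^ 2 * dz p z) + 9 * (p z * dz p z * q z) - 5 * dz^[3] p z + p z ^ 3 * q z -
        2 * p z ^ 4)) z := fun z =>
    (T.hasW_iterate (k := 3) w3 (fun z => (((((w0 z).mul (w1 z)).const_mul 15).sub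
      (((w1 z).mul (wq z)).const_mul 6)).add ((w0 z).pow 3)).sub ((w2 z).const_mul 5)) z).congr' rfl
      (by push_cast; ring)
  have w5 : ∀ z, HasW (dz^[5] p) (dz^[6] p z)
      (a z * (124 * (dz p z * dz^[2] p z) + 35 * (p z * dz^[3] p z) - 16 * (dz^[3] p z * q z) -
        26 * (p z ^ 2 * dz^[2] p z) + 23 * (p z * dz^[2] p z * q z) - 111 * (p z * dz p z ^ 2) +
        42 * (dz p z ^ 2 * q z) - 20 * (p z ^ 3 * dz p z) + 3 * (p z ^ 2 * dz p z * q z) -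
        5 * dz^[4] p z + p z ^ 5 - p z ^ 4 * q z)) z := fun z =>
    (T.hasW_iterate (k := 4) w4 (fun z => (((((((((w1 z).pow 2).const_mul 33).add
      (((w0 z).mul (w2 z)).const_mul 25)).sub (((w2 z).mul (wq z)).const_mul 11)).sub
      ((((w0 z).pow 2).mul (w1 z)).const_mul 9)).add
      ((((w0 z).mul (w1 z)).mul (wq z)).const_mul 9)).sub ((w3 z).const_mul 5)).add
      (((w0 z).pow 3).mul (wq z))).sub (((w0 z).pow 4).const_mul 2)) z).congr' rfl
      (by push_cast; ring)
  exact ⟨_, (((((((((((w5 z).add (((w2 z).pow 2).const_mul (19 / 2))).add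
    (((w1 z).mul (w3 z)).const_mul 16)).add (((w0 z).mul (w4 z)).const_mul 5)).add
    (((w1 z).pow 3).const_mul 18)).add ((((w0 z).mul (w1 z)).mul (w2 z)).const_mul 51)).add
    ((((w0 z).pow 2).mul (w3 z)).const_mul 11)).add
    ((((w0 z).pow 2).mul ((w1 z).pow 2)).const_mul (69 / 2))).add
    ((((w0 z).pow 3).mul (w2 z)).const_mul 13)).add
    ((((w0 z).pow 4).mul (w1 z)).const_mul 9)).add
    (((w0 z).pow 6).const_mul (1 / 2))).congr' rfl (by push_cast; ring)⟩

section asymptotics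
variable (ha : Tendsto (fun z => z ^ 2 * a z) (cocompact ℂ) (𝓝 0))
  (hb : Tendsto (fun z => z ^ 2 * b z) (cocompact ℂ) (𝓝 0))
  (hs : Tendsto (fun z => z * p z) (cocompact ℂ) (𝓝 s))
  (ht : Tendsto (fun z => z * q z) (cocompact ℂ) (𝓝 t))
include ha hb hs ht

lemma asym (n : ℕ) : Asym ⊤ n 1 p ∧ Asym ⊤ n 1 q ∧ Asym ⊥ (n + 1) 2 a ∧ Asym ⊥ (n + 1) 2 b := by
  have hp := T.contDiff_p
  have hq := T.contDiff_q
  have zero : ∀ {f : ℂ → ℂ}, Tendsto (fun z => z ^ 2 * f z) (cocompact ℂ) (𝓝 0) →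
      Asym ⊥ 0 2 f := fun h j hj => by
    obtain rfl : j = 0 := by omega
    exact ⟨0, rfl, h⟩
  have hab : ∀ {n}, Asym ⊤ n 1 p → Asym ⊤ n 1 q → Asym ⊥ (n + 1) 2 a ∧ Asym ⊥ (n + 1) 2 b := by
    intro n h1 h2
    have c1 : ContDiff ℝ ∞ fun z => (-2 : ℂ) * p z := contDiff_const.mul hp
    have c2 : ContDiff ℝ ∞ fun z => (3 : ℂ) * p z := contDiff_const.mul hp
    have c3 : ContDiff ℝ ∞ fun z => (-2 : ℂ) * q z := contDiff_const.mul hq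
    refine ⟨Asym.of_dz_eq_mul T.contDiff_a (hq.add c1) ?_ (zero ha)
      (Asym.add hq c1 h2 (h1.const_mul hp _)), Asym.of_dz_eq_mul T.contDiff_b (c2.add c3) ?_
      (zero hb) (Asym.add c2 c3 (h1.const_mul hp _) (h2.const_mul hq _))⟩
    · rw [T.dz_a]; funext z; ring
    · rw [T.dz_b]; funext z; ring
  have key : Asym ⊤ n 1 p ∧ Asym ⊤ n 1 q := by
    induction n with
    | zero =>
      refine ⟨asym_of_db hp hs ?_, asym_of_db hq ht ?_⟩
      · rw [T.db_p]; exact zero ha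
      · rw [T.db_q]; exact zero hb
    | succ n ih =>
      have := hab ih.1 ih.2
      refine ⟨asym_of_db hp hs ?_, asym_of_db hq ht ?_⟩
      · rw [T.db_p]; exact this.1
      · rw [T.db_q]; exact this.2
  exact ⟨key.1, key.2, hab key.1 key.2⟩

lemma quadratic_limit : Tendsto (fun z => z ^ (1 + 1) *
    (3 * p z ^ 2 - 3 * (p z * q z) + q z ^ 2 + 3 * dz p z + dz q z)) (cocompact ℂ)
    (𝓝 (3 * s ^ 2 - 3 * (s * t) + t ^ 2 + 3 * -s + -t)) := by
  obtain ⟨-, -, h1, h2⟩ := T.asym ha hb hs ht 0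
  have p1 : Tendsto (fun z => z ^ 2 * dz p z) (cocompact ℂ) (𝓝 (-s)) := by
    simpa using tendsto_iterate_dz T.contDiff_p hs (by rw [T.db_p]; exact h1) 1 le_rfl
  have q1 : Tendsto (fun z => z ^ 2 * dz q z) (cocompact ℂ) (𝓝 (-t)) := by
    simpa using tendsto_iterate_dz T.contDiff_q ht (by rw [T.db_q]; exact h2) 1 le_rfl
  refine ((((((hs.pow 2).const_mul 3).sub ((hs.mul ht).const_mul 3)).add (ht.pow 2)).add
    (p1.const_mul 3)).add q1).congr fun z => ?_
  ring

lemma quadratic_eq_zero :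
    ∀ z, 3 * p z ^ 2 - 3 * (p z * q z) + q z ^ 2 + 3 * dz p z + dz q z = 0 := by
  have hp := T.contDiff_p
  have hq := T.contDiff_q
  have hp' := hp.dz_infty
  have hq' := hq.dz_infty
  exact eq_zero_of_db_eq_zero (by fun_prop) (fun z => (T.hasW_quadratic z).choose_spec.db_eq)
    (T.quadratic_limit ha hb hs ht)

lemma quadratic_relation : 3 * s ^ 2 - 3 * (s * t) + t ^ 2 - 3 * s - t = 0 := by
  have h := T.quadratic_limit ha hb hs ht
  simp only [T.quadratic_eq_zero ha hb hs ht, mul_zero] at h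
  linear_combination -tendsto_nhds_unique tendsto_const_nhds h

lemma sextic_relation : s * (s - 1) * (s - 2) * (s - 4) * (s - 5) * (s - 6) = 0 := by
  have hp := T.contDiff_p
  have hk : ∀ k ≤ 5, Tendsto (fun z => z ^ (k + 1) * dz^[k] p z) (cocompact ℂ)
      (𝓝 ((-1) ^ k * k.factorial * s)) :=
    tendsto_iterate_dz hp hs (by rw [T.db_p]; exact (T.asym ha hb hs ht 4).2.2.1)
  have h1 : Tendsto (fun z => z ^ 2 * dz p z) (cocompact ℂ) _ := hk 1 (by norm_num)
  have h2 := hk 2 (by norm_num)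
  have h3 := hk 3 (by norm_num)
  have h4 := hk 4 (by norm_num)
  have h5 := hk 5 (by norm_num)
  have c1 := hp.dz_infty
  have c2 := hp.iterate_dz 2
  have c3 := hp.iterate_dz 3
  have c4 := hp.iterate_dz 4
  have c5 := hp.iterate_dz 5
  have := limit_eq_zero_of_db_eq_zero (f := sextic p) (n := 5) (by unfold sextic; fun_prop)
    (fun z => (T.hasW_sextic (T.quadratic_eq_zero ha hb hs ht) z).choose_spec.db_eq)
    (((((((((((h5.add ((h2.pow 2).const_mul (19 / 2))).add ((h1.mul h3).const_mul 16)).add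
      ((hs.mul h4).const_mul 5)).add ((h1.pow 3).const_mul 18)).add
      (((hs.mul h1).mul h2).const_mul 51)).add (((hs.pow 2).mul h3).const_mul 11)).add
      (((hs.pow 2).mul (h1.pow 2)).const_mul (69 / 2))).add (((hs.pow 3).mul h2).const_mul 13)).add
      (((hs.pow 4).mul h1).const_mul 9)).add ((hs.pow 6).const_mul (1 / 2))).congr
      fun z => by unfold sextic; ring)
  norm_num [Nat.factorial] at this
  linear_combination 2 * this

end asymptotics

end IsToda

lemma exists_le_of_decay {E : ℂ → ℝ} (hc : Continuous E)
    (hd : Tendsto (fun z => ‖z‖ ^ 2 * E z) (cocompact ℂ) (𝓝 0)) : ∃ M, ∀ z, E z ≤ M := by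
  obtain ⟨r, hr, h⟩ := eventually_cocompact_iff.mp (hd.eventually_lt_const one_pos)
  obtain ⟨M, hM⟩ := (isCompact_closedBall (0 : ℂ) (max r 1)).bddAbove_image hc.continuousOn
  refine ⟨max M 1, fun z => ?_⟩
  by_cases hz : ‖z‖ ≤ max r 1
  · exact (hM ⟨z, by simpa using hz, rfl⟩).trans (le_max_left _ _)
  · rw [not_le, max_lt_iff] at hz
    have h1 := h z hz.1.le
    have h2 : 1 ≤ ‖z‖ ^ 2 := one_le_pow₀ hz.2.le
    refine le_trans ?_ (le_max_right _ _)
    nlinarith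

lemma tendsto_sq_mul_ofReal {E : ℂ → ℝ} (hpos : ∀ z, 0 ≤ E z)
    (hd : Tendsto (fun z => ‖z‖ ^ 2 * E z) (cocompact ℂ) (𝓝 0)) :
    Tendsto (fun z => z ^ 2 * ((E z : ℂ) / 4)) (cocompact ℂ) (𝓝 0) := by
  have h := hd.div_const 4
  rw [zero_div] at h
  refine squeeze_zero_norm (fun z => le_of_eq ?_) h
  rw [norm_mul, norm_div, norm_pow, Complex.norm_real, norm_eq_abs, abs_of_nonneg (hpos z)]
  norm_num
  ring

/-- A gain of regularity for real functions whose `∂`-derivative is regular. -/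
lemma contDiff_succ_of_dz {U : ℂ → ℝ} {n : ℕ} (h1 : ContDiff ℝ 1 (fun z => (U z : ℂ)))
    (h : ContDiff ℝ n (dz (fun z => (U z : ℂ)))) :
    ContDiff ℝ ((n + 1 : ℕ) : WithTop ℕ∞) (fun z => (U z : ℂ)) := by
  push_cast
  refine contDiff_succ_iff_fderiv.mpr ⟨h1.differentiable one_ne_zero, by simp, ?_⟩
  have e : fderiv ℝ (fun z => (U z : ℂ)) = fun z =>
      dz (fun z => (U z : ℂ)) z • ContinuousLinearMap.id ℝ ℂ +
        (starRingEnd ℂ) (dz (fun z => (U z : ℂ)) z) • (Complex.conjCLE : ℂ →L[ℝ] ℂ) := by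
    funext z
    rw [← db_ofReal (h1.differentiable one_ne_zero z)]
    exact (h1.hasW one_ne_zero z).fderiv
  rw [e]
  exact (h.smul contDiff_const).add ((Complex.conjCLE.contDiff.comp h).smul contDiff_const)

/-- The growth rate of the gradient of a function `u` for which `|z|² exp u` decays. -/
lemma one_le_of_tendsto {u : ℂ → ℝ} {k : ℝ} (hu : ContDiff ℝ 1 (fun z => (u z : ℂ)))
    (hk : Tendsto (fun z => z * dz (fun w => (u w : ℂ)) z) (cocompact ℂ) (𝓝 (-k)))
    (hd : Tendsto (fun z => ‖z‖ ^ 2 * exp (u z)) (cocompact ℂ) (𝓝 0)) : 1 ≤ k := by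
  by_contra! hlt
  have hre : Tendsto (fun z => (z * dz (fun w => (u w : ℂ)) z).re) (cocompact ℂ) (𝓝 (-k)) := by
    have := (Complex.continuous_re.tendsto _).comp hk
    rwa [Complex.neg_re, Complex.ofReal_re] at this
  obtain ⟨R, hR, h⟩ := eventually_cocompact_iff.mp
    (hre.eventually_const_lt (show -1 < -k by linarith))
  have hder : ∀ r : ℝ, R ≤ r → HasDerivAt (fun r : ℝ => 2 * log r + u r)
      (2 / r + 2 * (dz (fun w => (u w : ℂ)) r).re) r := by
    intro r hr
    have hr0 : r ≠ 0 := (hR.trans_le hr).ne'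
    have h1 := hasDerivAt_re
      ((hu.hasW one_ne_zero (r : ℂ)).hasDerivAt_comp (Complex.ofRealCLM.hasDerivAt (x := r)))
    rw [db_ofReal (hu.differentiable one_ne_zero r)] at h1
    refine (((hasDerivAt_log hr0).const_mul 2).add h1).congr_deriv ?_
    simp
    ring
  have m : MonotoneOn (fun r : ℝ => 2 * log r + u r) (Set.Ici R) := by
    refine monotoneOn_of_hasDerivWithinAt_nonneg (convex_Ici R)
      (fun r hr => (hder r hr).continuousAt.continuousWithinAt)
      (fun r hr => (hder r (interior_subset hr)).hasDerivWithinAt) fun r hr => ?_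
    have hr' : R ≤ r := interior_subset (s := Set.Ici R) hr
    have hr0 : 0 < r := hR.trans_le hr'
    have h1 := h r (by rwa [Complex.norm_real, norm_eq_abs, abs_of_pos hr0])
    rw [Complex.re_ofReal_mul] at h1
    have : 2 / r + 2 * (dz (fun w => (u w : ℂ)) r).re =
        2 * (1 + r * (dz (fun w => (u w : ℂ)) r).re) / r := by field_simp
    rw [this]
    exact div_nonneg (by linarith) hr0.le
  obtain ⟨R', hR', h'⟩ := eventually_cocompact_iff.mp
    (hd.eventually_lt_const (exp_pos (2 * log R + u R)))
  have hmem : R ≤ max R R' := le_max_left _ _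
  have hpos : 0 < max R R' := hR.trans_le hmem
  have h1 := exp_le_exp.mpr (m Set.self_mem_Ici hmem hmem)
  have h2 := h' (max R R' : ℝ) (by
    rw [Complex.norm_real, norm_eq_abs, abs_of_pos hpos]; exact le_max_right _ _)
  rw [Complex.norm_real, norm_eq_abs, abs_of_pos hpos] at h2
  have h3 : exp (2 * log (max R R') + u (max R R' : ℝ)) =
      max R R' ^ 2 * exp (u (max R R' : ℝ)) := by
    rw [exp_add, mul_comm 2, exp_mul, exp_log hpos]
    norm_num
  simp only at h1
  rw [h3] at h1
  linarith

lemma eq_of_relations {s t : ℝ} (h1 : 1 ≤ 2 * s - t) (h2 : 1 ≤ 2 * t - 3 * s)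
    (hq : 3 * s ^ 2 - 3 * (s * t) + t ^ 2 - 3 * s - t = 0)
    (hs : s * (s - 1) * (s - 2) * (s - 4) * (s - 5) * (s - 6) = 0) : s = 6 ∧ t = 10 := by
  simp only [mul_eq_zero, sub_eq_zero] at hs
  rcases hs with ((((rfl | rfl) | rfl) | rfl) | rfl) | rfl
  · linarith
  · linarith
  · linarith
  · have : (t - 4) * (t - 9) = 0 := by linear_combination hq
    rcases mul_eq_zero.mp this with h | h <;> linarith
  · have : (t - 6) * (t - 10) = 0 := by linear_combination hq
    rcases mul_eq_zero.mp this with h | h <;> linarith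
  · have : (t - 9) * (t - 10) = 0 := by linear_combination hq
    rcases mul_eq_zero.mp this with h | h
    · linarith
    · exact ⟨rfl, by linarith⟩

lemma contDiff_succ_of_laplacian {U E : ℂ → ℝ} {n : ℕ} (hU : ContDiff ℝ 2 (fun z => (U z : ℂ)))
    (hL : ∀ z, 4 * dz (db (fun w => (U w : ℂ))) z = -(E z : ℂ))
    (hE : ContDiff ℝ n (fun z => (E z : ℂ))) :
    ContDiff ℝ ((n + 1 : ℕ) : WithTop ℕ∞) (fun z => (U z : ℂ)) := by
  refine contDiff_succ_of_dz (hU.of_le (by norm_num))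
    (contDiff_of_db (n := (n : ℕ∞)) (hU.dz (by norm_num)) ?_)
  have e : db (dz (fun w => (U w : ℂ))) = fun z => (-1 / 4) * (E z : ℂ) := by
    funext z
    rw [← dz_db_comm hU]
    linear_combination hL z / 4
  rw [e]
  exact contDiff_const.mul hE

lemma tendsto_mul_dz_of_laplacian {U E : ℂ → ℝ} {B M : ℝ} (hU : ContDiff ℝ 2 (fun z => (U z : ℂ)))
    (hL : ∀ z, 4 * dz (db (fun w => (U w : ℂ))) z = -(E z : ℂ))
    (hc : Continuous E) (hE : Integrable E) (hpos : ∀ z, 0 ≤ E z)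
    (hd : Tendsto (fun z => ‖z‖ ^ 2 * E z) (cocompact ℂ) (𝓝 0))
    (hB0 : 0 ≤ B) (hB : ∀ z, U z ≤ B) (hM : ∀ z, E z ≤ M) :
    Tendsto (fun z => z * -dz (fun w => (U w : ℂ)) z) (cocompact ℂ)
      (𝓝 (((∫ z, E z) / (4 * π) : ℝ) : ℂ)) := by
  have hπ : (π : ℂ) ≠ 0 := Complex.ofReal_ne_zero.mpr pi_ne_zero
  have h := (tendsto_mul_potential hc hE hpos hd hM).const_mul (-(1 / (4 * π : ℂ)))
  rw [integral_complex_ofReal] at h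
  convert h using 2
  · rw [← cauchy_potential hU hL hE hpos hB0 hB hM]
    field_simp
  · push_cast
    field_simp

/-- The `∂`-derivative of a linear combination of real functions. -/
lemma dz_comb {u v : ℂ → ℝ} (a b : ℝ) (hu : ContDiff ℝ 2 (fun z => (u z : ℂ)))
    (hv : ContDiff ℝ 2 (fun z => (v z : ℂ))) (z : ℂ) :
    dz (fun z => ((a * u z + b * v z : ℝ) : ℂ)) z =
      a * dz (fun z => (u z : ℂ)) z + b * dz (fun z => (v z : ℂ)) z := by
  have h := ((hu.hasW two_ne_zero z).const_mul (a : ℂ)).add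
    ((hv.hasW two_ne_zero z).const_mul (b : ℂ))
  simpa using h.dz_eq

lemma dz_db_comb {u v : ℂ → ℝ} (a b : ℝ) (hu : ContDiff ℝ 2 (fun z => (u z : ℂ)))
    (hv : ContDiff ℝ 2 (fun z => (v z : ℂ))) (z : ℂ) :
    dz (db (fun z => ((a * u z + b * v z : ℝ) : ℂ))) z =
      a * dz (db (fun z => (u z : ℂ))) z + b * dz (db (fun z => (v z : ℂ))) z := by
  have e : db (fun z => ((a * u z + b * v z : ℝ) : ℂ)) =
      fun z => a * db (fun z => (u z : ℂ)) z + b * db (fun z => (v z : ℂ)) z := by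
    funext z
    have h := ((hu.hasW two_ne_zero z).const_mul (a : ℂ)).add
      ((hv.hasW two_ne_zero z).const_mul (b : ℂ))
    simpa using h.db_eq
  have h := (((hu.db (m := 1) (by norm_num)).hasW one_ne_zero z).const_mul (a : ℂ)).add
    (((hv.db (m := 1) (by norm_num)).hasW one_ne_zero z).const_mul (b : ℂ))
  rw [e]
  exact h.dz_eq

lemma contDiff_comb {u v : ℂ → ℝ} {n : WithTop ℕ∞} (a b : ℝ)
    (hu : ContDiff ℝ n (fun z => (u z : ℂ))) (hv : ContDiff ℝ n (fun z => (v z : ℂ))) :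
    ContDiff ℝ n (fun z => ((a * u z + b * v z : ℝ) : ℂ)) := by
  simpa using (contDiff_const (c := (a : ℂ)).mul hu).add (contDiff_const (c := (b : ℂ)).mul hv)

lemma contDiff_exp {u : ℂ → ℝ} {n : WithTop ℕ∞} (hu : ContDiff ℝ n (fun z => (u z : ℂ))) :
    ContDiff ℝ n (fun z => (exp (u z) : ℂ)) := by
  simpa using hu.cexp

section System

variable {u v : ℂ → ℝ}

/-- Solutions of the `G₂` Toda system on the complex plane are smooth. -/
lemma contDiff_infty_of_toda (hu : ContDiff ℝ 2 (fun z => (u z : ℂ)))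
    (hv : ContDiff ℝ 2 (fun z => (v z : ℂ)))
    (hLu : ∀ z, 4 * dz (db (fun w => ((2 * u w + 1 * v w : ℝ) : ℂ))) z = -(exp (u z) : ℂ))
    (hLv : ∀ z, 4 * dz (db (fun w => ((3 * u w + 2 * v w : ℝ) : ℂ))) z = -(exp (v z) : ℂ)) :
    ContDiff ℝ ∞ (fun z => (u z : ℂ)) ∧ ContDiff ℝ ∞ (fun z => (v z : ℂ)) := by
  have key : ∀ n : ℕ, ContDiff ℝ n (fun z => (u z : ℂ)) ∧ ContDiff ℝ n (fun z => (v z : ℂ)) := by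
    intro n
    induction n with
    | zero => exact ⟨hu.of_le (by simp), hv.of_le (by simp)⟩
    | succ n ih =>
      have h1 := contDiff_succ_of_laplacian (contDiff_comb 2 1 hu hv) hLu (contDiff_exp ih.1)
      have h2 := contDiff_succ_of_laplacian (contDiff_comb 3 2 hu hv) hLv (contDiff_exp ih.2)
      refine ⟨?_, ?_⟩
      · convert contDiff_comb 2 (-1) h1 h2 using 3
        ring
      · convert contDiff_comb (-3) 2 h1 h2 using 3
        ring
  exact ⟨contDiff_infty.mpr fun n => (key n).1, contDiff_infty.mpr fun n => (key n).2⟩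

lemma dz_exp (hu : ContDiff ℝ ∞ (fun z => (u z : ℂ))) (z : ℂ) :
    dz (fun z => (exp (u z) : ℂ) / 4) z = (exp (u z) : ℂ) / 4 * dz (fun z => (u z : ℂ)) z := by
  have h := ((hu.hasW (by simp) z).cexp).const_mul (1 / 4 : ℂ)
  have e : (fun z => (exp (u z) : ℂ) / 4) = fun z => 1 / 4 * Complex.exp (u z : ℂ) := by
    funext z
    push_cast
    ring
  rw [e, h.dz_eq]
  push_cast
  ring

/-- The energies of a finite-energy solution of the `G₂` Toda system on the complex plane. -/
theorem integral_exp_of_toda (hu : ContDiff ℝ 2 (fun z => (u z : ℂ)))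
    (hv : ContDiff ℝ 2 (fun z => (v z : ℂ)))
    (hLu : ∀ z, 4 * dz (db (fun w => (u w : ℂ))) z = ((exp (v z) - 2 * exp (u z) : ℝ) : ℂ))
    (hLv : ∀ z, 4 * dz (db (fun w => (v w : ℂ))) z = ((3 * exp (u z) - 2 * exp (v z) : ℝ) : ℂ))
    (hiu : Integrable (fun z => exp (u z))) (hiv : Integrable (fun z => exp (v z))) :
    ∫ z, exp (u z) = 24 * π ∧ ∫ z, exp (v z) = 40 * π := by
  have hP : ∀ z, 4 * dz (db (fun w => ((2 * u w + 1 * v w : ℝ) : ℂ))) z = -(exp (u z) : ℂ) := by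
    intro z
    rw [dz_db_comb 2 1 hu hv]
    have h1 := hLu z
    have h2 := hLv z
    push_cast at h1 h2 ⊢
    linear_combination 2 * h1 + h2
  have hQ : ∀ z, 4 * dz (db (fun w => ((3 * u w + 2 * v w : ℝ) : ℂ))) z = -(exp (v z) : ℂ) := by
    intro z
    rw [dz_db_comb 3 2 hu hv]
    have h1 := hLu z
    have h2 := hLv z
    push_cast at h1 h2 ⊢
    linear_combination 3 * h1 + 2 * h2
  have hdu := tendsto_sq_mul_exp hu (fun z => by
    rw [hLu, Complex.ofReal_re]; linarith [exp_pos (v z)]) hiu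
  have hdv := tendsto_sq_mul_exp hv (fun z => by
    rw [hLv, Complex.ofReal_re]; linarith [exp_pos (u z)]) hiv
  have hcu : Continuous fun z => exp (u z) :=
    continuous_exp.comp (Complex.continuous_re.comp hu.continuous)
  have hcv : Continuous fun z => exp (v z) :=
    continuous_exp.comp (Complex.continuous_re.comp hv.continuous)
  obtain ⟨M, hM⟩ := exists_le_of_decay hcu hdu
  obtain ⟨N, hN⟩ := exists_le_of_decay hcv hdv
  have hMu : ∀ z, u z ≤ |M| := fun z => by
    linarith [add_one_le_exp (u z), hM z, le_abs_self M]
  have hNv : ∀ z, v z ≤ |N| := fun z => by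
    linarith [add_one_le_exp (v z), hN z, le_abs_self N]
  have hs := tendsto_mul_dz_of_laplacian (contDiff_comb 2 1 hu hv) hP hcu hiu (fun z => (exp_pos _).le) hdu
    (B := 2 * |M| + |N|) (by positivity) (fun z => by linarith [hMu z, hNv z]) hM
  have ht := tendsto_mul_dz_of_laplacian (contDiff_comb 3 2 hu hv) hQ hcv hiv (fun z => (exp_pos _).le) hdv
    (B := 3 * |M| + 2 * |N|) (by positivity) (fun z => by linarith [hMu z, hNv z]) hN
  set s := (∫ z, exp (u z)) / (4 * π) with hs_def
  set t := (∫ z, exp (v z)) / (4 * π) with ht_def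
  obtain ⟨su, sv⟩ := contDiff_infty_of_toda hu hv hP hQ
  have hp := dz_comb 2 1 hu hv
  have hq := dz_comb 3 2 hu hv
  have T : IsToda (fun z => -dz (fun w => ((2 * u w + 1 * v w : ℝ) : ℂ)) z)
      (fun z => -dz (fun w => ((3 * u w + 2 * v w : ℝ) : ℂ)) z)
      (fun z => (exp (u z) : ℂ) / 4) (fun z => (exp (v z) : ℂ) / 4) :=
    { contDiff_p := ((contDiff_comb 2 1 su sv).dz (by simp)).neg
      contDiff_q := ((contDiff_comb 3 2 su sv).dz (by simp)).neg
      contDiff_a := (contDiff_exp su).div_const 4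
      contDiff_b := (contDiff_exp sv).div_const 4
      db_p := by
        funext z
        have h := (((contDiff_comb 2 1 hu hv).dz (m := 1) (by norm_num)).hasW one_ne_zero z).neg
        rw [h.db_eq, ← dz_db_comm (contDiff_comb 2 1 hu hv)]
        linear_combination -hP z / 4
      db_q := by
        funext z
        have h := (((contDiff_comb 3 2 hu hv).dz (m := 1) (by norm_num)).hasW one_ne_zero z).neg
        rw [h.db_eq, ← dz_db_comm (contDiff_comb 3 2 hu hv)]
        linear_combination -hQ z / 4
      dz_a := by
        funext z
        rw [dz_exp su, hp, hq]
        push_cast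
        ring
      dz_b := by
        funext z
        rw [dz_exp sv, hp, hq]
        push_cast
        ring }
  have ha := tendsto_sq_mul_ofReal (fun z => (exp_pos (u z)).le) hdu
  have hb := tendsto_sq_mul_ofReal (fun z => (exp_pos (v z)).le) hdv
  have h1 : 1 ≤ 2 * s - t := by
    refine one_le_of_tendsto (hu.of_le (by norm_num)) ?_ hdu
    convert (ht.sub (hs.const_mul 2)) using 2 with z
    · rw [hp, hq]
      push_cast
      ring
    · push_cast
      ring
  have h2 : 1 ≤ 2 * t - 3 * s := by
    refine one_le_of_tendsto (hv.of_le (by norm_num)) ?_ hdv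
    convert ((hs.const_mul 3).sub (ht.const_mul 2)) using 2 with z
    · rw [hp, hq]
      push_cast
      ring
    · push_cast
      ring
  obtain ⟨es, et⟩ := eq_of_relations h1 h2 (by exact_mod_cast T.quadratic_relation ha hb hs ht)
    (by exact_mod_cast T.sextic_relation ha hb hs ht)
  rw [hs_def, div_eq_iff (by positivity)] at es
  rw [ht_def, div_eq_iff (by positivity)] at et
  exact ⟨by linarith, by linarith⟩

end System

/-- The isometry between the complex plane and `ℝ²`. -/
def planeEquiv : ℂ ≃ₗᵢ[ℝ] E2 := Complex.orthonormalBasisOneI.repr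

lemma planeEquiv_one : planeEquiv 1 = EuclideanSpace.single 0 1 := by
  simpa [planeEquiv] using Complex.orthonormalBasisOneI.repr_self 0

lemma planeEquiv_I : planeEquiv Complex.I = EuclideanSpace.single 1 1 := by
  simpa [planeEquiv] using Complex.orthonormalBasisOneI.repr_self 1

lemma fderiv_ofReal_comp_planeEquiv {u : E2 → ℝ} {z : ℂ}
    (hu : DifferentiableAt ℝ u (planeEquiv z)) (v : ℂ) :
    fderiv ℝ (fun z => (u (planeEquiv z) : ℂ)) z v = (fderiv ℝ u (planeEquiv z) (planeEquiv v) : ℝ) := by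
  have h := Complex.ofRealCLM.hasFDerivAt.comp z
    (hu.hasFDerivAt.comp z planeEquiv.toContinuousLinearEquiv.hasFDerivAt)
  exact congrArg (· v) h.fderiv

lemma contDiff_ofReal_comp_planeEquiv {u : E2 → ℝ} {n : WithTop ℕ∞} (hu : ContDiff ℝ n u) :
    ContDiff ℝ n (fun z => (u (planeEquiv z) : ℂ)) :=
  Complex.ofRealCLM.contDiff.comp (hu.comp planeEquiv.contDiff)

lemma fderiv_apply_one (f : ℂ → ℂ) (z : ℂ) : fderiv ℝ f z 1 = dz f z + db f z := by
  simp only [dz, db]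
  ring

lemma fderiv_apply_I (f : ℂ → ℂ) (z : ℂ) :
    fderiv ℝ f z Complex.I = Complex.I * (dz f z - db f z) := by
  simp only [dz, db]
  linear_combination fderiv ℝ f z Complex.I * Complex.I_sq

lemma four_mul_dz_db {u : E2 → ℝ} (hu : ContDiff ℝ 2 u) (z : ℂ) :
    4 * dz (db (fun w => (u (planeEquiv w) : ℂ))) z = (lap u (planeEquiv z) : ℂ) := by
  set U : ℂ → ℂ := fun w => (u (planeEquiv w) : ℂ) with hU_def
  have hU : ContDiff ℝ 2 U := contDiff_ofReal_comp_planeEquiv hu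
  have hd (v : E2) : Differentiable ℝ fun y => fderiv ℝ u y v :=
    ((hu.fderiv_right (m := 1) (by norm_num)).clm_apply contDiff_const).differentiable one_ne_zero
  have key (v : ℂ) : fderiv ℝ (fun w => fderiv ℝ U w v) z v =
      (fderiv ℝ (fun y => fderiv ℝ u y (planeEquiv v)) (planeEquiv z) (planeEquiv v) : ℝ) := by
    rw [← fderiv_ofReal_comp_planeEquiv (hd _ _)]
    congr 2
    funext w
    exact fderiv_ofReal_comp_planeEquiv (hu.differentiable two_ne_zero _) v
  have W1 := (hU.dz (m := 1) (by norm_num)).hasW one_ne_zero z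
  have W2 := (hU.db (m := 1) (by norm_num)).hasW one_ne_zero z
  have k1 := key 1
  have k2 := key Complex.I
  simp only [fderiv_apply_one, fderiv_apply_I] at k1 k2
  rw [(W1.add W2).dz_eq, (W1.add W2).db_eq, planeEquiv_one] at k1
  rw [((W1.sub W2).const_mul _).dz_eq, ((W1.sub W2).const_mul _).db_eq, planeEquiv_I] at k2
  simp only [lap, Fin.sum_univ_two]
  push_cast
  rw [← k1, ← k2, ← dz_db_comm hU z]
  linear_combination (2 * dz (db U) z - dz (dz U) z - db (db U) z) * Complex.I_sq

/-- Any finite-energy global solution of the `G₂` Toda system has energies `(12, 20)`. -/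
theorem g2_global_energy
    (u1 u2 : E2 → ℝ)
    (hu1 : ContDiff ℝ 2 u1) (hu2 : ContDiff ℝ 2 u2)
    (hpde1 : ∀ x : E2, lap u1 x + 2 * exp (u1 x) - exp (u2 x) = 0)
    (hpde2 : ∀ x : E2, lap u2 x - 3 * exp (u1 x) + 2 * exp (u2 x) = 0)
    (hint1 : Integrable (fun x : E2 => exp (u1 x)))
    (hint2 : Integrable (fun x : E2 => exp (u2 x))) :
    (1 / (2 * π)) * (∫ x : E2, exp (u1 x)) = 12 ∧
    (1 / (2 * π)) * (∫ x : E2, exp (u2 x)) = 20 := by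
  have hm : MeasurePreserving planeEquiv := planeEquiv.measurePreserving
  have he : MeasurableEmbedding planeEquiv := planeEquiv.toHomeomorph.measurableEmbedding
  obtain ⟨h1, h2⟩ := integral_exp_of_toda (contDiff_ofReal_comp_planeEquiv hu1)
    (contDiff_ofReal_comp_planeEquiv hu2)
    (fun z => by rw [four_mul_dz_db hu1]; congr 1; linarith [hpde1 (planeEquiv z)])
    (fun z => by rw [four_mul_dz_db hu2]; congr 1; linarith [hpde2 (planeEquiv z)])
    ((hm.integrable_comp_emb he).mpr hint1) ((hm.integrable_comp_emb he).mpr hint2)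
  rw [hm.integral_comp he (fun x => exp (u1 x))] at h1
  rw [hm.integral_comp he (fun x => exp (u2 x))] at h2
  rw [h1, h2]
  constructor <;>
  · field_simp
    norm_num
end
end

section
/- Let σ₁, σ₂ be nonnegative even integers, not both zero. Then 2σ₁² − 2σ₁σ₂ + σ₂² = 4σ₁ + 2σ₂ holds if and only if (σ₁, σ₂) is one of the seven pairs (2,0), (0,2), (4,2), (2,6), (4,8), (6,6), (6,8). -/
/-- The nonnegative even integer pairs `(σ₁, σ₂)`, not both zero, satisfying the `B₂`
Pohozaev identity `2σ₁² − 2σ₁σ₂ + σ₂² = 4σ₁ + 2σ₂` are exactly the seven listed pairs. -/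
theorem b2_pohozaev_even_solutions (σ₁ σ₂ : ℤ)
    (h₁ : 0 ≤ σ₁) (h₂ : 0 ≤ σ₂) (he₁ : Even σ₁) (he₂ : Even σ₂)
    (hnz : ¬(σ₁ = 0 ∧ σ₂ = 0)) :
    2 * σ₁ ^ 2 - 2 * σ₁ * σ₂ + σ₂ ^ 2 = 4 * σ₁ + 2 * σ₂ ↔
      (σ₁, σ₂) ∈ ({(2,0),(0,2),(4,2),(2,6),(4,8),(6,6),(6,8)} : Set (ℤ × ℤ)) := by
  simp only [Set.mem_insert_iff, Set.mem_singleton_iff, Prod.mk.injEq]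
  constructor
  · intro h
    have circle : (σ₁ - 3) ^ 2 + (σ₂ - σ₁ - 1) ^ 2 = 10 := by linarith
    have hx : σ₁ ≤ 6 := by nlinarith [sq_nonneg (σ₂ - σ₁ - 1)]
    have hy : σ₂ ≤ σ₁ + 4 := by nlinarith [sq_nonneg (σ₁ - 3)]
    obtain ⟨a, rfl⟩ := he₁
    obtain ⟨b, rfl⟩ := he₂
    have ha₀ : 0 ≤ a := by omega
    have ha : a ≤ 3 := by omega
    have hb₀ : 0 ≤ b := by omega
    have hb : b ≤ 5 := by omega
    interval_cases a <;> interval_cases b <;> simp_all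
  · rintro (⟨rfl, rfl⟩ | ⟨rfl, rfl⟩ | ⟨rfl, rfl⟩ | ⟨rfl, rfl⟩ | ⟨rfl, rfl⟩ |
      ⟨rfl, rfl⟩ | ⟨rfl, rfl⟩) <;> norm_num
end

section
/- Let σ₁, σ₂ be nonnegative even integers, not both zero, with σ₁ < 4 + 2√2 and σ₂ < 10 + 2√7. Then 3σ₁² + σ₂² − 3σ₁σ₂ = 6σ₁ + 2σ₂ holds if and only if (σ₁, σ₂) is one of the five pairs (2,0), (0,2), (4,2), (2,8), (4,12). -/
/-- The nonnegative even integer pairs `(σ₁, σ₂)`, not both zero, with `σ₁ < 4 + 2√2` and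
`σ₂ < 10 + 2√7`, satisfying the `G₂` Pohozaev identity `3σ₁² + σ₂² − 3σ₁σ₂ = 6σ₁ + 2σ₂`
are exactly the five listed pairs. -/
theorem g2_pohozaev_even_solutions (σ₁ σ₂ : ℤ)
    (h₁ : 0 ≤ σ₁) (h₂ : 0 ≤ σ₂) (he₁ : Even σ₁) (he₂ : Even σ₂)
    (hnz : ¬(σ₁ = 0 ∧ σ₂ = 0))
    (hb₁ : (σ₁ : ℝ) < 4 + 2 * Real.sqrt 2) (hb₂ : (σ₂ : ℝ) < 10 + 2 * Real.sqrt 7) :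
    3 * σ₁ ^ 2 + σ₂ ^ 2 - 3 * σ₁ * σ₂ = 6 * σ₁ + 2 * σ₂ ↔
      (σ₁, σ₂) ∈ ({(2,0),(0,2),(4,2),(2,8),(4,12)} : Set (ℤ × ℤ)) := by
  have hσ₁ : σ₁ < 7 := by
    have : Real.sqrt 2 < 3 / 2 := by
      rw [Real.sqrt_lt' (by norm_num)]
      norm_num
    exact_mod_cast (by linarith : (σ₁ : ℝ) < 7)
  have hσ₂ : σ₂ < 16 := by
    have : Real.sqrt 7 < 3 := by
      rw [Real.sqrt_lt' (by norm_num)]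
      norm_num
    exact_mod_cast (by linarith : (σ₂ : ℝ) < 16)
  clear hb₁ hb₂
  obtain ⟨a, rfl⟩ := he₁
  obtain ⟨b, rfl⟩ := he₂
  have ha₀ : 0 ≤ a := by lia
  have ha : a ≤ 3 := by lia
  have hb₀ : 0 ≤ b := by lia
  have hb : b ≤ 7 := by lia
  interval_cases a <;> interval_cases b <;> simp_all
end

section
/- Let p₁,…,p_m be distinct points in ℝ² and γ₁,…,γ_m positive real numbers. Let u solve the singular Liouville equation Δu + 2e^u = 4π Σⱼ γⱼ δ_{pⱼ} in the classical sense (u is C² on ℝ² ∖ {p₁,…,p_m}, Δu + 2e^u = 0 there, and for each j the function x ↦ u(x) − 2γⱼ log|x−pⱼ| is bounded near pⱼ), with ∫_{ℝ²} e^u < ∞. Then (1/(2π)) ∫_{ℝ²} e^u > (Σⱼ γⱼ) + 1. In particular, if Σⱼ γⱼ = 8 then (1/(2π)) ∫_{ℝ²} e^u > 9. -/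
noncomputable section
open Real MeasureTheory Metric Filter Topology

/-- A convex primitive of `Real.smoothTransition`: zero for `t ≤ 0` and affine of slope one for
`1 ≤ t`. -/
def convexRamp (t : ℝ) : ℝ := ∫ x in (0 : ℝ)..t, smoothTransition x

theorem hasDerivAt_convexRamp (t : ℝ) : HasDerivAt convexRamp (smoothTransition t) t :=
  intervalIntegral.integral_hasDerivAt_right
    (smoothTransition.continuous.intervalIntegrable _ _)
    (smoothTransition.continuous.stronglyMeasurableAtFilter _ _)
    smoothTransition.continuous.continuousAt

theorem deriv_convexRamp : deriv convexRamp = smoothTransition :=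
  funext fun t => (hasDerivAt_convexRamp t).deriv

theorem contDiff_convexRamp : ContDiff ℝ 2 convexRamp := by
  have h : ContDiff ℝ (1 + 1) convexRamp := by
    rw [contDiff_succ_iff_deriv]
    refine ⟨fun t => (hasDerivAt_convexRamp t).differentiableAt, by simp, ?_⟩
    rw [deriv_convexRamp]
    exact smoothTransition.contDiff (n := 1)
  exact h

theorem convexRamp_of_nonpos {t : ℝ} (ht : t ≤ 0) : convexRamp t = 0 := by
  have h : ∫ x in (0 : ℝ)..t, smoothTransition x = ∫ _ in (0 : ℝ)..t, (0 : ℝ) := by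
    refine intervalIntegral.integral_congr fun x hx => ?_
    rw [Set.uIcc_of_ge ht] at hx
    exact smoothTransition.zero_of_nonpos hx.2
  simpa [convexRamp] using h

theorem convexRamp_add_sub (t a : ℝ) :
    convexRamp (t + a) - convexRamp t = ∫ x in t..(t + a), smoothTransition x :=
  intervalIntegral.integral_interval_sub_left
    (smoothTransition.continuous.intervalIntegrable _ _)
    (smoothTransition.continuous.intervalIntegrable _ _)

theorem convexRamp_add_of_one_le {t a : ℝ} (ht : 1 ≤ t) (ha : 0 ≤ a) :
    convexRamp (t + a) - convexRamp t = a := by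
  rw [convexRamp_add_sub]
  have h : ∫ x in t..(t + a), smoothTransition x = ∫ _ in t..(t + a), (1 : ℝ) := by
    refine intervalIntegral.integral_congr fun x hx => ?_
    rw [Set.uIcc_of_le (by linarith)] at hx
    exact smoothTransition.one_of_one_le (ht.trans hx.1)
  simp [h]

theorem convexRamp_add_sub_le (t : ℝ) {a : ℝ} (ha : 0 ≤ a) :
    convexRamp (t + a) - convexRamp t ≤ a := by
  rw [convexRamp_add_sub]
  have h := intervalIntegral.integral_mono_on (a := t) (b := t + a) (by linarith)
    (smoothTransition.continuous.intervalIntegrable _ _)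
    (continuous_const.intervalIntegrable (μ := volume) t (t + a))
    (fun x _ => smoothTransition.le_one x)
  simpa using h

theorem monotone_convexRamp : Monotone convexRamp :=
  monotone_of_deriv_nonneg (fun t => (hasDerivAt_convexRamp t).differentiableAt)
    fun t => by rw [deriv_convexRamp]; exact smoothTransition.nonneg t

theorem deriv_smoothTransition_nonneg (t : ℝ) : 0 ≤ deriv smoothTransition t :=
  smoothTransition.monotone.deriv_nonneg

theorem continuous_deriv_smoothTransition : Continuous (deriv smoothTransition) :=
  (smoothTransition.contDiff (n := 1)).continuous_deriv le_rfl

theorem hasDerivAt_smoothTransition (t : ℝ) :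
    HasDerivAt smoothTransition (deriv smoothTransition t) t :=
  ((smoothTransition.contDiff (n := 1)).differentiable (by simp) t).hasDerivAt

theorem deriv_smoothTransition_of_nonpos {t : ℝ} (ht : t ≤ 0) : deriv smoothTransition t = 0 :=
  IsLocalMin.deriv_eq_zero <| Eventually.of_forall fun x => by
    rw [smoothTransition.zero_of_nonpos ht]; exact smoothTransition.nonneg x

theorem deriv_smoothTransition_of_one_le {t : ℝ} (ht : 1 ≤ t) : deriv smoothTransition t = 0 :=
  IsLocalMax.deriv_eq_zero <| Eventually.of_forall fun x => by
    rw [smoothTransition.one_of_one_le ht]; exact smoothTransition.le_one x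

theorem exists_deriv_smoothTransition_le : ∃ M > 0, ∀ t, deriv smoothTransition t ≤ M := by
  obtain ⟨t₀, -, h⟩ := isCompact_Icc.exists_isMaxOn (Set.nonempty_Icc.2 zero_le_one)
    (continuous_deriv_smoothTransition.continuousOn (s := Set.Icc 0 1))
  refine ⟨deriv smoothTransition t₀ + 1, by linarith [deriv_smoothTransition_nonneg t₀],
    fun t => ?_⟩
  rcases le_total t 0 with h0 | h0
  · linarith [deriv_smoothTransition_of_nonpos h0, deriv_smoothTransition_nonneg t₀]
  rcases le_total t 1 with h1 | h1
  · linarith [show deriv smoothTransition t ≤ deriv smoothTransition t₀ from h ⟨h0, h1⟩]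
  · linarith [deriv_smoothTransition_of_one_le h1, deriv_smoothTransition_nonneg t₀]

/-- A smoothing of `x ↦ max 0 (log ‖x - p‖ - τ)`. -/
def logRamp (p : E2) (τ : ℝ) (x : E2) : ℝ := convexRamp (Real.log (‖x - p‖ / exp τ))

/-- The Laplacian of `logRamp p τ`: a nonnegative radial density of mass `2π` on the annulus
`exp τ ≤ ‖x - p‖ ≤ exp (τ + 1)`. -/
def annulusDensity (p : E2) (τ : ℝ) (x : E2) : ℝ :=
  deriv smoothTransition (Real.log (‖x - p‖ / exp τ)) / ‖x - p‖ ^ 2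

theorem logRamp_of_ne {p x : E2} (τ : ℝ) (hx : x ≠ p) :
    logRamp p τ x = convexRamp (Real.log ‖x - p‖ - τ) := by
  rw [logRamp, Real.log_div (norm_ne_zero_iff.2 (sub_ne_zero.2 hx)) (exp_pos τ).ne', Real.log_exp]

theorem annulusDensity_of_ne {p x : E2} (τ : ℝ) (hx : x ≠ p) :
    annulusDensity p τ x = deriv smoothTransition (Real.log ‖x - p‖ - τ) / ‖x - p‖ ^ 2 := by
  rw [annulusDensity, Real.log_div (norm_ne_zero_iff.2 (sub_ne_zero.2 hx)) (exp_pos τ).ne',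
    Real.log_exp]

theorem logRamp_of_le {p x : E2} {τ : ℝ} (hx : ‖x - p‖ ≤ exp τ) : logRamp p τ x = 0 :=
  convexRamp_of_nonpos <| Real.log_nonpos (by positivity) ((div_le_one (exp_pos τ)).2 hx)

theorem annulusDensity_of_le {p x : E2} {τ : ℝ} (hx : ‖x - p‖ ≤ exp τ) :
    annulusDensity p τ x = 0 := by
  rw [annulusDensity, deriv_smoothTransition_of_nonpos, zero_div]
  exact Real.log_nonpos (by positivity) ((div_le_one (exp_pos τ)).2 hx)

theorem ne_of_exp_le_norm_sub {p x : E2} {τ : ℝ} (hx : exp τ ≤ ‖x - p‖) : x ≠ p := by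
  rintro rfl
  simp only [sub_self, norm_zero] at hx
  linarith [exp_pos τ]

theorem le_log_norm_sub {p x : E2} {τ : ℝ} (hx : exp τ ≤ ‖x - p‖) : τ ≤ Real.log ‖x - p‖ :=
  (Real.le_log_iff_exp_le ((exp_pos τ).trans_le hx)).2 hx

theorem annulusDensity_of_ge {p x : E2} {τ : ℝ} (hx : exp (τ + 1) ≤ ‖x - p‖) :
    annulusDensity p τ x = 0 := by
  rw [annulusDensity_of_ne τ (ne_of_exp_le_norm_sub hx), deriv_smoothTransition_of_one_le,
    zero_div]
  linarith [le_log_norm_sub hx]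

theorem annulusDensity_nonneg (p : E2) (τ : ℝ) (x : E2) : 0 ≤ annulusDensity p τ x :=
  div_nonneg (deriv_smoothTransition_nonneg _) (by positivity)

theorem eventually_norm_sub_le (p : E2) (τ : ℝ) : ∀ᶠ x in 𝓝 p, ‖x - p‖ ≤ exp τ := by
  filter_upwards [Metric.closedBall_mem_nhds p (exp_pos τ)] with x hx
  simpa [dist_eq_norm] using hx

theorem hasFDerivAt_norm_sub {p x : E2} (hx : x ≠ p) :
    HasFDerivAt (fun y : E2 => ‖y - p‖) (‖x - p‖⁻¹ • innerSL ℝ (x - p)) x := by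
  have h := ((hasStrictFDerivAt_norm_sq (x - p)).hasFDerivAt.comp x
    ((hasFDerivAt_id x).sub_const p)).sqrt (by
      simpa [sub_eq_zero] using hx)
  have hpos : 0 < ‖x - p‖ := norm_pos_iff.2 (sub_ne_zero.2 hx)
  simp only [Function.comp_def, Real.sqrt_sq (norm_nonneg _), id] at h
  refine h.congr_fderiv ?_
  ext v
  simp
  field_simp

theorem hasFDerivAt_log_norm_sub {p x : E2} (hx : x ≠ p) :
    HasFDerivAt (fun y : E2 => Real.log ‖y - p‖) ((‖x - p‖ ^ 2)⁻¹ • innerSL ℝ (x - p)) x := by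
  have hpos : 0 < ‖x - p‖ := norm_pos_iff.2 (sub_ne_zero.2 hx)
  refine ((hasFDerivAt_norm_sub hx).log hpos.ne').congr_fderiv ?_
  rw [smul_smul]
  congr 1
  field_simp

theorem contDiff_logRamp (p : E2) (τ : ℝ) : ContDiff ℝ 2 (logRamp p τ) := by
  refine contDiff_iff_contDiffAt.2 fun x => ?_
  by_cases hx : x = p
  · subst hx
    refine (contDiffAt_const (c := (0 : ℝ))).congr_of_eventuallyEq ?_
    filter_upwards [eventually_norm_sub_le x τ] with y hy using logRamp_of_le hy
  · have hx' : x - p ≠ 0 := sub_ne_zero.2 hx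
    refine contDiff_convexRamp.contDiffAt.comp x ?_
    have hsub : ContDiffAt ℝ 2 (fun y : E2 => y - p) x := by fun_prop
    refine ContDiffAt.log ((hsub.norm ℝ hx').div_const _) ?_
    have := exp_pos τ
    have := norm_pos_iff.2 hx'
    positivity

theorem fderiv_logRamp (p : E2) (τ : ℝ) (x : E2) (i : Fin 2) :
    fderiv ℝ (logRamp p τ) x (EuclideanSpace.single i 1) =
      smoothTransition (Real.log (‖x - p‖ / exp τ)) * ((x - p) i / ‖x - p‖ ^ 2) := by
  by_cases hx : x = p
  · subst hx
    have h : logRamp x τ =ᶠ[𝓝 x] fun _ => 0 := by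
      filter_upwards [eventually_norm_sub_le x τ] with y hy using logRamp_of_le hy
    simp [h.fderiv_eq]
  · have h : logRamp p τ =ᶠ[𝓝 x] fun y => convexRamp (Real.log ‖y - p‖ - τ) := by
      filter_upwards [isOpen_ne.mem_nhds hx] with y hy using logRamp_of_ne τ hy
    have h1 := (hasDerivAt_convexRamp _).comp_hasFDerivAt x
      ((hasFDerivAt_log_norm_sub hx).sub_const τ)
    rw [h.fderiv_eq,
      show fderiv ℝ (fun y => convexRamp (Real.log ‖y - p‖ - τ)) x = _ from h1.fderiv,
      Real.log_div (norm_ne_zero_iff.2 (sub_ne_zero.2 hx)) (exp_pos τ).ne', Real.log_exp]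
    simp [EuclideanSpace.inner_single_right, div_eq_inv_mul]

theorem lap_logRamp (p : E2) (τ : ℝ) (x : E2) : lap (logRamp p τ) x = annulusDensity p τ x := by
  simp only [lap, fderiv_logRamp]
  by_cases hx : x = p
  · subst hx
    have h (i : Fin 2) : (fun y : E2 => smoothTransition (Real.log (‖y - x‖ / exp τ)) *
        ((y - x) i / ‖y - x‖ ^ 2)) =ᶠ[𝓝 x] fun _ => 0 := by
      filter_upwards [eventually_norm_sub_le x τ] with y hy
      rw [smoothTransition.zero_of_nonpos, zero_mul]
      exact Real.log_nonpos (by positivity) ((div_le_one (exp_pos τ)).2 hy)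
    rw [Fin.sum_univ_two, (h 0).fderiv_eq, (h 1).fderiv_eq]
    simp [annulusDensity]
  · have hpos : 0 < ‖x - p‖ := norm_pos_iff.2 (sub_ne_zero.2 hx)
    have hd (i : Fin 2) : fderiv ℝ (fun y : E2 => smoothTransition (Real.log (‖y - p‖ / exp τ)) *
        ((y - p) i / ‖y - p‖ ^ 2)) x (EuclideanSpace.single i 1) =
        deriv smoothTransition (Real.log ‖x - p‖ - τ) * ((x - p) i) ^ 2 / ‖x - p‖ ^ 4 +
        smoothTransition (Real.log ‖x - p‖ - τ) *
          (1 / ‖x - p‖ ^ 2 - 2 * ((x - p) i) ^ 2 / ‖x - p‖ ^ 4) := by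
      have h : (fun y : E2 => smoothTransition (Real.log (‖y - p‖ / exp τ)) *
          ((y - p) i / ‖y - p‖ ^ 2)) =ᶠ[𝓝 x]
          fun y => smoothTransition (Real.log ‖y - p‖ - τ) * ((y - p) i * (‖y - p‖ ^ 2)⁻¹) := by
        filter_upwards [isOpen_ne.mem_nhds hx] with y hy
        rw [Real.log_div (norm_ne_zero_iff.2 (sub_ne_zero.2 hy)) (exp_pos τ).ne', Real.log_exp,
          div_eq_mul_inv]
      have h1 := (hasDerivAt_smoothTransition _).comp_hasFDerivAt x
        ((hasFDerivAt_log_norm_sub hx).sub_const τ)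
      have h2 : HasFDerivAt (fun y : E2 => (y - p) i) (EuclideanSpace.proj i : E2 →L[ℝ] ℝ) x := by
        simpa using (EuclideanSpace.proj i : E2 →L[ℝ] ℝ).hasFDerivAt.sub_const (p i)
      have h3 := (hasDerivAt_inv (pow_ne_zero 2 hpos.ne')).comp_hasFDerivAt x
        ((hasFDerivAt_norm_sub hx).pow 2)
      have h4 := h1.mul (h2.mul h3)
      rw [h.fderiv_eq]
      refine (congrArg (fun L : E2 →L[ℝ] ℝ => L (EuclideanSpace.single i 1)) h4.fderiv).trans ?_
      simp [EuclideanSpace.inner_single_right]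
      field_simp
      ring
    rw [Fin.sum_univ_two, hd, hd, annulusDensity_of_ne τ hx]
    have hn : ‖x - p‖ ^ 2 = (x - p) 0 ^ 2 + (x - p) 1 ^ 2 := by
      simp [EuclideanSpace.norm_sq_eq, Fin.sum_univ_two]
    have hn4 : ‖x - p‖ ^ 4 = ((x - p) 0 ^ 2 + (x - p) 1 ^ 2) ^ 2 := by rw [← hn]; ring
    have hs : (x - p) 0 ^ 2 + (x - p) 1 ^ 2 ≠ 0 := by rw [← hn]; positivity
    rw [hn, hn4]
    field_simp
    ring

theorem contDiffOn_fderiv_apply {u : E2 → ℝ} {U : Set E2} (hU : IsOpen U) {k n : ℕ}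
    (hkn : k + 1 ≤ n) (hu : ContDiffOn ℝ n u U) (v : E2) :
    ContDiffOn ℝ k (fun x => fderiv ℝ u x v) U :=
  (hu.fderiv_of_isOpen hU (by exact_mod_cast hkn)).clm_apply contDiffOn_const

theorem continuousOn_lap {u : E2 → ℝ} {U : Set E2} (hU : IsOpen U) (hu : ContDiffOn ℝ 2 u U) :
    ContinuousOn (lap u) U :=
  continuousOn_finsetSum _ fun _ _ => ContDiffOn.continuousOn (n := (0 : ℕ)) <|
    contDiffOn_fderiv_apply hU (n := 1) le_rfl
      (contDiffOn_fderiv_apply hU (k := 1) (n := 2) le_rfl hu _) _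

theorem integrable_mul_of_tsupport_subset {f g : E2 → ℝ} {U : Set E2} (hU : IsOpen U)
    (hf : ContinuousOn f U) (hg : Continuous g) (hc : HasCompactSupport g)
    (hs : tsupport g ⊆ U) : Integrable fun x => f x * g x := by
  refine Continuous.integrable_of_hasCompactSupport ?_ hc.mul_left
  refine continuous_of_tsupport fun x hx => ?_
  exact (hf.continuousAt (hU.mem_nhds (hs (tsupport_mul_subset_right hx)))).mul hg.continuousAt

/-- Green's identity on the plane against a compactly supported test function. -/
theorem integral_mul_lap {u φ : E2 → ℝ} {U : Set E2} (hU : IsOpen U) (hu : ContDiffOn ℝ 2 u U)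
    (hφ : ContDiff ℝ 2 φ) (hc : HasCompactSupport φ) (hs : tsupport φ ⊆ U) :
    ∫ x, u x * lap φ x = ∫ x, lap u x * φ x := by
  have hu1 (i : Fin 2) := contDiffOn_fderiv_apply hU (k := 1) (n := 2) le_rfl hu
    (EuclideanSpace.single i 1)
  have hu2 (i : Fin 2) := contDiffOn_fderiv_apply hU (k := 0) (n := 1) le_rfl (hu1 i)
    (EuclideanSpace.single i 1)
  have hφ1 (i : Fin 2) := contDiffOn_fderiv_apply isOpen_univ (k := 1) (n := 2) le_rfl
    hφ.contDiffOn (EuclideanSpace.single i 1)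
  have hφ2 (i : Fin 2) := contDiffOn_fderiv_apply isOpen_univ (k := 0) (n := 1) le_rfl
    (hφ1 i) (EuclideanSpace.single i 1)
  have hc1 (i : Fin 2) := hc.fderiv_apply (𝕜 := ℝ) (EuclideanSpace.single i 1)
  have hc2 (i : Fin 2) := (hc1 i).fderiv_apply (𝕜 := ℝ) (EuclideanSpace.single i 1)
  have hs1 (i : Fin 2) := (tsupport_fderiv_apply_subset ℝ (f := φ)
    (EuclideanSpace.single i 1)).trans hs
  have hs2 (i : Fin 2) := (tsupport_fderiv_apply_subset ℝ
    (f := fun x => fderiv ℝ φ x (EuclideanSpace.single i 1)) (EuclideanSpace.single i 1)).trans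
    (hs1 i)
  have cont {f : E2 → ℝ} {n : ℕ} (h : ContDiffOn ℝ n f Set.univ) : Continuous f :=
    (contDiffOn_univ.1 h).continuous
  have diff {f : E2 → ℝ} {n : ℕ} (hn : n ≠ 0) (h : ContDiffOn ℝ n f U) {x : E2} (hx : x ∈ U) :
      DifferentiableAt ℝ f x :=
    (h.contDiffAt (hU.mem_nhds hx)).differentiableAt (by exact_mod_cast hn)
  have i1 (i : Fin 2) := integrable_mul_of_tsupport_subset hU hu.continuousOn (cont (hφ2 i))
    (hc2 i) (hs2 i)
  have i2 (i : Fin 2) := integrable_mul_of_tsupport_subset hU (hu1 i).continuousOn (cont (hφ1 i))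
    (hc1 i) (hs1 i)
  have i3 (i : Fin 2) := integrable_mul_of_tsupport_subset hU (hu2 i).continuousOn hφ.continuous
    hc hs
  have key (i : Fin 2) := (integral_mul_fderiv_eq_neg_fderiv_mul_of_integrable (i2 i) (i1 i)
    (integrable_mul_of_tsupport_subset hU hu.continuousOn (cont (hφ1 i)) (hc1 i) (hs1 i))
    (fun x hx => diff two_ne_zero hu (hs1 i hx))
    (fun x _ => (contDiffOn_univ.1 (hφ1 i)).differentiable one_ne_zero x)).trans
    (congrArg Neg.neg (integral_mul_fderiv_eq_neg_fderiv_mul_of_integrable (i3 i) (i2 i)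
      (integrable_mul_of_tsupport_subset hU (hu1 i).continuousOn hφ.continuous hc hs)
      (fun x hx => diff one_ne_zero (hu1 i) (hs hx))
      (fun x _ => hφ.differentiable two_ne_zero x)))
  simp only [neg_neg] at key
  simp only [lap, Finset.mul_sum, Finset.sum_mul]
  rw [integral_finsetSum _ fun i _ => i1 i, integral_finsetSum _ fun i _ => i3 i]
  exact Finset.sum_congr rfl fun i _ => key i

theorem differentiable_fderiv_apply {f : E2 → ℝ} (hf : ContDiff ℝ 2 f) (v : E2) :
    Differentiable ℝ fun x => fderiv ℝ f x v :=
  (contDiffOn_univ.1 (contDiffOn_fderiv_apply isOpen_univ (k := 1) (n := 2) le_rfl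
    hf.contDiffOn v)).differentiable one_ne_zero

theorem lap_add {f g : E2 → ℝ} (hf : ContDiff ℝ 2 f) (hg : ContDiff ℝ 2 g) (x : E2) :
    lap (fun y => f y + g y) x = lap f x + lap g x := by
  simp only [lap, ← Finset.sum_add_distrib]
  refine Finset.sum_congr rfl fun i _ => ?_
  have h (y : E2) : fderiv ℝ (fun y => f y + g y) y = fderiv ℝ f y + fderiv ℝ g y :=
    fderiv_fun_add (hf.differentiable two_ne_zero y) (hg.differentiable two_ne_zero y)
  simp only [h, add_apply]
  rw [fderiv_fun_add (differentiable_fderiv_apply hf _ x) (differentiable_fderiv_apply hg _ x),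
    add_apply]

theorem lap_const_mul {f : E2 → ℝ} (hf : ContDiff ℝ 2 f) (c : ℝ) (x : E2) :
    lap (fun y => c * f y) x = c * lap f x := by
  simp only [lap, Finset.mul_sum]
  refine Finset.sum_congr rfl fun i _ => ?_
  have h (y : E2) : fderiv ℝ (fun y => c * f y) y = c • fderiv ℝ f y :=
    fderiv_const_mul (hf.differentiable two_ne_zero y) c
  simp only [h, smul_apply, smul_eq_mul]
  rw [fderiv_const_mul (differentiable_fderiv_apply hf _ x) c, smul_apply,
    smul_eq_mul]

theorem lap_const (c : ℝ) (x : E2) : lap (fun _ => c) x = 0 := by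
  simp [lap]

theorem lap_sum {ι : Type*} (s : Finset ι) {f : ι → E2 → ℝ} (hf : ∀ i, ContDiff ℝ 2 (f i))
    (x : E2) : lap (fun y => ∑ i ∈ s, f i y) x = ∑ i ∈ s, lap (f i) x := by
  classical
  induction s using Finset.induction_on with
  | empty => simp [lap_const]
  | insert a s ha ih =>
    simp only [Finset.sum_insert ha]
    rw [lap_add (hf a) (ContDiff.sum fun i _ => hf i), ih]

theorem continuous_annulusDensity (p : E2) (τ : ℝ) : Continuous (annulusDensity p τ) := by
  rw [← funext (lap_logRamp p τ)]
  exact continuousOn_univ.1 (continuousOn_lap isOpen_univ (contDiff_logRamp p τ).contDiffOn)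

theorem tsupport_annulusDensity_subset (p : E2) (τ : ℝ) :
    tsupport (annulusDensity p τ) ⊆ {x | exp τ ≤ ‖x - p‖ ∧ ‖x - p‖ ≤ exp (τ + 1)} := by
  refine closure_minimal (fun x hx => ?_) ?_
  · by_contra h
    rw [Set.mem_ofPred_eq, not_and_or, not_le, not_le] at h
    exact hx (h.elim (fun h => annulusDensity_of_le h.le) fun h => annulusDensity_of_ge h.le)
  · have hn : Continuous fun x : E2 => ‖x - p‖ := by fun_prop
    exact (isClosed_le continuous_const hn).inter (isClosed_le hn continuous_const)

theorem hasCompactSupport_annulusDensity (p : E2) (τ : ℝ) :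
    HasCompactSupport (annulusDensity p τ) :=
  (isCompact_closedBall p (exp (τ + 1))).of_isClosed_subset (isClosed_tsupport _) fun x hx => by
    simpa [dist_eq_norm] using (tsupport_annulusDensity_subset p τ hx).2

theorem integrable_annulusDensity (p : E2) (τ : ℝ) : Integrable (annulusDensity p τ) :=
  (continuous_annulusDensity p τ).integrable_of_hasCompactSupport
    (hasCompactSupport_annulusDensity p τ)

theorem integrable_mul_annulusDensity {f : E2 → ℝ} {U : Set E2} (hU : IsOpen U)
    (hf : ContinuousOn f U) {p : E2} {τ : ℝ}
    (h : ∀ x, exp τ ≤ ‖x - p‖ → ‖x - p‖ ≤ exp (τ + 1) → x ∈ U) :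
    Integrable fun x => f x * annulusDensity p τ x :=
  integrable_mul_of_tsupport_subset hU hf (continuous_annulusDensity p τ)
    (hasCompactSupport_annulusDensity p τ) fun x hx =>
      h x (tsupport_annulusDensity_subset p τ hx).1 (tsupport_annulusDensity_subset p τ hx).2

theorem integral_annulusDensity (p : E2) (τ : ℝ) : ∫ x, annulusDensity p τ x = 2 * π := by
  have hrad : ∫ x, annulusDensity p τ x =
      ∫ x : E2, deriv smoothTransition (Real.log (‖x‖ / exp τ)) / ‖x‖ ^ 2 :=
    integral_sub_right_eq_self
      (fun x : E2 => deriv smoothTransition (Real.log (‖x‖ / exp τ)) / ‖x‖ ^ 2) p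
  have hball : (volume : Measure E2).real (ball 0 1) = π := by
    simp [Measure.real, EuclideanSpace.volume_ball_fin_two, pi_pos.le]
  rw [hrad, integral_fun_norm_addHaar volume
    (fun y => deriv smoothTransition (Real.log (y / exp τ)) / y ^ 2), hball]
  have hmass : ∫ y in Set.Ioi (0 : ℝ),
      y⁻¹ * deriv smoothTransition (Real.log (y / exp τ)) = 1 := by
    have h0 : smoothTransition (Real.log (0 / exp τ)) = 0 := by simp
    refine (integral_Ioi_of_hasDerivAt_of_nonneg (l := 1)
      (g := fun y => smoothTransition (Real.log (y / exp τ)))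
      ?_ (fun y hy => ?_) (fun y hy => ?_) ?_).trans
        (by rw [h0, sub_zero])
    · have h : (fun y => smoothTransition (Real.log (y / exp τ))) =ᶠ[𝓝[Set.Ici 0] 0]
          fun _ => 0 := by
        filter_upwards [Icc_mem_nhdsGE (exp_pos τ)] with y hy
        exact smoothTransition.zero_of_nonpos
          (Real.log_nonpos (div_nonneg hy.1 (exp_pos τ).le) ((div_le_one (exp_pos τ)).2 hy.2))
      exact continuousWithinAt_const.congr_of_eventuallyEq h h0
    · have hy' : (0 : ℝ) < y := hy
      have := exp_pos τ
      refine ((hasDerivAt_smoothTransition _).comp y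
        (((hasDerivAt_id y).div_const (exp τ)).log (by simp [hy'.ne']))).congr_deriv ?_
      simp only [id]
      field_simp
    · exact mul_nonneg (inv_nonneg.2 (le_of_lt hy)) (deriv_smoothTransition_nonneg _)
    · refine tendsto_const_nhds.congr' ?_
      filter_upwards [eventually_ge_atTop (exp (τ + 1))] with y hy
      refine (smoothTransition.one_of_one_le ?_).symm
      rw [Real.le_log_iff_exp_le (div_pos ((exp_pos _).trans_le hy) (exp_pos τ)),
        le_div_iff₀ (exp_pos τ), ← exp_add, add_comm]
      exact hy
  have hcongr : ∫ y in Set.Ioi (0 : ℝ), y ^ (Module.finrank ℝ E2 - 1) •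
      (deriv smoothTransition (Real.log (y / exp τ)) / y ^ 2) = 1 := by
    rw [← hmass]
    refine setIntegral_congr_fun measurableSet_Ioi fun y hy => ?_
    have hy' : (0 : ℝ) < y := hy
    simp only [finrank_euclideanSpace, Fintype.card_fin, smul_eq_mul]
    field_simp
    simp
  rw [hcongr]
  simp

theorem annulusDensity_le {M : ℝ} (hM : ∀ t, deriv smoothTransition t ≤ M) (p : E2) (τ : ℝ)
    (x : E2) : annulusDensity p τ x ≤ M * exp (-2 * τ) := by
  have hM0 : 0 ≤ M := (deriv_smoothTransition_nonneg 0).trans (hM 0)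
  rcases le_total ‖x - p‖ (exp τ) with hx | hx
  · rw [annulusDensity_of_le hx]
    positivity
  · have hpos := (exp_pos τ).trans_le hx
    rw [annulusDensity, div_le_iff₀ (by positivity), mul_assoc]
    refine (hM _).trans (le_mul_of_one_le_right hM0 ?_)
    have h : exp (-2 * τ) * exp τ ^ 2 = 1 := by
      rw [← exp_nat_mul, ← exp_add]
      simp
    rw [← h]
    gcongr

/-- Near a point where `u - 2 γ log ‖x - p‖` is bounded, the annular means of `u` are logarithmic in
the radius up to a bounded error. -/
theorem abs_integral_mul_annulusDensity_le {u : E2 → ℝ} {p : E2} {γ ε M τ : ℝ} (hγ : 0 ≤ γ)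
    (hτ : exp (τ + 1) < ε)
    (hu : ∀ x : E2, x ≠ p → dist x p < ε → |u x - 2 * γ * Real.log ‖x - p‖| ≤ M)
    (hi : Integrable fun x => u x * annulusDensity p τ x) :
    |(∫ x, u x * annulusDensity p τ x) - 4 * π * γ * τ| ≤ 2 * π * (M + 2 * γ) := by
  have hρ := integrable_annulusDensity p τ
  have h1 : (∫ x, u x * annulusDensity p τ x) - 4 * π * γ * τ =
      ∫ x, (u x * annulusDensity p τ x - 2 * γ * τ * annulusDensity p τ x) := by
    rw [integral_sub hi (hρ.const_mul _), integral_const_mul, integral_annulusDensity]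
    ring
  have h2 : 2 * π * (M + 2 * γ) = ∫ x, (M + 2 * γ) * annulusDensity p τ x := by
    rw [integral_const_mul, integral_annulusDensity]
    ring
  rw [h1, h2, ← Real.norm_eq_abs]
  refine norm_integral_le_of_norm_le (hρ.const_mul _) (Eventually.of_forall fun x => ?_)
  rw [← sub_mul, norm_mul, Real.norm_eq_abs, Real.norm_of_nonneg (annulusDensity_nonneg p τ x)]
  by_cases hx : exp τ ≤ ‖x - p‖ ∧ ‖x - p‖ ≤ exp (τ + 1)
  · refine mul_le_mul_of_nonneg_right ?_ (annulusDensity_nonneg p τ x)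
    have hpos := (exp_pos τ).trans_le hx.1
    have hux := abs_le.1 (hu x (ne_of_exp_le_norm_sub hx.1)
      (by rw [dist_eq_norm]; exact hx.2.trans_lt hτ))
    have hlog1 := le_log_norm_sub hx.1
    have hlog2 := (Real.log_le_iff_le_exp hpos).2 hx.2
    rw [abs_le]
    constructor <;> nlinarith
  · rw [not_and_or, not_le, not_le] at hx
    rw [hx.elim (fun h => annulusDensity_of_le h.le) fun h => annulusDensity_of_ge h.le]
    simp

/-- A radial cutoff around `p`, equal to `0` on `‖x - p‖ ≤ exp τ` and to `T` on
`exp (τ + T + 1) ≤ ‖x - p‖`. -/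
def logCutoff (p : E2) (τ T : ℝ) (x : E2) : ℝ := logRamp p τ x - logRamp p (τ + T) x

theorem contDiff_logCutoff (p : E2) (τ T : ℝ) : ContDiff ℝ 2 (logCutoff p τ T) :=
  (contDiff_logRamp p τ).sub (contDiff_logRamp p (τ + T))

theorem lap_logCutoff (p : E2) (τ T : ℝ) (x : E2) :
    lap (logCutoff p τ T) x = annulusDensity p τ x - annulusDensity p (τ + T) x := by
  have h : logCutoff p τ T = fun y => logRamp p τ y + (-1) * logRamp p (τ + T) y := by
    funext y
    simp only [logCutoff]
    ring
  rw [h, lap_add (contDiff_logRamp p τ) (contDiff_const.mul (contDiff_logRamp p _)),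
    lap_const_mul (contDiff_logRamp p _), lap_logRamp, lap_logRamp]
  ring

theorem logCutoff_of_le {p x : E2} {τ T : ℝ} (hT : 0 ≤ T) (hx : ‖x - p‖ ≤ exp τ) :
    logCutoff p τ T x = 0 := by
  rw [logCutoff, logRamp_of_le hx,
    logRamp_of_le (hx.trans (exp_le_exp.2 (le_add_of_nonneg_right hT))), sub_zero]

theorem logCutoff_of_ge {p x : E2} {τ T : ℝ} (hT : 0 ≤ T) (hx : exp (τ + T + 1) ≤ ‖x - p‖) :
    logCutoff p τ T x = T := by
  have hne := ne_of_exp_le_norm_sub hx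
  have h := convexRamp_add_of_one_le (t := Real.log ‖x - p‖ - (τ + T)) (a := T)
    (by linarith [le_log_norm_sub hx]) hT
  rw [logCutoff, logRamp_of_ne _ hne, logRamp_of_ne _ hne]
  convert h using 3
  ring

theorem logCutoff_nonneg (p : E2) (τ : ℝ) {T : ℝ} (hT : 0 ≤ T) (x : E2) :
    0 ≤ logCutoff p τ T x := by
  by_cases hx : x = p
  · exact (logCutoff_of_le hT (by simp [hx, exp_nonneg])).ge
  · rw [logCutoff, logRamp_of_ne _ hx, logRamp_of_ne _ hx, sub_nonneg]
    exact monotone_convexRamp (by linarith)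

theorem logCutoff_le (p : E2) (τ : ℝ) {T : ℝ} (hT : 0 ≤ T) (x : E2) : logCutoff p τ T x ≤ T := by
  by_cases hx : x = p
  · exact (logCutoff_of_le hT (by simp [hx, exp_nonneg])).trans_le hT
  · rw [logCutoff, logRamp_of_ne _ hx, logRamp_of_ne _ hx]
    convert convexRamp_add_sub_le (Real.log ‖x - p‖ - (τ + T)) hT using 3
    ring

section PuncturedCutoff

variable {m : ℕ} {p : Fin m → E2}

/-- A test function equal to `T` on the ball of radius `exp τ` about the origin, with logarithmic
holes of outer radius `exp (-s + 1)` cut out around the points `p j`. -/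
def puncturedCutoff (p : Fin m → E2) (τ T s : ℝ) (x : E2) : ℝ :=
  T + ((-1) * logCutoff 0 τ T x + ∑ j, T / s * (-s + logCutoff (p j) (-(2 * s)) s x))

theorem contDiff_puncturedCutoff (p : Fin m → E2) (τ T s : ℝ) :
    ContDiff ℝ 2 (puncturedCutoff p τ T s) :=
  contDiff_const.add ((contDiff_const.mul (contDiff_logCutoff 0 τ T)).add
    (ContDiff.sum fun j _ => contDiff_const.mul
      (contDiff_const.add (contDiff_logCutoff (p j) (-(2 * s)) s))))

theorem lap_puncturedCutoff (p : Fin m → E2) (τ T s : ℝ) (x : E2) :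
    lap (puncturedCutoff p τ T s) x =
      annulusDensity 0 (τ + T) x - annulusDensity 0 τ x +
        ∑ j, T / s * (annulusDensity (p j) (-(2 * s)) x - annulusDensity (p j) (-s) x) := by
  have h1 := contDiff_logCutoff (0 : E2) τ T
  have h2 (j : Fin m) := contDiff_logCutoff (p j) (-(2 * s)) s
  have h3 (j : Fin m) : ContDiff ℝ 2 fun y => -s + logCutoff (p j) (-(2 * s)) s y :=
    contDiff_const.add (h2 j)
  have h4 (j : Fin m) : ContDiff ℝ 2 fun y => T / s * (-s + logCutoff (p j) (-(2 * s)) s y) :=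
    contDiff_const.mul (h3 j)
  have h5 : lap (puncturedCutoff p τ T s) x = _ := lap_add contDiff_const
    ((contDiff_const.mul h1).add (ContDiff.sum fun j _ => h4 j)) x
  rw [h5, lap_const, lap_add (contDiff_const.mul h1) (ContDiff.sum fun j _ => h4 j),
    lap_const_mul h1, lap_logCutoff, lap_sum _ h4]
  have h6 (j : Fin m) : lap (fun y => T / s * (-s + logCutoff (p j) (-(2 * s)) s y)) x =
      T / s * (annulusDensity (p j) (-(2 * s)) x - annulusDensity (p j) (-s) x) := by
    rw [lap_const_mul (h3 j), lap_add contDiff_const (h2 j), lap_const, lap_logCutoff,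
      show -(2 * s) + s = -s by ring, zero_add]
  simp only [h6]
  ring

theorem puncturedCutoff_le (p : Fin m → E2) (τ : ℝ) {T s : ℝ} (hT : 0 ≤ T) (hs : 0 < s) (x : E2) :
    puncturedCutoff p τ T s x ≤ T := by
  have h1 := logCutoff_nonneg 0 τ hT x
  have h2 : ∑ j, T / s * (-s + logCutoff (p j) (-(2 * s)) s x) ≤ 0 :=
    Finset.sum_nonpos fun j _ => mul_nonpos_of_nonneg_of_nonpos (by positivity)
      (by linarith [logCutoff_le (p j) (-(2 * s)) hs.le x])
  rw [puncturedCutoff]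
  linarith

theorem puncturedCutoff_of_ge {τ T s : ℝ} (hp : ∀ j, ‖p j‖ + 1 ≤ exp τ) (hT : 0 ≤ T)
    (hs : 1 ≤ s) {x : E2} (hx : exp (τ + T + 1) ≤ ‖x‖) : puncturedCutoff p τ T s x = 0 := by
  have h (j : Fin m) : logCutoff (p j) (-(2 * s)) s x = s := by
    refine logCutoff_of_ge (by linarith) ?_
    have h1 : exp (-(2 * s) + s + 1) ≤ 1 := exp_le_one_iff.2 (by linarith)
    have h2 : exp τ ≤ exp (τ + T + 1) := exp_le_exp.2 (by linarith)
    linarith [hp j, norm_sub_norm_le x (p j)]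
  rw [puncturedCutoff, logCutoff_of_ge hT (by simpa using hx)]
  simp [h]

theorem hasCompactSupport_puncturedCutoff {τ T s : ℝ} (hp : ∀ j, ‖p j‖ + 1 ≤ exp τ) (hT : 0 ≤ T)
    (hs : 1 ≤ s) : HasCompactSupport (puncturedCutoff p τ T s) :=
  HasCompactSupport.of_support_subset_isCompact (isCompact_closedBall 0 (exp (τ + T + 1)))
    fun x hx => by
      by_contra h
      rw [mem_closedBall_zero_iff, not_le] at h
      exact hx (puncturedCutoff_of_ge hp hT hs h.le)

theorem puncturedCutoff_of_near {τ T s : ℝ} (hp : ∀ j, ‖p j‖ + 1 ≤ exp τ) (hT : 0 ≤ T)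
    (hs : 1 ≤ s) (hsep : ∀ i j, i ≠ j → 2 * exp (-s + 1) ≤ ‖p i - p j‖) {i : Fin m} {x : E2}
    (hx : ‖x - p i‖ ≤ exp (-(2 * s))) : puncturedCutoff p τ T s x = 0 := by
  have h0 : logCutoff 0 τ T x = 0 := by
    refine logCutoff_of_le hT ?_
    have h1 : exp (-(2 * s)) ≤ 1 := exp_le_one_iff.2 (by linarith)
    rw [sub_zero]
    linarith [hp i, norm_sub_norm_le x (p i)]
  have hi : logCutoff (p i) (-(2 * s)) s x = 0 := logCutoff_of_le (by linarith) hx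
  have hj (j : Fin m) (hj : j ≠ i) : logCutoff (p j) (-(2 * s)) s x = s := by
    refine logCutoff_of_ge (by linarith) ?_
    have h1 : exp (-(2 * s)) ≤ exp (-s + 1) := exp_le_exp.2 (by linarith)
    have h2 := norm_sub_le_norm_sub_add_norm_sub (p i) x (p j)
    rw [norm_sub_rev (p i) x] at h2
    rw [show -(2 * s) + s + 1 = -s + 1 by ring]
    linarith [hsep i j hj.symm]
  rw [puncturedCutoff, h0, Finset.sum_eq_single i (fun j _ hji => by rw [hj j hji]; simp)
    (by simp), hi]
  have : s ≠ 0 := by linarith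
  field_simp
  ring

theorem tsupport_puncturedCutoff_subset {τ T s : ℝ} (hp : ∀ j, ‖p j‖ + 1 ≤ exp τ) (hT : 0 ≤ T)
    (hs : 1 ≤ s) (hsep : ∀ i j, i ≠ j → 2 * exp (-s + 1) ≤ ‖p i - p j‖) :
    tsupport (puncturedCutoff p τ T s) ⊆ (Set.range p)ᶜ := by
  rintro x hx ⟨i, rfl⟩
  refine notMem_tsupport_iff_eventuallyEq.2 ?_ hx
  filter_upwards [eventually_norm_sub_le (p i) (-(2 * s))] with y hy
  exact puncturedCutoff_of_near hp hT hs hsep hy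

/-- For a singular Liouville solution, the mean of `u` over the annulus of radius `exp (τ + T)`
decreases at most linearly in `T`, with slope governed by the total mass. -/
theorem exists_le_integral_mul_annulusDensity (hp : Function.Injective p) {γ : Fin m → ℝ}
    (hγ : ∀ j, 0 < γ j) {u : E2 → ℝ} (hreg : ContDiffOn ℝ 2 u ((Set.range p)ᶜ))
    (hpde : ∀ x : E2, x ∉ Set.range p → lap u x + 2 * exp (u x) = 0)
    (hsing : ∀ j, ∃ ε > (0:ℝ), ∃ M : ℝ, ∀ x : E2, x ≠ p j → dist x (p j) < ε →
      |u x - 2 * γ j * Real.log ‖x - p j‖| ≤ M)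
    (hint : Integrable (fun x : E2 => exp (u x))) {τ : ℝ} (hτ : ∀ j, ‖p j‖ + 1 ≤ exp τ) :
    ∃ C, ∀ T, 0 ≤ T → C + T * (4 * π * ∑ j, γ j - 2 * ∫ x, exp (u x)) ≤
      ∫ x, u x * annulusDensity 0 (τ + T) x := by
  have hU : IsOpen (Set.range p)ᶜ := (Set.finite_range p).isClosed.isOpen_compl
  choose ε hε M hM using hsing
  have hfar {T : ℝ} (hT : 0 ≤ T) :
      Integrable fun x => u x * annulusDensity 0 (τ + T) x := by
    refine integrable_mul_annulusDensity hU hreg.continuousOn ?_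
    rintro x hx - ⟨j, rfl⟩
    rw [sub_zero] at hx
    linarith [hτ j, exp_le_exp.2 (le_add_of_nonneg_right hT : τ ≤ τ + T)]
  refine ⟨(∫ x, u x * annulusDensity 0 τ x) - ∑ j, 4 * π * (M j + 2 * γ j), fun T hT => ?_⟩
  have hlim : Tendsto (fun s : ℝ => exp (-s + 1)) atTop (𝓝 0) :=
    tendsto_exp_atBot.comp (tendsto_atBot_add_const_right _ _ tendsto_neg_atTop_atBot)
  have hev : ∀ᶠ s : ℝ in atTop, (∀ j, exp (-s + 1) < ε j) ∧
      (∀ i j, i ≠ j → 2 * exp (-s + 1) ≤ ‖p i - p j‖) ∧ 1 ≤ s ∧ T ≤ s := by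
    refine (eventually_all.2 fun j => hlim.eventually_lt_const (hε j)).and
      ((eventually_all.2 fun i => eventually_all.2 fun j => ?_).and
        ((eventually_ge_atTop 1).and (eventually_ge_atTop T)))
    by_cases hij : i = j
    · simp [hij]
    have hd : 0 < ‖p i - p j‖ / 2 := half_pos (norm_pos_iff.2 (sub_ne_zero.2 (hp.ne hij)))
    filter_upwards [hlim.eventually_lt_const hd] with s hs _
    linarith
  obtain ⟨s, hsε, hsep, hs1, hsT⟩ := hev.exists
  have hs0 : 0 < s := by linarith
  have hnear (j : Fin m) {σ : ℝ} (hσ : σ ≤ -s) :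
      Integrable fun x => u x * annulusDensity (p j) σ x := by
    refine integrable_mul_annulusDensity hU hreg.continuousOn ?_
    rintro x hx hx' ⟨i, rfl⟩
    have hij : i ≠ j := by
      rintro rfl
      exact ne_of_exp_le_norm_sub hx rfl
    have h1 : exp (σ + 1) ≤ exp (-s + 1) := exp_le_exp.2 (by linarith)
    linarith [hsep i j hij, exp_pos (-s + 1)]
  have hloc (j : Fin m) {σ : ℝ} (hσ : σ ≤ -s) := abs_integral_mul_annulusDensity_le (hγ j).le
    ((exp_le_exp.2 (by linarith : σ + 1 ≤ -s + 1)).trans_lt (hsε j)) (hM j) (hnear j hσ)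
  have h2s : -(2 * s) ≤ -s := by linarith
  have hjump (j : Fin m) : T / s * ((∫ x, u x * annulusDensity (p j) (-(2 * s)) x) -
      ∫ x, u x * annulusDensity (p j) (-s) x) ≤
      4 * π * (M j + 2 * γ j) - T * (4 * π * γ j) := by
    have ha := (abs_le.1 (hloc j h2s)).2
    have hb := (abs_le.1 (hloc j le_rfl)).1
    have hc : 0 ≤ 2 * π * (M j + 2 * γ j) := (abs_nonneg _).trans (hloc j le_rfl)
    have hTs : T / s ≤ 1 := (div_le_one hs0).2 hsT
    have hTs0 : 0 ≤ T / s := div_nonneg hT hs0.le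
    calc _ ≤ T / s * (4 * π * (M j + 2 * γ j) - s * (4 * π * γ j)) :=
          mul_le_mul_of_nonneg_left (by linarith) hTs0
      _ = T / s * (4 * π * (M j + 2 * γ j)) - T * (4 * π * γ j) := by field_simp
      _ ≤ _ := by nlinarith
  have hgreen := integral_mul_lap hU hreg (contDiff_puncturedCutoff p τ T s)
    (hasCompactSupport_puncturedCutoff hτ hT hs1)
    (tsupport_puncturedCutoff_subset hτ hT hs1 hsep)
  have hleft : ∫ x, u x * lap (puncturedCutoff p τ T s) x =
      (∫ x, u x * annulusDensity 0 (τ + T) x) - (∫ x, u x * annulusDensity 0 τ x) +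
        ∑ j, T / s * ((∫ x, u x * annulusDensity (p j) (-(2 * s)) x) -
          ∫ x, u x * annulusDensity (p j) (-s) x) := by
    have hτi : Integrable fun x => u x * annulusDensity 0 τ x := by simpa using hfar le_rfl
    have hji (j : Fin m) := ((hnear j h2s).sub (hnear j le_rfl)).const_mul (T / s)
    simp only [Pi.sub_apply] at hji
    have h (j : Fin m) : ∫ x, T / s * (u x * annulusDensity (p j) (-(2 * s)) x -
        u x * annulusDensity (p j) (-s) x) = T / s * ((∫ x, u x * annulusDensity (p j)
          (-(2 * s)) x) - ∫ x, u x * annulusDensity (p j) (-s) x) := by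
      rw [integral_const_mul, integral_sub (hnear j h2s) (hnear j le_rfl)]
    rw [← integral_sub (hfar hT) hτi, ← Finset.sum_congr rfl fun j _ => h j,
      ← integral_finsetSum _ fun j _ => hji j]
    refine Eq.trans (integral_congr_ae (Eventually.of_forall fun x => ?_))
      (integral_add ((hfar hT).sub hτi) (integrable_finsetSum _ fun j _ => hji j))
    simp only [lap_puncturedCutoff, mul_add, mul_sub, Finset.mul_sum]
    congr 1
    exact Finset.sum_congr rfl fun j _ => by ring
  have hright : -(2 * T * ∫ x, exp (u x)) ≤ ∫ x, lap u x * puncturedCutoff p τ T s x := by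
    rw [← neg_mul, ← integral_const_mul]
    refine integral_mono (hint.const_mul _) (integrable_mul_of_tsupport_subset hU
      (continuousOn_lap hU hreg) (contDiff_puncturedCutoff p τ T s).continuous
      (hasCompactSupport_puncturedCutoff hτ hT hs1)
      (tsupport_puncturedCutoff_subset hτ hT hs1 hsep)) fun x => ?_
    simp only
    by_cases hx : x ∈ Set.range p
    · obtain ⟨i, rfl⟩ := hx
      rw [puncturedCutoff_of_near hτ hT hs1 hsep (i := i) (by simp [exp_nonneg]), mul_zero]
      nlinarith [mul_nonneg hT (exp_nonneg (u (p i)))]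
    · rw [eq_neg_of_add_eq_zero_left (hpde x hx)]
      nlinarith [mul_le_mul_of_nonneg_right (puncturedCutoff_le p τ hT hs0 x) (exp_nonneg (u x))]
  have hsum := Finset.sum_le_sum fun j (_ : j ∈ Finset.univ) => hjump j
  rw [Finset.sum_sub_distrib, ← Finset.mul_sum _ _ T, ← Finset.mul_sum _ γ (4 * π)] at hsum
  linarith

end PuncturedCutoff

/-- Jensen's inequality for the exponential against `annulusDensity`. -/
theorem exp_le_integral_exp_mul_annulusDensity {u : E2 → ℝ} {p : E2} {τ a : ℝ}
    (hi : Integrable fun x => u x * annulusDensity p τ x)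
    (he : Integrable fun x => exp (u x) * annulusDensity p τ x)
    (ha : 2 * π * a ≤ ∫ x, u x * annulusDensity p τ x) :
    2 * π * exp a ≤ ∫ x, exp (u x) * annulusDensity p τ x := by
  have hρ := integrable_annulusDensity p τ
  calc 2 * π * exp a
      ≤ exp a * ((∫ x, u x * annulusDensity p τ x) + (1 - a) * (2 * π)) := by
        nlinarith [exp_pos a]
    _ = ∫ x, exp a * (u x * annulusDensity p τ x + (1 - a) * annulusDensity p τ x) := by
        rw [integral_const_mul, integral_add hi (hρ.const_mul _), integral_const_mul,
          integral_annulusDensity]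
    _ ≤ _ := by
        refine integral_mono ((hi.add (hρ.const_mul _)).const_mul _) he fun x => ?_
        have h : exp a * (u x - a + 1) ≤ exp (u x) := by
          have h1 := mul_le_mul_of_nonneg_left (add_one_le_exp (u x - a)) (exp_nonneg a)
          rwa [← exp_add, add_sub_cancel] at h1
        linarith [mul_le_mul_of_nonneg_right h (annulusDensity_nonneg p τ x)]

/-- The density `annulusDensity 0 τ` is of size at most `M * exp (-2 * τ)` and vanishes inside the
ball of radius `exp τ`. -/
theorem integral_mul_annulusDensity_le {M : ℝ} (hM : ∀ t, deriv smoothTransition t ≤ M)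
    {f : E2 → ℝ} (hf : Integrable f) (hf0 : ∀ x, 0 ≤ f x) {τ : ℝ}
    (hi : Integrable fun x => f x * annulusDensity 0 τ x) :
    ∫ x, f x * annulusDensity 0 τ x ≤ M * exp (-2 * τ) * ∫ x in {x | exp τ ≤ ‖x‖}, f x := by
  have hS : MeasurableSet {x : E2 | exp τ ≤ ‖x‖} :=
    (isClosed_le continuous_const continuous_norm).measurableSet
  rw [← integral_const_mul, ← integral_indicator hS]
  refine integral_mono hi ((hf.const_mul _).indicator hS) fun x => ?_
  by_cases hx : exp τ ≤ ‖x‖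
  · rw [Set.indicator_of_mem (by exact hx)]
    simp only
    rw [mul_comm (f x)]
    exact mul_le_mul_of_nonneg_right (annulusDensity_le hM 0 τ x) (hf0 x)
  · rw [Set.indicator_of_notMem (by exact hx)]
    simp only
    rw [annulusDensity_of_le (by simpa using (not_le.1 hx).le), mul_zero]

theorem tendsto_setIntegral_exp_le_norm {f : E2 → ℝ} (hf : Integrable f) :
    Tendsto (fun τ : ℝ => ∫ x in {x | exp τ ≤ ‖x‖}, f x) atTop (𝓝 0) := by
  have h := tendsto_setIntegral_of_antitone (μ := volume) (f := f)
    (s := fun τ : ℝ => {x : E2 | exp τ ≤ ‖x‖})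
    (fun τ => (isClosed_le continuous_const continuous_norm).measurableSet)
    (fun _ _ hab _ hx => (exp_le_exp.2 hab).trans hx) ⟨0, hf.integrableOn⟩
  have hempty : ⋂ τ : ℝ, {x : E2 | exp τ ≤ ‖x‖} = ∅ := by
    refine Set.eq_empty_of_forall_notMem fun x hx => ?_
    have hx' : exp ‖x‖ ≤ ‖x‖ := Set.mem_iInter.1 hx ‖x‖
    linarith [add_one_le_exp ‖x‖]
  simpa [hempty] using h

/-- A finite-energy solution of `Δu + 2eᵘ = 4π Σⱼ γⱼ δ_{pⱼ}` with positive strengths `γⱼ`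
has total mass `(1/(2π)) ∫ eᵘ > Σⱼ γⱼ + 1`; in particular if `Σⱼ γⱼ = 8` the mass
exceeds `9`. -/
theorem singular_liouville_mass_lower_bound
    (m : ℕ) (p : Fin m → E2) (hp : Function.Injective p)
    (γ : Fin m → ℝ) (hγ : ∀ j, 0 < γ j)
    (u : E2 → ℝ)
    (hreg : ContDiffOn ℝ 2 u ((Set.range p)ᶜ))
    (hpde : ∀ x : E2, x ∉ Set.range p → lap u x + 2 * exp (u x) = 0)
    (hsing : ∀ j, ∃ ε > (0:ℝ), ∃ M : ℝ, ∀ x : E2, x ≠ p j → dist x (p j) < ε →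
      |u x - 2 * γ j * Real.log ‖x - p j‖| ≤ M)
    (hint : Integrable (fun x : E2 => exp (u x))) :
    (1 / (2 * π)) * (∫ x : E2, exp (u x)) > (∑ j, γ j) + 1 ∧
    ((∑ j, γ j) = 8 → (1 / (2 * π)) * (∫ x : E2, exp (u x)) > 9) := by
  have main : (1 / (2 * π)) * (∫ x : E2, exp (u x)) > (∑ j, γ j) + 1 := by
    by_contra! hcon
    have hmass : ∫ x, exp (u x) ≤ 2 * π * ((∑ j, γ j) + 1) := by
      rwa [one_div, inv_mul_le_iff₀ (by positivity)] at hcon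
    obtain ⟨τ, hτ⟩ : ∃ τ : ℝ, ∀ j, ‖p j‖ + 1 ≤ exp τ :=
      (eventually_all.2 fun j => tendsto_exp_atTop.eventually_ge_atTop (‖p j‖ + 1)).exists
    obtain ⟨C, hC⟩ := exists_le_integral_mul_annulusDensity hp hγ hreg hpde hsing hint hτ
    obtain ⟨M, hM0, hM⟩ := exists_deriv_smoothTransition_le
    have hU : IsOpen (Set.range p)ᶜ := (Set.finite_range p).isClosed.isOpen_compl
    have htail : ∀ᶠ t : ℝ in atTop, 2 * π / M * exp (C / (2 * π) + 2 * τ) ≤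
        ∫ x in {x : E2 | exp t ≤ ‖x‖}, exp (u x) := by
      filter_upwards [eventually_ge_atTop τ] with t ht
      have hmem : ∀ x : E2, exp t ≤ ‖x - 0‖ → ‖x - 0‖ ≤ exp (t + 1) → x ∈ (Set.range p)ᶜ := by
        rintro x hx - ⟨j, rfl⟩
        rw [sub_zero] at hx
        linarith [hτ j, exp_le_exp.2 ht]
      have hi := integrable_mul_annulusDensity hU hreg.continuousOn hmem
      have he := integrable_mul_annulusDensity hU hreg.continuousOn.rexp hmem
      have hT := hC (t - τ) (sub_nonneg.2 ht)
      rw [add_sub_cancel] at hT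
      have hmean : 2 * π * (C / (2 * π) - 2 * (t - τ)) ≤ ∫ x, u x * annulusDensity 0 t x := by
        refine le_trans ?_ hT
        rw [mul_sub, mul_div_cancel₀ _ (by positivity)]
        nlinarith [mul_le_mul_of_nonneg_left hmass (sub_nonneg.2 ht)]
      have h := (exp_le_integral_exp_mul_annulusDensity hi he hmean).trans
        (integral_mul_annulusDensity_le hM hint (fun x => exp_nonneg _) he)
      have hexp : exp (C / (2 * π) - 2 * (t - τ)) =
          exp (C / (2 * π) + 2 * τ) * exp (-2 * t) := by
        rw [← exp_add]
        ring_nf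
      rw [hexp, ← mul_assoc, mul_right_comm M] at h
      rw [div_mul_eq_mul_div, div_le_iff₀ hM0, mul_comm _ M]
      exact le_of_mul_le_mul_right h (exp_pos _)
    have hpos : 0 < 2 * π / M * exp (C / (2 * π) + 2 * τ) := by positivity
    exact hpos.not_ge (ge_of_tendsto (tendsto_setIntegral_exp_le_norm hint) htail)
  exact ⟨main, fun h8 => by linarith⟩
end
end
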